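/- Assume the Riemann Hypothesis and that all nontrivial zeros of the Riemann zeta function are simple. Let k = a/b ≥ 0 be a fixed rational number (a, b positive integers, or k = 0). Then there exist a constant c > 0 and T₀ > 0 (depending on a, b) such that for all T ≥ T₀, the discrete negative moment J_{-k}(T) = ∑_{0 < γ ≤ T} |ζ′(ρ)|^{-2k}, where the sum runs over the nontrivial zeros ρ = 1/2 + iγ of ζ with ordinates 0 < γ ≤ T, satisfies J_{-k}(T) ≥ c · T (log T)^{(k-1)²}. -/

import Mathlib

open Complex Filter

/-- The discrete negative `2k`-th moment of `ζ'` over the nontrivial zeros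
`ρ` of the Riemann zeta function with ordinate `0 < Im ρ ≤ T`:
`J_{-k}(T) = ∑_{0 < γ ≤ T} |ζ'(ρ)|^{-2k}`. -/
noncomputable def negativeMoment (k T : ℝ) : ℝ :=
  ∑' ρ : {ρ : ℂ // riemannZeta ρ = 0 ∧ 0 < ρ.re ∧ ρ.re < 1 ∧ 0 < ρ.im ∧ ρ.im ≤ T},
    ‖deriv riemannZeta (ρ : ℂ)‖ ^ (-(2 * k))

open MeasureTheory Set Topology Asymptotics in
theorem evenKernel_modif_exp_integrable : ∃ p : ℝ, 0 < p ∧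
    IntegrableOn (fun x : ℝ => Real.exp (p * x) *
      ‖(HurwitzZeta.hurwitzEvenFEPair 0).f_modif x‖) (Ioi 1) := by
  obtain ⟨p, hp, hO⟩ := HurwitzZeta.isBigO_atTop_evenKernel_sub 0
  refine ⟨p / 2, by positivity, ?_⟩
  set P := HurwitzZeta.hurwitzEvenFEPair 0 with hP
  have hmod : ∀ x ∈ Ioi (1:ℝ), P.f_modif x = P.f x - P.f₀ := by
    intro x hx
    have h1 : x ∉ Ioo (0:ℝ) 1 := fun h => absurd h.2 (not_lt.mpr hx.le)
    simp [WeakFEPair.f_modif, hx, h1]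
  have hloc : LocallyIntegrableOn (fun x : ℝ => Real.exp (p/2 * x) * ‖P.f_modif x‖) (Ici 1) := by
    have h0 : LocallyIntegrableOn (fun x => ‖P.f_modif x‖) (Ici (1:ℝ)) :=
      (P.hf_modif_int.mono_set (Ici_subset_Ioi.mpr one_pos)).norm
    refine h0.continuousOn_mul (f := fun x => ‖P.f_modif x‖) (g := fun x => Real.exp (p/2*x)) ?_ ?_
    · fun_prop
    · exact isClosed_Ici.isLocallyClosed
  have hbig : (fun x : ℝ => Real.exp (p/2 * x) * ‖P.f_modif x‖) =O[atTop]
      (fun x => Real.exp (-(p/2) * x)) := by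
    have h2 : (fun x => ‖P.f_modif x‖) =O[atTop] (fun x => Real.exp (-p * x)) := by
      rw [isBigO_norm_left]
      have : P.f_modif =ᶠ[atTop] (fun x => ((HurwitzZeta.evenKernel 0 x - (if (0:UnitAddCircle) = 0 then 1 else 0) : ℝ) : ℂ)) := by
        filter_upwards [eventually_gt_atTop 1] with x hx
        rw [hmod x hx]
        simp [hP, HurwitzZeta.hurwitzEvenFEPair]
      refine this.trans_isBigO ?_
      rw [isBigO_ofReal_left]
      exact hO
    have h3 := (isBigO_refl (fun x : ℝ => Real.exp (p/2 * x)) atTop).mul h2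
    refine h3.congr_right ?_
    intro x
    rw [← Real.exp_add]; congr 1; ring
  have hint : IntegrableOn (fun x : ℝ => Real.exp (p/2 * x) * ‖P.f_modif x‖) (Ici 1) :=
    hloc.integrableOn_of_isBigO_atTop hbig
      ⟨Ioi 0, Ioi_mem_atTop 0, by simpa using integrableOn_exp_mul_Ioi (a := -(p/2)) (by linarith) 0⟩
  exact hint.mono_set Ioi_subset_Ici_self

theorem rpow_le_factorial_mul_exp {x p u : ℝ} {n : ℕ} (hx : 1 ≤ x) (hp : 0 < p) (hu : u ≤ n) :
    x ^ u ≤ n.factorial * (1 / p) ^ n * Real.exp (p * x) := by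
  have h1 : x ^ u ≤ x ^ n := by
    rw [← Real.rpow_natCast]; exact Real.rpow_le_rpow_of_exponent_le hx hu
  have h2 : (p * x) ^ n / n.factorial ≤ Real.exp (p * x) :=
    Real.pow_div_factorial_le_exp _ (by positivity) n
  have h3 : x ^ n = n.factorial * (1 / p) ^ n * ((p * x) ^ n / n.factorial) := by
    have : (n.factorial : ℝ) ≠ 0 := by positivity
    rw [mul_pow, one_div, inv_pow]
    field_simp
  rw [h3] at h1
  refine h1.trans (by gcongr)

open MeasureTheory Set Topology Asymptotics in
theorem completedRiemannZeta0_norm_le_factorial : ∃ C K : ℝ, 0 < C ∧ 1 ≤ K ∧ ∀ (s : ℂ) (n : ℕ),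
    1 / 2 ≤ s.re → s.re ≤ n → ‖completedRiemannZeta₀ s‖ ≤ C * n.factorial * K ^ n := by
  obtain ⟨p, hp, hI⟩ := evenKernel_modif_exp_integrable
  set P := HurwitzZeta.hurwitzEvenFEPair 0 with hP
  set f := P.f_modif with hf
  have hconv : ∀ s : ℂ, MellinConvergent f s := fun s =>
    ((P.isStrongFEPair_toStrongFEPair).hasMellin s).1
  have h14 : IntegrableOn (fun x : ℝ => x ^ ((1:ℝ)/4 - 1) * ‖f x‖) (Ioi 0) := by
    have := (hconv ((1/4 : ℝ) : ℂ)).norm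
    refine IntegrableOn.congr_fun this ?_ measurableSet_Ioi
    intro x hx
    simp only [norm_smul]
    rw [Complex.norm_cpow_eq_rpow_re_of_pos hx]
    simp
  set A := ∫ x in Ioc (0:ℝ) 1, x ^ ((1:ℝ)/4 - 1) * ‖f x‖ with hA
  set B := ∫ x in Ioi (1:ℝ), Real.exp (p * x) * ‖f x‖ with hB
  have hA0 : 0 ≤ A := setIntegral_nonneg measurableSet_Ioc
    (fun x hx => mul_nonneg (Real.rpow_nonneg hx.1.le _) (norm_nonneg _))
  have hB0 : 0 ≤ B := setIntegral_nonneg measurableSet_Ioi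
    (fun x hx => by positivity)
  refine ⟨A + B + 1, max 1 (1/p), by positivity, le_max_left _ _, ?_⟩
  intro s n hs hn
  set u := s.re / 2 with hu
  have hint : IntegrableOn (fun x : ℝ => x ^ (u - 1) * ‖f x‖) (Ioi 0) := by
    have := (hconv (s/2)).norm
    refine IntegrableOn.congr_fun this ?_ measurableSet_Ioi
    intro x hx
    simp only [norm_smul]
    rw [Complex.norm_cpow_eq_rpow_re_of_pos hx]
    simp [hu]
  have hle : ‖completedRiemannZeta₀ s‖ ≤ (∫ x in Ioi (0:ℝ), x ^ (u - 1) * ‖f x‖) := by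
    have h1 : completedRiemannZeta₀ s = mellin f (s / 2) / 2 := rfl
    rw [h1, norm_div]
    have h2 : ‖mellin f (s/2)‖ ≤ ∫ x in Ioi (0:ℝ), x ^ (u - 1) * ‖f x‖ := by
      rw [mellin]
      refine (norm_integral_le_integral_norm _).trans (le_of_eq ?_)
      refine setIntegral_congr_fun measurableSet_Ioi ?_
      intro x hx
      simp only [norm_smul]
      rw [Complex.norm_cpow_eq_rpow_re_of_pos hx]
      simp [hu]
    have h3 : 0 ≤ ∫ x in Ioi (0:ℝ), x ^ (u - 1) * ‖f x‖ := (norm_nonneg _).trans h2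
    simp only [Complex.norm_ofNat]
    linarith
  have hsplit : (∫ x in Ioi (0:ℝ), x ^ (u - 1) * ‖f x‖) =
      (∫ x in Ioc (0:ℝ) 1, x ^ (u - 1) * ‖f x‖) + ∫ x in Ioi (1:ℝ), x ^ (u - 1) * ‖f x‖ := by
    rw [← Ioc_union_Ioi_eq_Ioi (zero_le_one (α := ℝ))]
    refine setIntegral_union (Ioc_disjoint_Ioi le_rfl) measurableSet_Ioi ?_ ?_
    · exact hint.mono_set Ioc_subset_Ioi_self
    · exact hint.mono_set (Ioi_subset_Ioi zero_le_one)
  have hK : (1/p)^n ≤ (max 1 (1/p))^n := by gcongr; exact le_max_right _ _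
  have hK1 : 1 ≤ (max 1 (1/p))^n := one_le_pow₀ (le_max_left _ _)
  have hfac : (1:ℝ) ≤ n.factorial := by exact_mod_cast Nat.one_le_iff_ne_zero.mpr n.factorial_ne_zero
  have i1 : (∫ x in Ioc (0:ℝ) 1, x ^ (u - 1) * ‖f x‖) ≤ A := by
    refine setIntegral_mono_on (hint.mono_set Ioc_subset_Ioi_self)
      (h14.mono_set Ioc_subset_Ioi_self) measurableSet_Ioc ?_
    intro x hx
    exact mul_le_mul_of_nonneg_right
      (Real.rpow_le_rpow_of_exponent_ge hx.1 hx.2 (by linarith)) (norm_nonneg _)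
  have i2 : (∫ x in Ioi (1:ℝ), x ^ (u - 1) * ‖f x‖) ≤ n.factorial * (1/p)^n * B := by
    rw [hB, ← integral_const_mul]
    refine setIntegral_mono_on (hint.mono_set (Ioi_subset_Ioi zero_le_one))
      (hI.const_mul _) measurableSet_Ioi ?_
    intro x hx
    rw [← mul_assoc]
    gcongr
    exact rpow_le_factorial_mul_exp (le_of_lt hx) hp (by linarith)
  set Kn := (max 1 (1/p))^n
  have j1 : A ≤ A * (n.factorial * Kn) :=
    le_mul_of_one_le_right hA0 (one_le_mul_of_one_le_of_one_le hfac hK1)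
  have j2 : n.factorial * (1/p)^n * B ≤ B * (n.factorial * Kn) := by
    rw [mul_comm B]; gcongr
  have j3 : 0 ≤ (n.factorial : ℝ) * Kn := by positivity
  calc _ ≤ _ := hle
    _ ≤ A * (n.factorial * Kn) + B * (n.factorial * Kn) := by rw [hsplit]; linarith
    _ ≤ _ := by nlinarith

theorem exists_entire_factor {f : ℂ → ℂ} (hf : Differentiable ℂ f) (S : Finset ℂ)
    (h0 : (0 : ℂ) ∉ S) (hz : ∀ a ∈ S, f a = 0) :
    ∃ g : ℂ → ℂ, Differentiable ℂ g ∧ ∀ z, f z = g z * ∏ a ∈ S, (1 - z / a) := by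
  classical
  induction S using Finset.induction_on with
  | empty => exact ⟨f, hf, by simp⟩
  | insert a S ha ih =>
    obtain ⟨g, hg, hfg⟩ := ih (fun h => h0 (Finset.mem_insert_of_mem h))
      (fun b hb => hz b (Finset.mem_insert_of_mem hb))
    have ha0 : a ≠ 0 := fun h => h0 (h ▸ Finset.mem_insert_self _ _)
    have hga : g a = 0 := by
      have h1 := hz a (Finset.mem_insert_self _ _)
      rw [hfg a] at h1
      refine (mul_eq_zero.mp h1).resolve_right ?_
      refine Finset.prod_ne_zero_iff.mpr ?_
      intro b hb hab
      have hb0 : b ≠ 0 := fun h => h0 (h ▸ Finset.mem_insert_of_mem hb)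
      have : a = b := by
        have := sub_eq_zero.mp hab
        field_simp at this
        exact this.symm
      exact ha (this ▸ hb)
    refine ⟨fun z => -a * dslope g a z, ?_, ?_⟩
    · refine Differentiable.const_mul ?_ _
      have := (Complex.differentiableOn_dslope (f := g) (s := Set.univ) (c := a) univ_mem).mpr
        hg.differentiableOn
      exact differentiableOn_univ.mp this
    · intro z
      have h1 := sub_smul_dslope g a z
      rw [hga, sub_zero, smul_eq_mul] at h1
      rw [Finset.prod_insert ha, hfg z, ← h1]
      field_simp
      ring

open Metric in
theorem exists_log_of_ne_zero {g : ℂ → ℂ} (hg : Differentiable ℂ g) {R : ℝ} (hR : 0 < R)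
    (h0 : ∀ z ∈ ball (0:ℂ) R, g z ≠ 0) :
    ∃ h : ℂ → ℂ, (∀ z ∈ ball (0:ℂ) R, HasDerivAt h (deriv g z / g z) z) ∧ h 0 = 0 ∧
      ∀ z ∈ ball (0:ℂ) R, g z = g 0 * exp (h z) := by
  have hd : DifferentiableOn ℂ (fun z => deriv g z / g z) (ball 0 R) := by
    refine DifferentiableOn.div ?_ hg.differentiableOn h0
    exact hg.differentiableOn.deriv isOpen_ball
  have hex := DifferentiableOn.isExactOn_ball hd
  obtain ⟨h, h00, hh⟩ := hex.with_val_at 0 0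
  have hh' : ∀ z ∈ ball (0:ℂ) R, HasDerivAt h (deriv g z / g z) z := fun z hz => hh z hz
  refine ⟨h, hh', h00, ?_⟩
  have hder : ∀ z ∈ ball (0:ℂ) R, HasDerivAt (fun z => g z * exp (- h z)) 0 z := by
    intro z hz
    have h1 := (hg z).hasDerivAt.mul ((hh' z hz).neg.cexp)
    refine h1.congr_deriv ?_
    have := h0 z hz
    simp only [Pi.neg_apply]
    field_simp
    ring
  intro z hz
  have hconst := (convex_ball (0:ℂ) R).is_const_of_fderivWithin_eq_zero (𝕜 := ℂ)
    (f := fun z => g z * exp (- h z))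
    (fun z hz => (hder z hz).differentiableAt.differentiableWithinAt)
    (fun z hz => by
      rw [fderivWithin_of_isOpen isOpen_ball hz]
      have := (hder z hz).hasFDerivAt.fderiv
      rw [this]; ext; simp) hz (mem_ball_self hR)
  simp only [h00, neg_zero, exp_zero, mul_one] at hconst
  rw [← hconst, mul_assoc, ← exp_add]; simp

open Metric in
theorem norm_logDeriv_sub_le {g : ℂ → ℂ} (hg : Differentiable ℂ g) {R K : ℝ} (hR : 0 < R)
    (hK : 0 < K) (h0 : ∀ z ∈ ball (0:ℂ) R, g z ≠ 0)
    (hb : ∀ z ∈ ball (0:ℂ) R, ‖g z‖ ≤ ‖g 0‖ * Real.exp K) {z : ℂ} (hz : ‖z‖ ≤ R / 8) :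
    ‖deriv g z / g z - deriv g 0 / g 0‖ ≤ 64 * K / R ^ 2 * ‖z‖ := by
  obtain ⟨h, hh, h00, hexp⟩ := exists_log_of_ne_zero hg hR h0
  have hdiff : DifferentiableOn ℂ h (ball 0 R) :=
    fun z hz => (hh z hz).differentiableAt.differentiableWithinAt
  have hre : Set.MapsTo h (ball 0 R) {z | z.re ≤ K} := by
    intro z hz
    have h1 := hb z hz
    rw [hexp z hz, norm_mul, Complex.norm_exp] at h1
    have h2 : 0 < ‖g 0‖ := norm_pos_iff.mpr (h0 0 (mem_ball_self hR))
    exact Real.exp_le_exp.mp (le_of_mul_le_mul_left h1 h2)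
  have hbound : ∀ w, ‖w‖ ≤ R / 2 → ‖h w‖ ≤ 2 * K := by
    intro w hw
    have hwR : w ∈ ball (0:ℂ) R := by simp; linarith
    refine (Complex.borelCaratheodory_zero hK hdiff hre hR hwR h00).trans ?_
    rw [div_le_iff₀ (by linarith)]
    nlinarith [norm_nonneg w]
  have hd1 : ∀ w, ‖w‖ ≤ R / 4 → ‖deriv h w‖ ≤ 8 * K / R := by
    intro w hw
    have hsub : ∀ v ∈ closedBall w (R/4), ‖v‖ ≤ R / 2 := by
      intro v hv
      rw [mem_closedBall, dist_eq_norm] at hv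
      calc ‖v‖ = ‖(v - w) + w‖ := by ring_nf
        _ ≤ _ := norm_add_le _ _
        _ ≤ _ := by linarith
    have := norm_deriv_le_of_forall_mem_sphere_norm_le (c := w) (R := R/4) (C := 2 * K) (f := h)
      (by positivity) ?_ (fun v hv => hbound v (hsub v (sphere_subset_closedBall hv)))
    · refine this.trans (le_of_eq ?_); field_simp; ring
    · refine DifferentiableOn.diffContOnCl ?_
      refine hdiff.mono ?_
      intro v hv
      have := hsub v (closure_ball_subset_closedBall hv)
      simp; linarith
  have hderdiff : DifferentiableOn ℂ (deriv h) (ball 0 R) := hdiff.deriv isOpen_ball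
  have hd2 : ∀ w, ‖w‖ ≤ R / 8 → ‖deriv (deriv h) w‖ ≤ 64 * K / R ^ 2 := by
    intro w hw
    have hsub : ∀ v ∈ closedBall w (R/8), ‖v‖ ≤ R / 4 := by
      intro v hv
      rw [mem_closedBall, dist_eq_norm] at hv
      calc ‖v‖ = ‖(v - w) + w‖ := by ring_nf
        _ ≤ _ := norm_add_le _ _
        _ ≤ _ := by linarith
    have := norm_deriv_le_of_forall_mem_sphere_norm_le (c := w) (R := R/8) (C := 8 * K / R)
      (f := deriv h)
      (by positivity) ?_ (fun v hv => hd1 v (hsub v (sphere_subset_closedBall hv)))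
    · refine this.trans (le_of_eq ?_); field_simp; ring
    · refine DifferentiableOn.diffContOnCl ?_
      refine hderdiff.mono ?_
      intro v hv
      have := hsub v (closure_ball_subset_closedBall hv)
      simp; linarith
  have hmv := (convex_closedBall (0:ℂ) (R/8)).norm_image_sub_le_of_norm_deriv_le (𝕜 := ℂ)
    (f := deriv h) (C := 64 * K / R^2) (x := 0) (y := z)
    (fun w hw => by
      refine hderdiff.differentiableAt (isOpen_ball.mem_nhds ?_)
      simp at hw ⊢; linarith)
    (fun w hw => hd2 w (by simpa using hw)) (by simp; positivity) (by simpa using hz)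
  rw [sub_zero] at hmv
  have e1 : deriv h z = deriv g z / g z := (hh z (by simp; linarith)).deriv
  have e2 : deriv h 0 = deriv g 0 / g 0 := (hh 0 (by simp; linarith)).deriv
  rwa [e1, e2] at hmv

open Metric in
/-- A quantitative partial fraction expansion of the logarithmic derivative of an entire
function with simple zeros. -/
theorem norm_logDeriv_sub_sum_le {f : ℂ → ℂ} (hf : Differentiable ℂ f) {R K : ℝ} (hR : 0 < R)
    (hK : 0 < K) (hf0 : f 0 ≠ 0) (S : Finset ℂ) (hS : ∀ a, a ∈ S ↔ f a = 0 ∧ ‖a‖ ≤ R)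
    (hsimple : ∀ a ∈ S, deriv f a ≠ 0)
    (hb : ∀ z, ‖z‖ = 3 * R → ‖f z‖ ≤ ‖f 0‖ * Real.exp K) {z : ℂ} (hz : ‖z‖ ≤ R / 8)
    (hfz : f z ≠ 0) :
    ‖(deriv f z / f z - ∑ a ∈ S, 1 / (z - a)) - (deriv f 0 / f 0 - ∑ a ∈ S, 1 / (0 - a))‖
      ≤ 64 * K / R ^ 2 * ‖z‖ := by
  classical
  have h0S : (0 : ℂ) ∉ S := fun h => hf0 ((hS 0).mp h).1
  have hSne : ∀ a ∈ S, a ≠ 0 := fun a ha h => h0S (h ▸ ha)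
  obtain ⟨g, hg, hfg⟩ := exists_entire_factor hf S h0S (fun a ha => ((hS a).mp ha).1)
  set P : ℂ → ℂ := fun z => ∏ a ∈ S, (1 - z / a) with hP
  have hPd : Differentiable ℂ P := by
    rw [hP]; fun_prop
  have hfgP : f = fun z => g z * P z := funext hfg
  have hg0 : g 0 = f 0 := by rw [hfg 0]; simp
  have hgz : ∀ w ∈ ball (0:ℂ) R, g w ≠ 0 := by
    intro w hw hgw
    have hfw : f w = 0 := by rw [hfg w, hgw, zero_mul]
    have hwS : w ∈ S := (hS w).mpr ⟨hfw, by simpa using (mem_ball_zero_iff.mp hw).le⟩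
    have hPw : P w = 0 := by
      rw [hP]; exact Finset.prod_eq_zero hwS (by rw [div_self (hSne w hwS), sub_self])
    apply hsimple w hwS
    rw [hfgP]
    have := ((hg w).hasDerivAt.mul (hPd w).hasDerivAt).deriv
    have h2 : (g * P) = fun z => g z * P z := rfl
    rw [h2] at this
    rw [this, hgw, hPw]; simp
  have hgb : ∀ w ∈ ball (0:ℂ) R, ‖g w‖ ≤ ‖g 0‖ * Real.exp K := by
    intro w hw
    refine Complex.norm_le_of_forall_mem_frontier_norm_le (U := ball 0 (3*R)) isBounded_ball
      hg.diffContOnCl ?_ (subset_closure ?_)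
    · intro v hv
      rw [frontier_ball _ (by positivity), mem_sphere_zero_iff_norm] at hv
      have h1 := hb v hv
      rw [hfg v, norm_mul] at h1
      have h2 : 1 ≤ ‖P v‖ := by
        rw [hP]; simp only [norm_prod]
        refine Finset.one_le_prod ?_
        intro a ha
        have h3 : ‖a‖ ≤ R := ((hS a).mp ha).2
        have h4 : 0 < ‖a‖ := norm_pos_iff.mpr (hSne a ha)
        have h5 : 3 ≤ ‖v / a‖ := by
          rw [norm_div, hv, le_div_iff₀ h4]; linarith
        have h6 := norm_sub_norm_le (v / a) 1
        rw [norm_sub_rev] at h6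
        rw [norm_one] at h6
        linarith
      rw [hg0]
      exact (le_mul_of_one_le_right (norm_nonneg _) h2).trans h1
    · simp at hw ⊢; linarith
  have key : ∀ w, f w ≠ 0 → deriv g w / g w = deriv f w / f w - ∑ a ∈ S, 1 / (w - a) := by
    intro w hw
    have hgw : g w ≠ 0 := fun h => hw (by rw [hfg w, h, zero_mul])
    have hPw : P w ≠ 0 := fun h => hw (by rw [hfg w]; change g w * P w = 0; rw [h, mul_zero])
    have h1 : logDeriv f w = logDeriv g w + logDeriv P w := by
      rw [hfgP]; exact logDeriv_mul w hgw hPw (hg w) (hPd w)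
    have h2 : logDeriv P w = ∑ a ∈ S, 1 / (w - a) := by
      have hne : ∀ a ∈ S, (1 - w / a) ≠ 0 := Finset.prod_ne_zero_iff.mp hPw
      rw [hP, logDeriv_prod hne (fun a ha => by fun_prop)]
      refine Finset.sum_congr rfl fun a ha => ?_
      have ha0 := hSne a ha
      have hwa : w - a ≠ 0 := by
        intro h
        apply hne a ha
        rw [sub_eq_zero.mp h, div_self ha0, sub_self]
      have hd : HasDerivAt (fun z : ℂ => 1 - z / a) (-(1 / a)) w := by
        simpa using ((hasDerivAt_id w).div_const a).const_sub 1
      rw [logDeriv_apply, hd.deriv]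
      have : 1 - w / a = - ((w - a) / a) := by field_simp; ring
      rw [this]; field_simp
    simp only [logDeriv_apply] at h1 h2
    rw [h1, ← h2]; simp
  rw [← key z hfz, ← key 0 hf0]
  exact norm_logDeriv_sub_le hg hR hK hgz hgb hz

/-- The entire function `z ↦ s (s - 1) Λ(s)` with `s = 1/2 + z`. -/
noncomputable def xiFn (z : ℂ) : ℂ :=
  (1 / 2 + z) * (1 / 2 + z - 1) * completedRiemannZeta₀ (1 / 2 + z) + 1

theorem differentiable_xiFn : Differentiable ℂ xiFn := by
  unfold xiFn
  have h := differentiable_completedZeta₀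
  have h2 : Differentiable ℂ (fun z : ℂ => completedRiemannZeta₀ (1/2 + z)) :=
    h.comp (by fun_prop)
  fun_prop

theorem xiFn_neg (z : ℂ) : xiFn (-z) = xiFn z := by
  unfold xiFn
  rw [← completedRiemannZeta₀_one_sub (1/2 + z)]
  rw [show 1 - (1/2 + z) = 1/2 + -z by ring]
  ring

theorem xiFn_eq {z : ℂ} (h0 : 1 / 2 + z ≠ 0) (h1 : 1 / 2 + z ≠ 1) :
    xiFn z = (1 / 2 + z) * (1 / 2 + z - 1) * completedRiemannZeta (1 / 2 + z) := by
  unfold xiFn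
  rw [completedRiemannZeta_eq]
  generalize completedRiemannZeta₀ (1/2 + z) = L
  generalize (1/2 + z) = s at *
  have h2 : 1 - s ≠ 0 := fun h => h1 (sub_eq_zero.mp h).symm
  field_simp
  ring

theorem xiFn_eq_zeta {z : ℂ} (h0 : 0 < (1 / 2 + z).re) (h1 : 1 / 2 + z ≠ 1) :
    xiFn z = (1 / 2 + z) * (1 / 2 + z - 1) * (Gammaℝ (1 / 2 + z) * riemannZeta (1 / 2 + z)) := by
  have hne : 1 / 2 + z ≠ 0 := fun h => by rw [h] at h0; simp at h0
  rw [xiFn_eq hne h1, riemannZeta_def_of_ne_zero hne, mul_div_cancel₀]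
  exact Gammaℝ_ne_zero_of_re_pos h0

theorem xiFn_zero_of_zeta {γ : ℝ} (h : riemannZeta (1 / 2 + γ * I) = 0) : xiFn (γ * I) = 0 := by
  rw [xiFn_eq_zeta (by simp), h]
  · simp
  · intro h; have := congrArg Complex.re h; norm_num at this

theorem zeta_zero_of_xiFn (hRH : RiemannHypothesis) {z : ℂ} (hz : xiFn z = 0) :
    ∃ γ : ℝ, z = γ * I ∧ riemannZeta (1 / 2 + γ * I) = 0 := by
  have key : ∀ z : ℂ, xiFn z = 0 → 1/2 + z ≠ 0 ∧ 1/2 + z ≠ 1 ∧ riemannZeta (1/2 + z) = 0 := by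
    intro z hz
    have h0 : 1/2 + z ≠ 0 := by
      intro h; unfold xiFn at hz; rw [h] at hz; simp at hz
    have h1 : 1/2 + z ≠ 1 := by
      intro h; unfold xiFn at hz; rw [h] at hz; simp at hz
    refine ⟨h0, h1, ?_⟩
    rw [xiFn_eq h0 h1] at hz
    have := (mul_eq_zero.mp hz).resolve_left (mul_ne_zero h0 (sub_ne_zero.mpr h1))
    rw [riemannZeta_def_of_ne_zero h0, this, zero_div]
  obtain ⟨h0, h1, hζ⟩ := key z hz
  obtain ⟨-, -, hζ'⟩ := key (-z) (by rw [xiFn_neg]; exact hz)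
  have hre : (1/2 + z).re = 1/2 := by
    refine hRH _ hζ ?_ h1
    rintro ⟨n, hn⟩
    refine riemannZeta_ne_zero_of_one_le_re ?_ hζ'
    have : z = -2 * (n+1) - 1/2 := by rw [← hn]; ring
    rw [this]
    have h3 : (0:ℝ) ≤ n := Nat.cast_nonneg n
    simp
    linarith
  have hz0 : z.re = 0 := by simpa using hre
  refine ⟨z.im, ?_, ?_⟩
  · apply Complex.ext <;> simp [hz0]
  · have : (z.im : ℂ) * I = z := by apply Complex.ext <;> simp [hz0]
    rw [this]; exact hζ

theorem deriv_xiFn_ne_zero (hsimple : ∀ ρ : ℂ, riemannZeta ρ = 0 → 0 < ρ.re → ρ.re < 1 →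
      deriv riemannZeta ρ ≠ 0) {γ : ℝ} (h : riemannZeta (1 / 2 + γ * I) = 0) :
    deriv xiFn (γ * I) ≠ 0 := by
  have hs := hsimple _ h (by simp) (by norm_num)
  set z : ℂ := γ * I with hz
  have hre : 0 < (1/2 + z).re := by simp [hz]
  have hne1 : 1/2 + z ≠ 1 := by
    intro h; have := congrArg Complex.re h; norm_num [hz] at this
  have hne0 : 1/2 + z ≠ 0 := fun h => by rw [h] at hre; simp at hre
  have hev : xiFn =ᶠ[nhds z] fun w => ((1 / 2 + w) * (1 / 2 + w - 1) * Gammaℝ (1 / 2 + w)) *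
      riemannZeta (1 / 2 + w) := by
    have o1 : ∀ᶠ w in nhds z, 0 < (1/2 + w).re :=
      (by fun_prop : Continuous fun w : ℂ => (1/2 + w).re).continuousAt.eventually_const_lt hre
    have o2 : ∀ᶠ w in nhds z, 1/2 + w ≠ 1 :=
      (by fun_prop : Continuous fun w : ℂ => (1/2 + w)).continuousAt.eventually_ne hne1
    filter_upwards [o1, o2] with w h1 h2
    rw [xiFn_eq_zeta h1 h2]; ring
  have hA : DifferentiableAt ℂ (fun w : ℂ => (1 / 2 + w) * (1 / 2 + w - 1) * Gammaℝ (1 / 2 + w)) z := by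
    have hG : DifferentiableAt ℂ Gammaℝ (1/2 + z) := by
      have := (differentiable_Gammaℝ_inv (1/2 + z)).inv
        (inv_ne_zero (Gammaℝ_ne_zero_of_re_pos hre))
      have h2 : (fun s => (Gammaℝ s)⁻¹)⁻¹ = Gammaℝ := by ext s; simp
      rwa [h2] at this
    have : DifferentiableAt ℂ (fun w : ℂ => Gammaℝ (1/2 + w)) z :=
      DifferentiableAt.comp z (g := Gammaℝ) (f := fun w : ℂ => 1/2 + w) hG (by fun_prop)
    fun_prop
  have hZ : HasDerivAt (fun w : ℂ => riemannZeta (1/2 + w)) (deriv riemannZeta (1/2 + z)) z := by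
    have := (differentiableAt_riemannZeta hne1).hasDerivAt
    simpa using HasDerivAt.comp_const_add (1/2) z this
  rw [hev.deriv_eq]
  refine ne_of_eq_of_ne (hA.hasDerivAt.mul hZ).deriv ?_
  rw [h, mul_zero, zero_add]
  refine mul_ne_zero (mul_ne_zero (mul_ne_zero hne0 (sub_ne_zero.mpr hne1)) ?_) hs
  exact Gammaℝ_ne_zero_of_re_pos hre

theorem deriv_xiFn_zero : deriv xiFn 0 = 0 := by
  have h1 : (fun z => xiFn (-z)) = xiFn := funext xiFn_neg
  have h2 := deriv_comp_neg xiFn (0:ℂ)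
  rw [h1, neg_zero] at h2
  have h3 : (2:ℂ) * deriv xiFn 0 = 0 := by linear_combination h2
  simpa using h3

theorem xiFn_zero_ne_zero (hsimple : ∀ ρ : ℂ, riemannZeta ρ = 0 → 0 < ρ.re → ρ.re < 1 →
      deriv riemannZeta ρ ≠ 0) : xiFn 0 ≠ 0 := by
  intro h
  have h1 : riemannZeta (1/2 + (0:ℝ) * I) = 0 := by
    have h2 := xiFn_eq_zeta (z := 0) (by simp) (by norm_num)
    rw [h] at h2
    have h3 := Gammaℝ_ne_zero_of_re_pos (s := 1/2 + 0) (by simp)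
    have h4 : riemannZeta (1/2 + 0) = 0 := by
      have := h2.symm
      rw [mul_eq_zero, mul_eq_zero (a := Gammaℝ _)] at this
      obtain h5 | h5 | h5 := this
      · norm_num at h5
      · exact absurd h5 h3
      · exact h5
    simpa using h4
  have := deriv_xiFn_ne_zero hsimple h1
  simp [deriv_xiFn_zero] at this

theorem xiFn_growth : ∃ C : ℝ, 0 < C ∧ ∀ R : ℝ, 1 ≤ R → ∀ z : ℂ, ‖z‖ ≤ R →
    ‖xiFn z‖ ≤ Real.exp (C * R ^ (3 / 2 : ℝ)) := by
  obtain ⟨C, K, hC, hK, hb⟩ := completedRiemannZeta0_norm_le_factorial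
  have hK0 : 0 < K := by linarith
  have hlogK : 0 ≤ Real.log K := Real.log_nonneg hK
  have key : ∀ R : ℝ, 1 ≤ R → ∀ z : ℂ, ‖z‖ ≤ R → 0 ≤ z.re →
    ‖xiFn z‖ ≤ Real.exp ((6 + C + 12 + 3 * Real.log K) * R ^ (3 / 2 : ℝ)) := by
    intro R hR z hz hre
    set n : ℕ := ⌈R⌉₊ + 1 with hn
    have hn1 : (n:ℝ) ≤ 3 * R := by
      have := Nat.ceil_lt_add_one (a := R) (by linarith)
      rw [hn]; push_cast; linarith
    have hn2 : R + 1 ≤ n := by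
      have := Nat.le_ceil R
      rw [hn]; push_cast; linarith
    have hzre : z.re ≤ R := (le_trans (Complex.re_le_norm z) hz)
    have h1 := hb (1/2 + z) n (by simp; exact hre) (by simp; linarith)
    have hs1 : ‖(1/2 + z)‖ ≤ 2 * R := by
      calc _ ≤ ‖(1/2 : ℂ)‖ + ‖z‖ := norm_add_le _ _
        _ ≤ _ := by norm_num; linarith
    have hs2 : ‖(1/2 + z - 1)‖ ≤ 2 * R := by
      rw [show (1/2 + z - 1) = -(1/2 : ℂ) + z by ring]
      calc _ ≤ ‖-(1/2 : ℂ)‖ + ‖z‖ := norm_add_le _ _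
        _ ≤ _ := by norm_num; linarith
    have hR2 : R ≤ R ^ (3/2 : ℝ) := by
      conv_lhs => rw [← Real.rpow_one R]
      exact Real.rpow_le_rpow_of_exponent_le hR (by norm_num)
    have hRe : R ≤ Real.exp R := by linarith [Real.add_one_le_exp R]
    have hfac : (n.factorial : ℝ) ≤ Real.exp (12 * R ^ (3/2 : ℝ)) := by
      have hn0 : (0:ℝ) < n := by linarith
      have e1 : (n.factorial : ℝ) ≤ (n:ℝ) ^ n := by exact_mod_cast Nat.factorial_le_pow n
      have e2 : (n:ℝ) ^ n = Real.exp (n * Real.log n) := by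
        rw [mul_comm, Real.exp_mul, Real.exp_log hn0, Real.rpow_natCast]
      have e3 : Real.log n ≤ 2 * Real.sqrt n := by
        have := Real.log_le_rpow_div hn0.le (ε := 1/2) (by norm_num)
        rw [← Real.sqrt_eq_rpow] at this
        linarith
      have e4 : Real.sqrt n ≤ 2 * Real.sqrt R := by
        rw [show 2 * Real.sqrt R = Real.sqrt (4 * R) by
          rw [Real.sqrt_mul (by norm_num), show (4:ℝ) = 2^2 by norm_num, Real.sqrt_sq (by norm_num)]]
        exact Real.sqrt_le_sqrt (by linarith)
      have e5 : R ^ (3/2 : ℝ) = R * Real.sqrt R := by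
        rw [show (3/2:ℝ) = 1 + 1/2 by norm_num, Real.rpow_add (by linarith), Real.rpow_one,
          Real.sqrt_eq_rpow]
      rw [e2] at e1
      refine e1.trans (Real.exp_le_exp.mpr ?_)
      rw [e5]
      calc (n:ℝ) * Real.log n ≤ (3 * R) * (2 * (2 * Real.sqrt R)) := by
            refine mul_le_mul hn1 (by linarith) (Real.log_nonneg (by linarith)) (by linarith)
        _ = _ := by ring
    have hKn : K ^ n ≤ Real.exp (3 * Real.log K * R ^ (3/2 : ℝ)) := by
      have : K ^ n = Real.exp (n * Real.log K) := by
        rw [mul_comm, Real.exp_mul, Real.exp_log hK0, Real.rpow_natCast]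
      rw [this]
      apply Real.exp_le_exp.mpr
      calc n * Real.log K ≤ (3 * R) * Real.log K := by gcongr
        _ ≤ (3 * R ^ (3/2:ℝ)) * Real.log K := by gcongr
        _ = _ := by ring
    have hCe : C ≤ Real.exp (C * R ^ (3/2 : ℝ)) := by
      have : C ≤ C * R ^ (3/2 : ℝ) := le_mul_of_one_le_right hC.le (hR.trans hR2)
      linarith [Real.add_one_le_exp (C * R ^ (3/2 : ℝ))]
    unfold xiFn
    have big : ‖(1/2 + z) * (1/2 + z - 1) * completedRiemannZeta₀ (1/2 + z) + 1‖ ≤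
      (2 * R) * (2 * R) * (Real.exp (C * R ^ (3/2 : ℝ)) * Real.exp (12 * R ^ (3/2 : ℝ)) *
        Real.exp (3 * Real.log K * R ^ (3/2 : ℝ))) + 1 := by
      refine (norm_add_le _ _).trans ?_
      rw [norm_mul, norm_mul, norm_one]
      gcongr
      refine h1.trans ?_
      gcongr
    refine big.trans ?_
    set E := Real.exp (C * R ^ (3/2 : ℝ)) * Real.exp (12 * R ^ (3/2 : ℝ)) *
        Real.exp (3 * Real.log K * R ^ (3/2 : ℝ)) with hE
    have hE1 : 1 ≤ E := by
      rw [hE, ← Real.exp_add, ← Real.exp_add]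
      apply Real.one_le_exp
      positivity
    have h5 : (2 * R) * (2 * R) * E + 1 ≤ 5 * (R * R) * E := by nlinarith [mul_le_mul hR hR (by norm_num) (by linarith)]
    refine h5.trans ?_
    have h6 : 5 * (R * R) ≤ Real.exp (6 * R ^ (3/2:ℝ)) := by
      have : (5:ℝ) ≤ Real.exp 4 := by linarith [Real.add_one_le_exp (4:ℝ)]
      calc 5 * (R * R) ≤ Real.exp 4 * (Real.exp R * Real.exp R) := by gcongr
        _ = Real.exp (4 + (R + R)) := by rw [← Real.exp_add, ← Real.exp_add]
        _ ≤ _ := Real.exp_le_exp.mpr (by linarith)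
    calc 5 * (R * R) * E ≤ Real.exp (6 * R ^ (3/2:ℝ)) * E := by gcongr
      _ = _ := by
        rw [hE, ← Real.exp_add, ← Real.exp_add, ← Real.exp_add]; congr 1; ring
  refine ⟨6 + C + 12 + 3 * Real.log K, by positivity, ?_⟩
  intro R hR z hz
  rcases le_total 0 z.re with h | h
  · exact key R hR z hz h
  · rw [← xiFn_neg]
    exact key R hR (-z) (by simpa using hz) (by simpa using h)

/-- The ordinates of the zeros of `ζ` on the critical line. -/
def zetaOrd : Set ℝ := {γ | riemannZeta (1 / 2 + γ * I) = 0}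

theorem mem_zetaOrd_iff {γ : ℝ} : γ ∈ zetaOrd ↔ xiFn (γ * I) = 0 := by
  constructor
  · exact xiFn_zero_of_zeta
  · intro h
    have hne1 : (1:ℂ)/2 + γ * I ≠ 1 := by
      intro h; have := congrArg Complex.re h; norm_num at this
    have hne0 : (1:ℂ)/2 + γ * I ≠ 0 := by
      intro h; have := congrArg Complex.re h; norm_num at this
    rw [xiFn_eq_zeta (by simp) hne1] at h
    have h2 := (mul_eq_zero.mp h).resolve_left (mul_ne_zero hne0 (sub_ne_zero.mpr hne1))
    exact (mul_eq_zero.mp h2).resolve_left (Gammaℝ_ne_zero_of_re_pos (by simp))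

theorem neg_mem_zetaOrd {γ : ℝ} (h : γ ∈ zetaOrd) : -γ ∈ zetaOrd := by
  rw [mem_zetaOrd_iff] at *
  rw [← xiFn_neg]; simpa using h

theorem finite_zetaOrd_inter (R : ℝ) : (zetaOrd ∩ Set.Icc (-R) R).Finite := by
  have hc : IsCompact ((fun γ : ℝ => (1/2 + γ * I : ℂ)) '' Set.Icc (-R) R) :=
    isCompact_Icc.image (by fun_prop)
  have hf := hc.inter_riemannZetaZeros_finite
  have hinj : Function.Injective (fun γ : ℝ => (1/2 + γ * I : ℂ)) := by
    intro a b h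
    have := congrArg Complex.im h
    simpa using this
  refine (hf.preimage hinj.injOn).subset ?_
  rintro γ ⟨h1, h2⟩
  exact ⟨⟨γ, h2, rfl⟩, h1⟩

theorem finite_zetaOrd_abs_le (R : ℝ) : {γ : zetaOrd | |(γ:ℝ)| ≤ R}.Finite := by
  refine Set.Finite.of_injOn (f := fun γ : zetaOrd => (γ:ℝ)) (t := zetaOrd ∩ Set.Icc (-R) R) ?_
    Subtype.val_injective.injOn (finite_zetaOrd_inter R)
  intro γ hγ
  exact ⟨γ.2, abs_le.mp hγ⟩

/-- The finite set of critical ordinates of absolute value at most `R`. -/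
noncomputable def zetaOrdFin (R : ℝ) : Finset zetaOrd := (finite_zetaOrd_abs_le R).toFinset

theorem mem_zetaOrdFin {R : ℝ} {γ : zetaOrd} : γ ∈ zetaOrdFin R ↔ |(γ:ℝ)| ≤ R := by
  simp [zetaOrdFin]

theorem tendsto_zetaOrdFin : Tendsto zetaOrdFin atTop atTop := by
  refine tendsto_atTop_finset_of_monotone ?_ ?_
  · intro a b hab γ hγ
    rw [mem_zetaOrdFin] at *
    linarith
  · intro γ
    exact ⟨|(γ:ℝ)|, mem_zetaOrdFin.mpr le_rfl⟩

/-- Negation on the set of critical ordinates. -/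
def zetaOrdNeg : zetaOrd ≃ zetaOrd where
  toFun γ := ⟨-γ, neg_mem_zetaOrd γ.2⟩
  invFun γ := ⟨-γ, neg_mem_zetaOrd γ.2⟩
  left_inv γ := by simp
  right_inv γ := by simp

theorem xiFn_logDeriv_bound (hRH : RiemannHypothesis)
    (hsimple : ∀ ρ : ℂ, riemannZeta ρ = 0 → 0 < ρ.re → ρ.re < 1 → deriv riemannZeta ρ ≠ 0) :
    ∃ C : ℝ, 0 < C ∧ ∀ R : ℝ, 1 ≤ R → ∀ z : ℂ, ‖z‖ ≤ R / 8 →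
    xiFn z ≠ 0 →
    ‖deriv xiFn z / xiFn z - ∑ γ ∈ zetaOrdFin R, z / (z ^ 2 + (γ:ℝ) ^ 2)‖ ≤
      C * R ^ (3 / 2 : ℝ) / R ^ 2 * ‖z‖ := by
  classical
  obtain ⟨C, hC, hgrow⟩ := xiFn_growth
  have h0 := xiFn_zero_ne_zero hsimple
  set D := |Real.log ‖xiFn 0‖| with hD
  refine ⟨64 * (C * 3 ^ (3/2:ℝ) + D), by positivity, ?_⟩
  intro R hR z hz hxz
  have hR0 : 0 < R := by linarith
  set S : Finset ℂ := (zetaOrdFin R).image (fun γ : zetaOrd => ((γ:ℝ):ℂ) * I) with hS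
  have hSmem : ∀ a, a ∈ S ↔ xiFn a = 0 ∧ ‖a‖ ≤ R := by
    intro a
    rw [hS, Finset.mem_image]
    constructor
    · rintro ⟨γ, hγ, rfl⟩
      refine ⟨mem_zetaOrd_iff.mp γ.2, ?_⟩
      rw [mem_zetaOrdFin] at hγ
      simpa using hγ
    · rintro ⟨h1, h2⟩
      obtain ⟨γ, rfl, hγ⟩ := zeta_zero_of_xiFn hRH h1
      refine ⟨⟨γ, hγ⟩, ?_, rfl⟩
      rw [mem_zetaOrdFin]
      simpa using h2
  have hinj : Function.Injective (fun γ : zetaOrd => ((γ:ℝ):ℂ) * I) := by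
    intro a b h
    have := congrArg Complex.im h
    simp at this
    exact Subtype.ext this
  have hsum : ∀ w : ℂ, xiFn w ≠ 0 →
      ∑ a ∈ S, 1 / (w - a) = ∑ γ ∈ zetaOrdFin R, w / (w ^ 2 + (γ:ℝ) ^ 2) := by
    intro w hw
    rw [hS, Finset.sum_image hinj.injOn]
    have hsym : ∑ γ ∈ zetaOrdFin R, 1 / (w - ((γ:ℝ):ℂ) * I) =
        ∑ γ ∈ zetaOrdFin R, 1 / (w + ((γ:ℝ):ℂ) * I) := by
      refine Finset.sum_equiv zetaOrdNeg ?_ ?_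
      · intro γ; rw [mem_zetaOrdFin, mem_zetaOrdFin]; simp [zetaOrdNeg]
      · intro γ hγ; simp [zetaOrdNeg, sub_eq_add_neg]
    have h2 : (2:ℂ) * ∑ γ ∈ zetaOrdFin R, 1 / (w - ((γ:ℝ):ℂ) * I) =
        2 * ∑ γ ∈ zetaOrdFin R, w / (w ^ 2 + (γ:ℝ) ^ 2) := by
      rw [two_mul]
      nth_rewrite 2 [hsym]
      rw [← Finset.sum_add_distrib, Finset.mul_sum]
      refine Finset.sum_congr rfl fun γ hγ => ?_
      have hm : w - ((γ:ℝ):ℂ) * I ≠ 0 := by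
        intro h
        apply hw
        rw [sub_eq_zero.mp h]
        exact mem_zetaOrd_iff.mp γ.2
      have hp : w + ((γ:ℝ):ℂ) * I ≠ 0 := by
        intro h
        apply hw
        rw [← xiFn_neg, show -w = ((γ:ℝ):ℂ) * I by linear_combination -h]
        exact mem_zetaOrd_iff.mp γ.2
      have e : w ^ 2 + ((γ:ℝ):ℂ) ^ 2 = (w - ((γ:ℝ):ℂ) * I) * (w + ((γ:ℝ):ℂ) * I) := by
        linear_combination ((γ:ℝ):ℂ)^2 * I_sq
      rw [e]
      field_simp
      ring
    exact mul_left_cancel₀ two_ne_zero h2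
  set K := C * (3 * R) ^ (3/2:ℝ) + D + 0 with hK
  have hKpos : 0 < K := by
    have : 0 < C * (3 * R) ^ (3/2:ℝ) := by positivity
    have : 0 ≤ D := abs_nonneg _
    linarith
  have hn0 : 0 < ‖xiFn 0‖ := norm_pos_iff.mpr h0
  have hb : ∀ w, ‖w‖ = 3 * R → ‖xiFn w‖ ≤ ‖xiFn 0‖ * Real.exp K := by
    intro w hw
    refine (hgrow (3 * R) (by linarith) w hw.le).trans ?_
    nth_rewrite 1 [← Real.exp_log hn0]
    rw [← Real.exp_add]
    apply Real.exp_le_exp.mpr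
    have := neg_abs_le (Real.log ‖xiFn 0‖)
    linarith
  have main := norm_logDeriv_sub_sum_le differentiable_xiFn hR0 hKpos h0 S hSmem ?_ hb hz hxz
  · rw [hsum z hxz, hsum 0 h0, deriv_xiFn_zero] at main
    simp only [zero_div, Finset.sum_const_zero, sub_zero] at main
    refine main.trans ?_
    refine mul_le_mul_of_nonneg_right ?_ (norm_nonneg _)
    refine div_le_div_of_nonneg_right ?_ (by positivity)
    have h32 : (1:ℝ) ≤ R ^ (3/2:ℝ) := Real.one_le_rpow hR (by norm_num)
    rw [hK, Real.mul_rpow (by norm_num) hR0.le]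
    have : D ≤ D * R ^ (3/2:ℝ) := le_mul_of_one_le_right (abs_nonneg _) h32
    nlinarith
  · intro a ha
    obtain ⟨γ, rfl, hγ⟩ := zeta_zero_of_xiFn hRH ((hSmem a).mp ha).1
    exact deriv_xiFn_ne_zero hsimple hγ

theorem tendsto_sum_zetaOrdFin (hRH : RiemannHypothesis)
    (hsimple : ∀ ρ : ℂ, riemannZeta ρ = 0 → 0 < ρ.re → ρ.re < 1 → deriv riemannZeta ρ ≠ 0)
    {z : ℂ} (hz : xiFn z ≠ 0) :
    Tendsto (fun R => ∑ γ ∈ zetaOrdFin R, z / (z ^ 2 + ((γ:ℝ):ℂ) ^ 2)) atTop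
      (nhds (deriv xiFn z / xiFn z)) := by
  obtain ⟨C, hC, hb⟩ := xiFn_logDeriv_bound hRH hsimple
  rw [tendsto_iff_norm_sub_tendsto_zero]
  have h1 : Tendsto (fun R : ℝ => C * ‖z‖ * R ^ (-(1/2) : ℝ)) atTop (nhds 0) := by
    have := (tendsto_rpow_neg_atTop (y := 1/2) (by norm_num)).const_mul (C * ‖z‖)
    simpa using this
  refine squeeze_zero' (Eventually.of_forall fun _ => norm_nonneg _) ?_ h1
  filter_upwards [eventually_ge_atTop 1, eventually_ge_atTop (8 * ‖z‖)] with R hR1 hR2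
  rw [norm_sub_rev]
  refine (hb R hR1 z (by linarith) hz).trans (le_of_eq ?_)
  have hR0 : 0 < R := by linarith
  rw [show (-(1/2) : ℝ) = 3/2 - (2:ℕ) by norm_num, Real.rpow_sub_natCast hR0.ne']
  ring

theorem summable_zetaOrd (hRH : RiemannHypothesis)
    (hsimple : ∀ ρ : ℂ, riemannZeta ρ = 0 → 0 < ρ.re → ρ.re < 1 → deriv riemannZeta ρ ≠ 0) :
    Summable (fun γ : zetaOrd => 1 / (1 + (γ:ℝ) ^ 2)) := by
  have h1 : xiFn 1 ≠ 0 := by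
    intro h
    obtain ⟨γ, hγ, -⟩ := zeta_zero_of_xiFn hRH h
    have := congrArg Complex.re hγ
    simp at this
  have ht := tendsto_sum_zetaOrdFin hRH hsimple h1
  have ht' : Tendsto (fun R => ∑ γ ∈ zetaOrdFin R, 1 / (1 + (γ:ℝ) ^ 2)) atTop
      (nhds (deriv xiFn 1 / xiFn 1).re) := by
    have := (Complex.continuous_re.tendsto _).comp ht
    refine this.congr fun R => ?_
    simp only [Function.comp_apply, Complex.re_sum]
    refine Finset.sum_congr rfl fun γ _ => ?_
    rw [show (1 : ℂ) / (1 ^ 2 + ((γ:ℝ):ℂ) ^ 2) = ((1 / (1 + (γ:ℝ)^2) : ℝ) : ℂ) by push_cast; ring]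
    exact Complex.ofReal_re _
  have hnn : ∀ γ : zetaOrd, 0 ≤ 1 / (1 + (γ:ℝ) ^ 2) := fun γ => by positivity
  refine summable_of_sum_le (c := (deriv xiFn 1 / xiFn 1).re) hnn ?_
  intro u
  refine ge_of_tendsto ht' ?_
  filter_upwards [tendsto_zetaOrdFin.eventually_ge_atTop u] with R hR
  exact Finset.sum_le_sum_of_subset_of_nonneg hR (fun _ _ _ => hnn _)

theorem hasSum_zetaOrd (hRH : RiemannHypothesis)
    (hsimple : ∀ ρ : ℂ, riemannZeta ρ = 0 → 0 < ρ.re → ρ.re < 1 → deriv riemannZeta ρ ≠ 0)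
    {z : ℂ} (hz : xiFn z ≠ 0) :
    HasSum (fun γ : zetaOrd => z / (z ^ 2 + ((γ:ℝ):ℂ) ^ 2)) (deriv xiFn z / xiFn z) := by
  have hs : Summable (fun γ : zetaOrd => z / (z ^ 2 + ((γ:ℝ):ℂ) ^ 2)) := by
    refine Summable.of_norm_bounded_eventually
      ((summable_zetaOrd hRH hsimple).mul_left (4 * ‖z‖)) ?_
    have hcof : ∀ᶠ γ : zetaOrd in cofinite, ¬ |(γ:ℝ)| ≤ 2 * ‖z‖ + 1 := by
      rw [eventually_cofinite]
      simpa using finite_zetaOrd_abs_le (2 * ‖z‖ + 1)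
    filter_upwards [hcof] with γ hγ
    push Not at hγ
    have hsq : (2 * ‖z‖ + 1) ^ 2 ≤ (γ:ℝ)^2 := by
      rw [← sq_abs (γ:ℝ)]; gcongr
    have h1 : (1 + (γ:ℝ)^2) / 4 ≤ ‖z ^ 2 + ((γ:ℝ):ℂ) ^ 2‖ := by
      have := norm_sub_norm_le (((γ:ℝ):ℂ) ^ 2) (-(z^2))
      rw [sub_neg_eq_add, norm_neg, norm_pow, norm_pow, Complex.norm_real, Real.norm_eq_abs, sq_abs,
        add_comm (((γ:ℝ):ℂ) ^ 2)] at this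
      nlinarith [norm_nonneg z]
    rw [norm_div, div_le_iff₀ (lt_of_lt_of_le (by positivity) h1)]
    calc ‖z‖ = 4 * ‖z‖ * (1 / (1 + (γ:ℝ)^2)) * ((1 + (γ:ℝ)^2) / 4) := by field_simp
      _ ≤ _ := by gcongr
  have h1 := hs.hasSum.comp tendsto_zetaOrdFin
  rw [← tendsto_nhds_unique h1 (tendsto_sum_zetaOrdFin hRH hsimple hz)]
  exact hs.hasSum
theorem Real.abs_log_one_add_inv_sub_le (j : ℕ) :
    |Real.log ((j + 2) / (j + 1)) - 1 / (j + 1)| ≤ 1 / ((j:ℝ) + 1) ^ 2 := by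
  have hj : (0:ℝ) < (j:ℝ) + 1 := by positivity
  have h1 : Real.log ((j + 2) / (j + 1)) ≤ 1 / (j + 1) := by
    have := Real.log_le_sub_one_of_pos (x := ((j:ℝ) + 2) / (j + 1)) (by positivity)
    refine this.trans (le_of_eq ?_); field_simp; ring
  have h2 : 1 / ((j:ℝ) + 2) ≤ Real.log ((j + 2) / (j + 1)) := by
    have := Real.one_sub_inv_le_log_of_pos (x := ((j:ℝ) + 2) / (j + 1)) (by positivity)
    refine le_trans (le_of_eq ?_) this; field_simp; ring
  rw [abs_sub_comm, abs_of_nonneg (by linarith)]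
  have h3 : 1 / ((j:ℝ) + 1) - 1 / (j + 2) ≤ 1 / ((j:ℝ) + 1) ^ 2 := by
    rw [div_sub_div _ _ (by positivity) (by positivity), div_le_div_iff₀ (by positivity) (by positivity)]
    nlinarith
  linarith

theorem summable_one_div_nat_add_one_sq : Summable (fun j : ℕ => 1 / ((j:ℝ) + 1) ^ 2) := by
  have := (summable_nat_add_iff 1).mpr (Real.summable_one_div_nat_pow (p := 2).mpr (by norm_num))
  simpa using this

theorem norm_inv_sub_inv_add_le {z : ℂ} (hz : 0 < z.re) (j : ℕ) :
    ‖1 / ((j:ℂ) + 1) - 1 / (z + j + 1)‖ ≤ ‖z‖ * (1 / ((j:ℝ) + 1) ^ 2) := by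
  have hj : (0:ℝ) < (j:ℝ) + 1 := by positivity
  have h1 : (j:ℝ) + 1 ≤ ‖z + j + 1‖ := by
    refine le_trans ?_ (Complex.re_le_norm _)
    simp; linarith
  have hj' : (j:ℂ) + 1 ≠ 0 := by exact_mod_cast hj.ne'
  have hzj : z + j + 1 ≠ 0 := norm_pos_iff.mp (by linarith)
  have : 1 / ((j:ℂ) + 1) - 1 / (z + j + 1) = z / (((j:ℂ) + 1) * (z + j + 1)) := by
    field_simp; ring
  rw [this, norm_div, norm_mul, mul_one_div]
  have h2 : ‖(j:ℂ) + 1‖ = (j:ℝ) + 1 := by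
    have : ((j:ℂ) + 1) = (((j:ℝ) + 1 : ℝ) : ℂ) := by push_cast; rfl
    rw [this, Complex.norm_real, Real.norm_of_nonneg hj.le]
  rw [h2, sq]
  gcongr

theorem summable_inv_sub_inv_add {z : ℂ} (hz : 0 < z.re) :
    Summable (fun j : ℕ => 1 / ((j:ℂ) + 1) - 1 / (z + j + 1)) :=
  Summable.of_norm_bounded (summable_one_div_nat_add_one_sq.mul_left ‖z‖)
    (fun j => norm_inv_sub_inv_add_le hz j)

/-- The `j`-th term of the logarithm of Euler's product for `Gamma`. -/
noncomputable def logGammaTerm (j : ℕ) (z : ℂ) : ℂ :=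
  z * (Real.log ((j + 2) / (j + 1)) : ℝ) - log (1 + z / (j + 1))

theorem hasDerivAt_logGammaTerm (j : ℕ) {z : ℂ} (hz : 0 < z.re) :
    HasDerivAt (logGammaTerm j)
      ((Real.log ((j + 2) / (j + 1)) : ℝ) - 1 / (z + j + 1)) z := by
  have hj : (0:ℝ) < (j:ℝ) + 1 := by positivity
  have hj' : (j:ℂ) + 1 ≠ 0 := by exact_mod_cast hj.ne'
  have hre : 0 < (1 + z / ((j:ℂ) + 1)).re := by
    have : z / ((j:ℂ) + 1) = z / (((j:ℝ) + 1 : ℝ) : ℂ) := by push_cast; rfl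
    rw [add_re, this, Complex.div_ofReal_re, one_re]
    positivity
  have h1 : HasDerivAt (fun z : ℂ => 1 + z / ((j:ℂ) + 1)) (1 / ((j:ℂ) + 1)) z := by
    simpa using ((hasDerivAt_id z).div_const ((j:ℂ) + 1)).const_add 1
  have h2 := h1.clog (Or.inl hre)
  have h3 := ((hasDerivAt_id z).mul_const ((Real.log ((j + 2) / (j + 1)) : ℝ) : ℂ)).sub h2
  refine h3.congr_deriv ?_
  have hzj : z + j + 1 ≠ 0 := by
    intro h
    have := congrArg Complex.re h
    simp at this; linarith
  have hne : 1 + z / ((j:ℂ) + 1) ≠ 0 := fun h => by rw [h] at hre; simp at hre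
  have : 1 + z / ((j:ℂ) + 1) = (z + j + 1) / (j + 1) := by field_simp; ring
  rw [this]
  field_simp

theorem logGammaTerm_one (j : ℕ) : logGammaTerm j 1 = 0 := by
  unfold logGammaTerm
  have hj : (0:ℝ) < (j:ℝ) + 1 := by positivity
  have : (1:ℂ) + 1 / ((j:ℂ) + 1) = ((((j:ℝ) + 2) / (j + 1) : ℝ) : ℂ) := by
    have hj' : (j:ℂ) + 1 ≠ 0 := by exact_mod_cast hj.ne'
    push_cast
    field_simp; ring
  rw [this, ← Complex.ofReal_log (by positivity)]
  ring

theorem logGamma_summable_hasDerivAt {z : ℂ} (hz : 0 < z.re) :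
    Summable (fun j => logGammaTerm j z) ∧
    HasDerivAt (fun w => ∑' j, logGammaTerm j w)
      (∑' j : ℕ, (((Real.log ((j + 2) / (j + 1)) : ℝ) : ℂ) - 1 / (z + j + 1))) z := by
  set M := ‖z‖ + 2 with hM
  set t : Set ℂ := {w | 0 < w.re} ∩ Metric.ball 0 M with ht
  have hto : IsOpen t := (isOpen_lt continuous_const continuous_re).inter Metric.isOpen_ball
  have htc : IsPreconnected t :=
    ((convex_halfSpace_re_gt 0).inter (convex_ball _ _)).isPreconnected
  have hu : Summable (fun j : ℕ => (1 + M) * (1 / ((j:ℝ) + 1) ^ 2)) :=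
    summable_one_div_nat_add_one_sq.mul_left _
  have hg : ∀ (n : ℕ), ∀ y ∈ t, HasDerivAt (logGammaTerm n)
      ((Real.log ((n + 2) / (n + 1)) : ℝ) - 1 / (y + n + 1)) y :=
    fun n y hy => hasDerivAt_logGammaTerm n hy.1
  have hg' : ∀ (n : ℕ), ∀ y ∈ t, ‖((Real.log ((n + 2) / (n + 1)) : ℝ) : ℂ) - 1 / (y + n + 1)‖ ≤
      (1 + M) * (1 / ((n:ℝ) + 1) ^ 2) := by
    intro n y hy
    have h1 := norm_inv_sub_inv_add_le hy.1 n
    have h2 := Real.abs_log_one_add_inv_sub_le n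
    have hyM : ‖y‖ ≤ M := (mem_ball_zero_iff.mp hy.2).le
    have e : ((Real.log ((n + 2) / (n + 1)) : ℝ) : ℂ) - 1 / (y + n + 1) =
      ((Real.log ((n + 2) / (n + 1)) - 1 / (n + 1) : ℝ) : ℂ) +
        (1 / ((n:ℂ) + 1) - 1 / (y + n + 1)) := by push_cast; ring
    rw [e]
    refine (norm_add_le _ _).trans ?_
    rw [Complex.norm_real, Real.norm_eq_abs, add_mul, one_mul]
    refine add_le_add h2 (h1.trans ?_)
    gcongr
  have h1t : (1:ℂ) ∈ t := ⟨by simp, by simp [hM]; linarith [norm_nonneg z]⟩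
  have hzt : z ∈ t := ⟨hz, by simp [hM]⟩
  have hs1 : Summable (fun j => logGammaTerm j 1) := by simp [logGammaTerm_one, summable_zero]
  exact ⟨summable_of_summable_hasDerivAt_of_isPreconnected hu hto htc hg hg' h1t hs1 hzt,
    hasDerivAt_tsum_of_isPreconnected hu hto htc hg hg' h1t hs1 hzt⟩

theorem Gamma_eq_exp_tsum {z : ℂ} (hz : 0 < z.re) :
    Gamma z = exp (∑' j, logGammaTerm j z) / z := by
  have hs := (logGamma_summable_hasDerivAt hz).1
  have hz0 : z ≠ 0 := fun h => by rw [h] at hz; simp at hz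
  have hlim := ((Complex.continuous_exp.tendsto _).comp hs.hasSum.tendsto_sum_nat).div_const z
  have hΓ := GammaSeq_tendsto_Gamma z
  have hlog : Tendsto (fun n : ℕ => exp (z * ((Real.log ((n + 1 : ℝ) / n) : ℝ) : ℂ))) atTop (nhds 1) := by
    have h1 : Tendsto (fun n : ℕ => ((n + 1 : ℝ) / n)) atTop (nhds 1) := by
      have := tendsto_natCast_div_add_atTop (1:ℝ)
      have h2 := this.inv₀ one_ne_zero
      simpa using h2
    have h2 := (Real.continuousAt_log one_ne_zero).tendsto.comp h1
    rw [Real.log_one] at h2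
    have h3 := (Complex.continuous_ofReal.tendsto 0).comp h2
    have h4 := (Complex.continuous_exp.tendsto _).comp (h3.const_mul z)
    simpa [Function.comp_def] using h4
  have hprod := hΓ.mul hlog
  rw [mul_one] at hprod
  refine (tendsto_nhds_unique (hlim.congr' ?_) hprod).symm
  filter_upwards [eventually_gt_atTop 0] with n hn
  have hzj : ∀ j : ℕ, z + j + 1 ≠ 0 := by
    intro j h
    have := congrArg Complex.re h
    simp at this
    have h3 : (0:ℝ) ≤ j := Nat.cast_nonneg j
    linarith
  have key : ∀ m : ℕ, exp (∑ j ∈ Finset.range m, logGammaTerm j z) =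
      exp (z * ((Real.log (m + 1) : ℝ) : ℂ)) * (m.factorial / ∏ j ∈ Finset.range m, (z + (j + 1 : ℕ))) := by
    intro m
    induction m with
    | zero => simp
    | succ m ih =>
      rw [Finset.sum_range_succ, exp_add, ih, Finset.prod_range_succ, Nat.factorial_succ]
      have hj : (0:ℝ) < (m:ℝ) + 1 := by positivity
      have hj' : (m:ℂ) + 1 ≠ 0 := by exact_mod_cast hj.ne'
      have hne : 1 + z / ((m:ℂ) + 1) ≠ 0 := by
        have : 1 + z / ((m:ℂ) + 1) = (z + m + 1) / (m + 1) := by field_simp; ring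
        rw [this]; exact div_ne_zero (hzj m) hj'
      have e1 : exp (logGammaTerm m z) =
          exp (z * ((Real.log ((m + 2) / (m + 1)) : ℝ) : ℂ)) * ((m + 1) / (z + m + 1)) := by
        unfold logGammaTerm
        rw [exp_sub, exp_log hne, div_eq_mul_inv]
        congr 1
        have hq : 1 + z / ((m:ℂ) + 1) = (z + m + 1) / (m + 1) := by field_simp; ring
        rw [hq, inv_div]
      have e2 : Real.log ((m + 2) / (m + 1)) = Real.log ((m:ℝ) + 2) - Real.log (m + 1) :=
        Real.log_div (by positivity) (by positivity)
      have e3 : exp (z * ((Real.log ((m + 1 : ℕ) + 1) : ℝ) : ℂ)) =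
          exp (z * ((Real.log (m + 1) : ℝ) : ℂ)) *
          exp (z * ((Real.log ((m + 2) / (m + 1)) : ℝ) : ℂ)) := by
        rw [← exp_add, e2]; congr 1; push_cast; rw [show (m:ℝ) + 1 + 1 = m + 2 by ring]; ring
      rw [e1, e3]
      push_cast
      rw [show z + ((m:ℂ) + 1) = z + m + 1 by ring]
      have := hzj m
      field_simp
  simp only [Function.comp_apply]
  rw [key n, GammaSeq, Finset.prod_range_succ']
  have hn' : (0:ℝ) < n := by exact_mod_cast hn
  have e4 : (n:ℂ) ^ z = exp (z * ((Real.log n : ℝ) : ℂ)) := by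
    rw [cpow_def_of_ne_zero (by exact_mod_cast hn.ne'), ← Complex.ofReal_natCast, ← ofReal_log hn'.le]
    congr 1; ring
  have e5 : Real.log ((n + 1) / n) = Real.log ((n:ℝ) + 1) - Real.log n :=
    Real.log_div (by positivity) (by positivity)
  have e6 : exp (z * ((Real.log (n + 1) : ℝ) : ℂ)) = exp (z * ((Real.log n : ℝ) : ℂ)) *
      exp (z * ((Real.log ((n + 1) / n) : ℝ) : ℂ)) := by
    rw [← exp_add, e5]; congr 1; push_cast; ring
  rw [e4, e6]
  simp only [Nat.cast_zero, add_zero]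
  have hpr : ∏ j ∈ Finset.range n, (z + ((j + 1 : ℕ) : ℂ)) ≠ 0 := by
    refine Finset.prod_ne_zero_iff.mpr fun j _ => ?_
    have := hzj j
    push_cast
    rwa [← add_assoc]
  field_simp

/-- The partial fraction expansion of the logarithmic derivative of `Gamma`, up to a constant. -/
theorem exists_hasSum_logDeriv_Gamma : ∃ c : ℝ, ∀ z : ℂ, 0 < z.re →
    HasSum (fun j : ℕ => 1 / ((j:ℂ) + 1) - 1 / (z + j + 1)) (deriv Gamma z / Gamma z + c + 1 / z) := by
  set d : ℕ → ℝ := fun j => Real.log ((j + 2) / (j + 1)) - 1 / (j + 1) with hd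
  have hds : Summable d := by
    refine Summable.of_norm_bounded summable_one_div_nat_add_one_sq ?_
    intro j; exact Real.abs_log_one_add_inv_sub_le j
  refine ⟨-∑' j, d j, fun z hz => ?_⟩
  have hz0 : z ≠ 0 := fun h => by rw [h] at hz; simp at hz
  have hev : Gamma =ᶠ[nhds z] fun w => exp (∑' j, logGammaTerm j w) / w := by
    have : ∀ᶠ w in nhds z, 0 < w.re :=
      (continuous_re.tendsto z).eventually_const_lt hz
    filter_upwards [this] with w hw using Gamma_eq_exp_tsum hw
  have hder := ((logGamma_summable_hasDerivAt hz).2.cexp).div (hasDerivAt_id z) hz0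
  have hΓ' := hev.deriv_eq.trans hder.deriv
  have hs := summable_inv_sub_inv_add hz
  have hdC : HasSum (fun j => ((d j : ℝ) : ℂ)) ((∑' j, d j : ℝ) : ℂ) := Complex.hasSum_ofReal.mpr hds.hasSum
  have hsum := hdC.add hs.hasSum
  have e : ∀ j : ℕ, ((d j : ℝ) : ℂ) + (1 / ((j:ℂ) + 1) - 1 / (z + j + 1)) =
      ((Real.log ((j + 2) / (j + 1)) : ℝ) : ℂ) - 1 / (z + j + 1) := by
    intro j; simp only [hd]; push_cast; ring
  simp only [e] at hsum
  rw [hΓ', hsum.tsum_eq, Gamma_eq_exp_tsum hz]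
  convert hs.hasSum using 1
  have := exp_ne_zero (∑' j, logGammaTerm j z)
  simp only [id]
  push_cast
  field_simp
  ring

/-- The Riemann Hypothesis together with simplicity of the nontrivial zeros. -/
def SimpleRH : Prop := RiemannHypothesis ∧
  ∀ ρ : ℂ, riemannZeta ρ = 0 → 0 < ρ.re → ρ.re < 1 → deriv riemannZeta ρ ≠ 0

theorem deriv_Gammaℝ_div {s : ℂ} (hs : 0 < s.re) :
    deriv Gammaℝ s / Gammaℝ s = -(Real.log Real.pi : ℂ) / 2 +
      deriv Gamma (s / 2) / Gamma (s / 2) / 2 := by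
  have hs2 : 0 < (s / 2).re := by simpa using hs
  have hG : DifferentiableAt ℂ Gamma (s / 2) := by
    refine differentiableAt_Gamma _ fun m h => ?_
    rw [h] at hs2
    simp at hs2
    linarith [(Nat.cast_nonneg m : (0:ℝ) ≤ m)]
  have hpi : (Real.pi : ℂ) ≠ 0 := by exact_mod_cast Real.pi_ne_zero
  have h1 : HasDerivAt (fun s : ℂ => (Real.pi : ℂ) ^ (-s / 2))
      ((Real.pi : ℂ) ^ (-s / 2) * Complex.log Real.pi * (-1 / 2)) s :=
    ((hasDerivAt_id s).neg.div_const 2).const_cpow (Or.inl hpi)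
  have h2 : HasDerivAt (fun s : ℂ => Gamma (s / 2)) (deriv Gamma (s / 2) * (1 / 2)) s :=
    HasDerivAt.comp s (h₂ := Gamma) hG.hasDerivAt ((hasDerivAt_id s).div_const 2)
  have h3 : HasDerivAt Gammaℝ _ s := h1.mul h2
  rw [h3.deriv, Gammaℝ_def]
  have hg := Gamma_ne_zero_of_re_pos hs2
  have hc : (Real.pi : ℂ) ^ (-s / 2) ≠ 0 := by rw [cpow_def_of_ne_zero hpi]; exact exp_ne_zero _
  rw [← ofReal_log Real.pi_pos.le]
  field_simp

theorem differentiableAt_Gammaℝ {s : ℂ} (hs : 0 < s.re) : DifferentiableAt ℂ Gammaℝ s := by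
  have := (differentiable_Gammaℝ_inv s).inv (inv_ne_zero (Gammaℝ_ne_zero_of_re_pos hs))
  simpa [Pi.inv_def] using this

theorem xiFn_sub_half_ne_zero (hRH : RiemannHypothesis) {s : ℂ}
    (hz : riemannZeta s ≠ 0) : xiFn (s - 1 / 2) ≠ 0 := by
  intro h
  obtain ⟨γ, hγ, hγ0⟩ := zeta_zero_of_xiFn hRH h
  rw [← hγ] at hγ0
  exact hz (by simpa using hγ0)

theorem exists_zeta_logDeriv_eq (H : SimpleRH) : ∃ c : ℝ, ∀ s : ℂ, 0 < s.re → s ≠ 1 →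
    riemannZeta s ≠ 0 →
    Summable (fun j : ℕ => 1 / (2 * ((j:ℂ) + 1)) - 1 / (s + 2 * (j + 1))) ∧
    Summable (fun γ : zetaOrd => (s - 1 / 2) / ((s - 1 / 2) ^ 2 + ((γ:ℝ):ℂ) ^ 2)) ∧
    deriv riemannZeta s / riemannZeta s = c - 1 / (s - 1) +
      (∑' γ : zetaOrd, (s - 1 / 2) / ((s - 1 / 2) ^ 2 + ((γ:ℝ):ℂ) ^ 2)) -
      ∑' j : ℕ, (1 / (2 * ((j:ℂ) + 1)) - 1 / (s + 2 * (j + 1))) := by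
  obtain ⟨c, hc⟩ := exists_hasSum_logDeriv_Gamma
  refine ⟨Real.log Real.pi / 2 + c / 2, fun s hs hs1 hz => ?_⟩
  have hs0 : s ≠ 0 := fun h => by rw [h] at hs; simp at hs
  have hzs := hasSum_zetaOrd H.1 H.2 (xiFn_sub_half_ne_zero H.1 hz)
  have hs2 : 0 < (s / 2).re := by simpa using hs
  have hG := (hc _ hs2).div_const 2
  have hG' : HasSum (fun j : ℕ => 1 / (2 * ((j:ℂ) + 1)) - 1 / (s + 2 * (j + 1)))
      ((deriv Gamma (s / 2) / Gamma (s / 2) + c + 1 / (s / 2)) / 2) := by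
    refine hG.congr_fun fun j => ?_
    have h2 : s / 2 + j + 1 = (s + 2 * (j + 1)) / 2 := by ring
    rw [h2, one_div_div, ← div_div, div_right_comm]
    ring
  refine ⟨hG'.summable, hzs.summable, ?_⟩
  rw [hG'.tsum_eq, hzs.tsum_eq]
  have hev : (fun w => xiFn (w - 1 / 2)) =ᶠ[nhds s]
      fun w => w * (w - 1) * (Gammaℝ w * riemannZeta w) := by
    filter_upwards [(continuous_re.tendsto s).eventually_const_lt hs,
      isOpen_ne.mem_nhds hs1] with w hw hw1
    have := xiFn_eq_zeta (z := w - 1 / 2) (by simpa using hw) (by simpa using hw1)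
    simpa using this
  have h1 : deriv xiFn (s - 1 / 2) = deriv (fun w => xiFn (w - 1 / 2)) s :=
    (deriv_comp_sub_const _ _ _).symm
  have h0 : xiFn (s - 1 / 2) = _ := hev.self_of_nhds
  have hgd := differentiableAt_Gammaℝ hs
  have hzd := differentiableAt_riemannZeta hs1
  have hg0 := Gammaℝ_ne_zero_of_re_pos hs
  have h2 : HasDerivAt (fun w => w * (w - 1) * (Gammaℝ w * riemannZeta w)) _ s :=
    (((hasDerivAt_id s).mul ((hasDerivAt_id s).sub_const 1)).mul
    (hgd.hasDerivAt.mul hzd.hasDerivAt))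
  have hs1' : s - 1 ≠ 0 := sub_ne_zero.mpr hs1
  have h3 : deriv xiFn (s - 1 / 2) / xiFn (s - 1 / 2) =
      1 / s + 1 / (s - 1) + deriv Gammaℝ s / Gammaℝ s + deriv riemannZeta s / riemannZeta s := by
    rw [h1, hev.deriv_eq, h0, h2.deriv]
    simp only [id, Pi.mul_apply]
    field_simp
    ring
  rw [h3, deriv_Gammaℝ_div hs, one_div_div]
  push_cast
  field_simp
  ring

theorem zeta_ne_zero_of_half_lt (H : SimpleRH) {s : ℂ} (hs : 1 / 2 < s.re) : riemannZeta s ≠ 0 := by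
  intro h
  rcases eq_or_ne s 1 with rfl | h1
  · exact riemannZeta_ne_zero_of_one_le_re (by simp) h
  have := H.1 s h (by
    rintro ⟨n, rfl⟩
    simp at hs
    have : (0:ℝ) ≤ n := Nat.cast_nonneg n
    linarith) h1
  linarith

theorem sub_zetaOrd_ne_zero {s : ℂ} (hz : riemannZeta s ≠ 0) (γ : zetaOrd) :
    s - 1 / 2 - (γ:ℝ) * I ≠ 0 := by
  intro h
  have : s = 1 / 2 + (γ:ℝ) * I := by linear_combination h
  rw [this] at hz
  exact hz γ.2

theorem normSq_sub_zetaOrd (s : ℂ) (γ : ℝ) :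
    ‖s - 1 / 2 - (γ:ℝ) * I‖ ^ 2 = (s.re - 1 / 2) ^ 2 + (s.im - γ) ^ 2 := by
  rw [← normSq_eq_norm_sq, normSq_apply]
  simp
  ring

theorem summable_zetaOrd_shift (H : SimpleRH) (x y : ℝ) :
    Summable (fun γ : zetaOrd => 1 / (x ^ 2 + (y - (γ:ℝ)) ^ 2)) := by
  refine Summable.of_norm_bounded_eventually ((summable_zetaOrd H.1 H.2).mul_left 8) ?_
  have hcof : ∀ᶠ γ : zetaOrd in cofinite, ¬ |(γ:ℝ)| ≤ 2 * |y| + 1 := by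
    rw [eventually_cofinite]
    simpa using finite_zetaOrd_abs_le (2 * |y| + 1)
  filter_upwards [hcof] with γ hγ
  push Not at hγ
  rw [Real.norm_of_nonneg (by positivity), mul_one_div]
  have h1 : |(γ:ℝ)| ≤ |y - γ| + |y| := by
    have := abs_sub_abs_le_abs_sub (γ:ℝ) y
    rw [abs_sub_comm] at this; linarith
  have h2 : (|(γ:ℝ)| + 1) / 2 ≤ |y - γ| := by linarith
  have h3 : ((|(γ:ℝ)| + 1) / 2) ^ 2 ≤ (y - γ) ^ 2 := by
    rw [← sq_abs (y - γ)]
    gcongr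
  have h4 : (1 + (γ:ℝ) ^ 2) / 8 ≤ x ^ 2 + (y - γ) ^ 2 := by
    have := sq_abs (γ:ℝ)
    nlinarith [sq_nonneg x, abs_nonneg (γ:ℝ)]
  rw [show 8 / (1 + (γ:ℝ) ^ 2) = 1 / ((1 + (γ:ℝ) ^ 2) / 8) by rw [one_div_div]]
  exact one_div_le_one_div_of_le (by positivity) h4

theorem summable_zetaOrd_inv_sq (H : SimpleRH) (s : ℂ) :
    Summable (fun γ : zetaOrd => 1 / ‖s - 1 / 2 - (γ:ℝ) * I‖ ^ 2) := by
  simp only [normSq_sub_zetaOrd]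
  exact summable_zetaOrd_shift H _ _

theorem summable_trivial_inv_sq {s : ℂ} (hs : 0 < s.re) :
    Summable (fun j : ℕ => 1 / ‖s + 2 * ((j:ℂ) + 1)‖ ^ 2) := by
  refine Summable.of_nonneg_of_le (fun j => by positivity) (fun j => ?_)
    summable_one_div_nat_add_one_sq
  have h1 : (j:ℝ) + 1 ≤ ‖s + 2 * ((j:ℂ) + 1)‖ := by
    refine le_trans ?_ (re_le_norm _)
    simp
    have : (0:ℝ) ≤ j := Nat.cast_nonneg j
    linarith
  gcongr

/-- The contribution of the nontrivial zeros to the real part of the logarithmic derivative. -/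
noncomputable def zeroSum (s : ℂ) : ℝ :=
  ∑' γ : zetaOrd, (s.re - 1 / 2) / ((s.re - 1 / 2) ^ 2 + (s.im - (γ:ℝ)) ^ 2)

theorem summable_zeroSum (H : SimpleRH) (s : ℂ) :
    Summable fun γ : zetaOrd => (s.re - 1 / 2) / ((s.re - 1 / 2) ^ 2 + (s.im - (γ:ℝ)) ^ 2) := by
  simpa [div_eq_mul_inv] using (summable_zetaOrd_shift H (s.re - 1 / 2) s.im).mul_left (s.re - 1 / 2)

theorem tsum_zetaOrd_symm {E : Type*} [NormedAddCommGroup E] [NormedSpace ℝ E] {f : zetaOrd → E}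
    (hf : Summable f) : ∑' γ, f γ = ∑' γ, (1 / 2 : ℝ) • (f γ + f (zetaOrdNeg γ)) := by
  have h1 : ∑' γ, f (zetaOrdNeg γ) = ∑' γ, f γ := zetaOrdNeg.tsum_eq f
  have h2 : Summable fun γ => f (zetaOrdNeg γ) := zetaOrdNeg.summable_iff.mpr hf
  rw [tsum_const_smul'' (1 / 2 : ℝ), hf.tsum_add h2, h1, ← two_smul ℝ, smul_smul]
  norm_num

theorem re_pair (z : ℂ) (γ : ℝ) (h1 : z - γ * I ≠ 0) (h2 : z + γ * I ≠ 0) :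
    z / (z ^ 2 + (γ:ℂ) ^ 2) = 1 / 2 * (1 / (z - γ * I) + 1 / (z + γ * I)) := by
  have : z ^ 2 + (γ:ℂ) ^ 2 = (z - γ * I) * (z + γ * I) := by
    ring_nf; rw [I_sq]; ring
  rw [this]
  field_simp
  ring

theorem exists_re_zeta_logDeriv_eq (H : SimpleRH) : ∃ c : ℝ, ∀ s : ℂ, 0 < s.re → s ≠ 1 →
    riemannZeta s ≠ 0 →
    Summable (fun j : ℕ => 1 / (2 * ((j:ℝ) + 1)) - (1 / (s + 2 * (j + 1))).re) ∧
    (deriv riemannZeta s / riemannZeta s).re = zeroSum s - (c + (1 / (s - 1)).re +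
      ∑' j : ℕ, (1 / (2 * ((j:ℝ) + 1)) - (1 / (s + 2 * (j + 1))).re)) := by
  obtain ⟨c, hc⟩ := exists_zeta_logDeriv_eq H
  refine ⟨-c, fun s hs hs1 hz => ?_⟩
  obtain ⟨h1, h2, h3⟩ := hc s hs hs1 hz
  have e1 : ∀ j : ℕ, (1 / (2 * ((j:ℂ) + 1)) - 1 / (s + 2 * (j + 1))).re =
      1 / (2 * ((j:ℝ) + 1)) - (1 / (s + 2 * (j + 1))).re := by
    intro j
    rw [sub_re, show 1 / (2 * ((j:ℂ) + 1)) = ((1 / (2 * ((j:ℝ) + 1)) : ℝ) : ℂ) by push_cast; rfl,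
      ofReal_re]
  have h1' := Complex.hasSum_re h1.hasSum
  simp only [e1] at h1'
  refine ⟨h1'.summable, ?_⟩
  have h2' := Complex.hasSum_re h2.hasSum
  rw [h3]
  simp only [sub_re, add_re, ofReal_re]
  rw [h1'.tsum_eq, ← h2'.tsum_eq, zeroSum, tsum_zetaOrd_symm (summable_zeroSum H s)]
  have : ∀ γ : zetaOrd, ((s - 1 / 2) / ((s - 1 / 2) ^ 2 + ((γ:ℝ):ℂ) ^ 2)).re =
      (1 / 2 : ℝ) • ((s.re - 1 / 2) / ((s.re - 1 / 2) ^ 2 + (s.im - (γ:ℝ)) ^ 2) +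
        (s.re - 1 / 2) / ((s.re - 1 / 2) ^ 2 + (s.im - (zetaOrdNeg γ:ℝ)) ^ 2)) := by
    intro γ
    have a1 := sub_zetaOrd_ne_zero hz γ
    have a2 := sub_zetaOrd_ne_zero hz (zetaOrdNeg γ)
    have hneg : ((zetaOrdNeg γ : zetaOrd) : ℝ) = -(γ:ℝ) := rfl
    have a2' : s - 1 / 2 + (γ:ℝ) * I ≠ 0 := by
      rw [hneg] at a2; push_cast at a2; convert a2 using 1; ring
    have key : ∀ x : ℝ, (1 / (s - 1 / 2 - x * I)).re =
        (s.re - 1 / 2) / ((s.re - 1 / 2) ^ 2 + (s.im - x) ^ 2) := by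
      intro x
      rw [one_div, inv_re, normSq_eq_norm_sq, normSq_sub_zetaOrd]
      simp
    rw [re_pair _ _ a1 a2', show s - 1 / 2 + (γ:ℝ) * I = s - 1 / 2 - ((-(γ:ℝ) : ℝ) : ℂ) * I by
      push_cast; ring, show (1 / 2 : ℂ) = ((1 / 2 : ℝ) : ℂ) by push_cast; rfl, re_ofReal_mul, add_re]
    have k1 := key γ
    have k2 := key (-(γ:ℝ))
    push_cast at k1 k2 ⊢
    rw [k1, k2, hneg, smul_eq_mul]
  rw [tsum_congr this]
  ring

theorem inv_sub_inv_bound {a b : ℂ} (ha : a ≠ 0) (hb : b ≠ 0) :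
    ‖1 / b - 1 / a‖ ≤ ‖b - a‖ * (1 / ‖a‖ ^ 2 + 1 / ‖b‖ ^ 2) := by
  have : 1 / b - 1 / a = (a - b) * (1 / a * (1 / b)) := by field_simp
  rw [this, norm_mul, norm_sub_rev]
  gcongr
  rw [norm_mul, norm_div, norm_div, norm_one]
  have h1 : 1 / ‖a‖ ^ 2 = (1 / ‖a‖) ^ 2 := by rw [div_pow, one_pow]
  have h2 : 1 / ‖b‖ ^ 2 = (1 / ‖b‖) ^ 2 := by rw [div_pow, one_pow]
  rw [h1, h2]
  nlinarith [sq_nonneg (1 / ‖a‖ - 1 / ‖b‖), sq_nonneg (1 / ‖a‖), sq_nonneg (1 / ‖b‖)]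

theorem zeta_logDeriv_sub (H : SimpleRH) {s s' : ℂ} (hs : 0 < s.re) (hs1 : s ≠ 1)
    (hz : riemannZeta s ≠ 0) (hs' : 0 < s'.re) (hs1' : s' ≠ 1) (hz' : riemannZeta s' ≠ 0) :
    deriv riemannZeta s' / riemannZeta s' - deriv riemannZeta s / riemannZeta s =
      (∑' γ : zetaOrd, (1 / (s' - 1 / 2 - (γ:ℝ) * I) - 1 / (s - 1 / 2 - (γ:ℝ) * I))) +
      (∑' j : ℕ, (1 / (s' + 2 * ((j:ℂ) + 1)) - 1 / (s + 2 * ((j:ℂ) + 1)))) -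
      (1 / (s' - 1) - 1 / (s - 1)) := by
  obtain ⟨c, hc⟩ := exists_zeta_logDeriv_eq H
  obtain ⟨h1, h2, h3⟩ := hc s hs hs1 hz
  obtain ⟨h1', h2', h3'⟩ := hc s' hs' hs1' hz'
  have hsum : Summable fun γ : zetaOrd =>
      (1 / (s' - 1 / 2 - (γ:ℝ) * I) - 1 / (s - 1 / 2 - (γ:ℝ) * I)) := by
    refine Summable.of_norm_bounded (((summable_zetaOrd_inv_sq H s).add
      (summable_zetaOrd_inv_sq H s')).mul_left ‖s' - s‖) fun γ => ?_
    refine (inv_sub_inv_bound (sub_zetaOrd_ne_zero hz γ) (sub_zetaOrd_ne_zero hz' γ)).trans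
      (le_of_eq ?_)
    congr 2; ring
  have e2 : (∑' γ : zetaOrd, (1 / (s' - 1 / 2 - (γ:ℝ) * I) - 1 / (s - 1 / 2 - (γ:ℝ) * I))) =
      (∑' γ : zetaOrd, (s' - 1 / 2) / ((s' - 1 / 2) ^ 2 + ((γ:ℝ):ℂ) ^ 2)) -
      ∑' γ : zetaOrd, (s - 1 / 2) / ((s - 1 / 2) ^ 2 + ((γ:ℝ):ℂ) ^ 2) := by
    rw [tsum_zetaOrd_symm hsum, ← h2'.tsum_sub h2]
    refine tsum_congr fun γ => ?_
    have pair : ∀ u : ℂ, riemannZeta u ≠ 0 → (u - 1 / 2) / ((u - 1 / 2) ^ 2 + ((γ:ℝ):ℂ) ^ 2) =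
        1 / 2 * (1 / (u - 1 / 2 - (γ:ℝ) * I) + 1 / (u - 1 / 2 + (γ:ℝ) * I)) := by
      intro u hu
      have a2 := sub_zetaOrd_ne_zero hu (zetaOrdNeg γ)
      have hneg : ((zetaOrdNeg γ : zetaOrd) : ℝ) = -(γ:ℝ) := rfl
      refine re_pair _ _ (sub_zetaOrd_ne_zero hu γ) ?_
      rw [hneg] at a2; push_cast at a2; convert a2 using 1; ring
    have hneg : ((zetaOrdNeg γ : zetaOrd) : ℝ) = -(γ:ℝ) := rfl
    rw [pair s hz, pair s' hz', hneg]
    simp only [real_smul]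
    push_cast
    simp only [neg_mul, sub_neg_eq_add]
    ring
  have e1 : (∑' j : ℕ, (1 / (s' + 2 * ((j:ℂ) + 1)) - 1 / (s + 2 * ((j:ℂ) + 1)))) =
      (∑' j : ℕ, (1 / (2 * ((j:ℂ) + 1)) - 1 / (s + 2 * (j + 1)))) -
      ∑' j : ℕ, (1 / (2 * ((j:ℂ) + 1)) - 1 / (s' + 2 * (j + 1))) := by
    rw [← h1.tsum_sub h1']
    exact tsum_congr fun j => by ring
  rw [h3, h3', e1, e2]
  ring

theorem trivialTerm_eq (s : ℂ) (hs : 0 < s.re) (j : ℕ) :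
    1 / (2 * ((j:ℝ) + 1)) - (1 / (s + 2 * ((j:ℂ) + 1))).re =
      (s.re * (s.re + 2 * (j + 1)) + s.im ^ 2) /
        (2 * ((j:ℝ) + 1) * ((s.re + 2 * (j + 1)) ^ 2 + s.im ^ 2)) := by
  have hj : (0:ℝ) < (j:ℝ) + 1 := by positivity
  have hp : 0 < (s.re + 2 * ((j:ℝ) + 1)) ^ 2 + s.im ^ 2 := by positivity
  have : (1 / (s + 2 * ((j:ℂ) + 1))).re =
      (s.re + 2 * ((j:ℝ) + 1)) / ((s.re + 2 * ((j:ℝ) + 1)) ^ 2 + s.im ^ 2) := by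
    rw [one_div, inv_re, normSq_apply]
    simp
    ring
  rw [this]
  field_simp
  ring

theorem harmonic_eq_sum (n : ℕ) :
    (harmonic n : ℝ) = ∑ j ∈ Finset.range n, 1 / ((j:ℝ) + 1) := by
  simp [harmonic]

theorem sum_inv_sq_tail_le {N : ℕ} (hN : 0 < N) (n : ℕ) :
    ∑ j ∈ Finset.range n, 1 / (((j + N : ℕ):ℝ) + 1) ^ 2 ≤ 1 / (N:ℝ) := by
  have hN' : (0:ℝ) < N := by exact_mod_cast hN
  have : ∑ j ∈ Finset.range n, 1 / (((j + N : ℕ):ℝ) + 1) ^ 2 ≤ 1 / (N:ℝ) - 1 / (N + n) := by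
    induction n with
    | zero => simp
    | succ n ih =>
      rw [Finset.sum_range_succ]
      have : 1 / (((n + N : ℕ):ℝ) + 1) ^ 2 ≤ 1 / ((N:ℝ) + n) - 1 / ((N:ℝ) + (n + 1 : ℕ)) := by
        have hn : (0:ℝ) ≤ n := Nat.cast_nonneg n
        push_cast
        rw [div_sub_div _ _ (by positivity) (by positivity), div_le_div_iff₀ (by positivity) (by positivity)]
        nlinarith
      linarith
  have h2 : (0:ℝ) ≤ 1 / ((N:ℝ) + n) := by positivity
  linarith

theorem tsum_trivialTerm_le {T : ℝ} (hT : 2 ≤ T) {s : ℂ} (hs : 0 < s.re) (hsT : s.re ≤ 3 * T)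
    (ht : |s.im| ≤ 3 * T)
    (hsum : Summable (fun j : ℕ => 1 / (2 * ((j:ℝ) + 1)) - (1 / (s + 2 * ((j:ℂ) + 1))).re)) :
    ∑' j : ℕ, (1 / (2 * ((j:ℝ) + 1)) - (1 / (s + 2 * ((j:ℂ) + 1))).re) ≤
      1 / 2 * Real.log T + 7 := by
  set N := ⌊T⌋₊ with hN
  have hN0 : 0 < N := Nat.floor_pos.mpr (by linarith)
  have hNT : (N:ℝ) ≤ T := Nat.floor_le (by linarith)
  have hTN : T < N + 1 := Nat.lt_floor_add_one T
  have hN' : (1:ℝ) ≤ N := by exact_mod_cast hN0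
  rw [← hsum.sum_add_tsum_nat_add N]
  have h1 : ∑ j ∈ Finset.range N, (1 / (2 * ((j:ℝ) + 1)) - (1 / (s + 2 * ((j:ℂ) + 1))).re) ≤
      1 / 2 * (1 + Real.log T) := by
    have : ∑ j ∈ Finset.range N, (1 / (2 * ((j:ℝ) + 1)) - (1 / (s + 2 * ((j:ℂ) + 1))).re) ≤
        1 / 2 * (harmonic N : ℝ) := by
      rw [harmonic_eq_sum, Finset.mul_sum]
      refine Finset.sum_le_sum fun j _ => ?_
      have hp : 0 ≤ (1 / (s + 2 * ((j:ℂ) + 1))).re := by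
        rw [one_div, inv_re]
        refine div_nonneg ?_ (normSq_nonneg _)
        simp
        positivity
      have : 1 / (2 * ((j:ℝ) + 1)) = 1 / 2 * (1 / ((j:ℝ) + 1)) := by rw [one_div_mul_one_div]
      linarith
    refine this.trans ?_
    gcongr
    refine (harmonic_le_one_add_log N).trans ?_
    gcongr
  have h2 : ∑' j : ℕ, (1 / (2 * (((j + N : ℕ):ℝ) + 1)) - (1 / (s + 2 * (((j + N : ℕ):ℂ) + 1))).re) ≤
      3 * T * (1 / N) := by
    have hterm : ∀ j : ℕ, 0 ≤ 1 / (2 * (((j + N : ℕ):ℝ) + 1)) -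
        (1 / (s + 2 * (((j + N : ℕ):ℂ) + 1))).re ∧ 1 / (2 * (((j + N : ℕ):ℝ) + 1)) -
        (1 / (s + 2 * (((j + N : ℕ):ℂ) + 1))).re ≤ 3 * T * (1 / (((j + N : ℕ):ℝ) + 1) ^ 2) := by
      intro j
      rw [trivialTerm_eq s hs]
      have hm : T ≤ (((j + N : ℕ):ℝ) + 1) := by
        push_cast
        have : (0:ℝ) ≤ j := Nat.cast_nonneg j
        linarith
      set m : ℝ := (((j + N : ℕ):ℝ) + 1)
      have hm0 : 0 < m := by linarith
      refine ⟨by positivity, ?_⟩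
      rw [mul_one_div, div_le_div_iff₀ (by positivity) (by positivity)]
      have him : s.im ^ 2 ≤ (3 * T) ^ 2 := by rw [← sq_abs]; gcongr
      have a1 : s.re * (s.re + 2 * m) * m ≤ 3 * T * (s.re + 2 * m) ^ 2 := by
        have : s.re * m ≤ 3 * T * (s.re + 2 * m) := by nlinarith
        nlinarith [mul_pos hs hm0]
      have a2 : s.im ^ 2 * m ≤ 3 * T * (s.re + 2 * m) ^ 2 := by
        have e1 : (2 * m) ^ 2 ≤ (s.re + 2 * m) ^ 2 := by gcongr; linarith
        have e2 : s.im ^ 2 * m ≤ (3 * T) ^ 2 * m := by gcongr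
        have e3 : (3 * T) ^ 2 * m ≤ 3 * T * (2 * m) ^ 2 := by
          have : 3 * T * m ≤ (2 * m) ^ 2 := by nlinarith
          nlinarith
        nlinarith
      have a3 : 0 ≤ 3 * T * s.im ^ 2 := by positivity
      nlinarith
    refine Real.tsum_le_of_sum_range_le (fun j => (hterm j).1) fun n => ?_
    refine (Finset.sum_le_sum fun j _ => (hterm j).2).trans ?_
    rw [← Finset.mul_sum]
    gcongr
    exact sum_inv_sq_tail_le hN0 n
  have h3 : 3 * T * (1 / (N:ℝ)) ≤ 6 := by
    rw [mul_one_div, div_le_iff₀ (by linarith)]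
    linarith
  linarith

theorem le_tsum_trivialTerm {t : ℝ} (ht : 4 ≤ t) {s : ℂ} (hs : s.re = 1 / 2) (him : s.im = t)
    (hsum : Summable (fun j : ℕ => 1 / (2 * ((j:ℝ) + 1)) - (1 / (s + 2 * ((j:ℂ) + 1))).re)) :
    1 / 4 * Real.log (t / 4) ≤
      ∑' j : ℕ, (1 / (2 * ((j:ℝ) + 1)) - (1 / (s + 2 * ((j:ℂ) + 1))).re) := by
  have hs0 : 0 < s.re := by rw [hs]; norm_num
  set N := ⌊t / 4⌋₊ with hN
  have hNt : (N:ℝ) ≤ t / 4 := Nat.floor_le (by linarith)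
  have htN : t / 4 < N + 1 := Nat.lt_floor_add_one _
  have h0 : ∀ j : ℕ, 0 ≤ 1 / (2 * ((j:ℝ) + 1)) - (1 / (s + 2 * ((j:ℂ) + 1))).re := by
    intro j; rw [trivialTerm_eq s hs0]; positivity
  refine le_trans ?_ (hsum.sum_le_tsum (Finset.range N) fun j _ => h0 j)
  have h1 : 1 / 4 * (harmonic N : ℝ) ≤
      ∑ j ∈ Finset.range N, (1 / (2 * ((j:ℝ) + 1)) - (1 / (s + 2 * ((j:ℂ) + 1))).re) := by
    rw [harmonic_eq_sum, Finset.mul_sum]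
    refine Finset.sum_le_sum fun j hj => ?_
    have hj' : (j:ℝ) + 1 ≤ N := by exact_mod_cast Finset.mem_range.mp hj
    rw [trivialTerm_eq s hs0, hs, him]
    set m : ℝ := (j:ℝ) + 1
    have hm : 0 < m := by positivity
    have hm1 : 1 ≤ m := by simp [m]
    rw [one_div_mul_one_div, div_le_div_iff₀ (by positivity) (by positivity)]
    have h6 : (1 / 2 + 2 * m) ^ 2 ≤ t ^ 2 := by gcongr; linarith
    nlinarith
  refine le_trans ?_ h1
  gcongr
  refine le_trans ?_ (log_add_one_le_harmonic N)
  gcongr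
  push_cast
  exact htN.le

theorem abs_re_one_div_sub_one_le {s : ℂ} (ht : 1 ≤ |s.im|) : |(1 / (s - 1)).re| ≤ 1 := by
  refine (abs_re_le_norm _).trans ?_
  rw [norm_div, norm_one, div_le_one₀]
  · refine ht.trans ?_
    have := abs_im_le_norm (s - 1)
    simpa using this
  · refine lt_of_lt_of_le (by linarith : 0 < |s.im|) ?_
    have := abs_im_le_norm (s - 1)
    simpa using this

theorem ne_one_of_abs_im {s : ℂ} (ht : 1 ≤ |s.im|) : s ≠ 1 := by
  rintro rfl; norm_num at ht

theorem zeroSum_sub_le (H : SimpleRH) : ∃ C : ℝ, 0 < C ∧ ∀ T : ℝ, 2 ≤ T → ∀ s : ℂ, 0 < s.re →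
    s.re ≤ 3 * T → 1 ≤ |s.im| → |s.im| ≤ 3 * T → riemannZeta s ≠ 0 →
    zeroSum s - (deriv riemannZeta s / riemannZeta s).re ≤ 1 / 2 * Real.log T + C := by
  obtain ⟨c, hc⟩ := exists_re_zeta_logDeriv_eq H
  refine ⟨|c| + 8, by positivity, fun T hT s hs hsT h1 h3 hz => ?_⟩
  obtain ⟨hs1, hs2⟩ := hc s hs (ne_one_of_abs_im h1) hz
  have := tsum_trivialTerm_le hT hs hsT h3 hs1
  have h4 := abs_le.mp (abs_re_one_div_sub_one_le h1)
  have := le_abs_self c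
  linarith

theorem neg_re_logDeriv_ge (H : SimpleRH) : ∃ C : ℝ, 0 < C ∧ ∀ t : ℝ, 4 ≤ t →
    riemannZeta (1 / 2 + t * I) ≠ 0 →
    1 / 4 * Real.log t - C ≤
      -(deriv riemannZeta (1 / 2 + t * I) / riemannZeta (1 / 2 + t * I)).re := by
  obtain ⟨c, hc⟩ := exists_re_zeta_logDeriv_eq H
  refine ⟨|c| + 1 + Real.log 4, by positivity, fun t ht hz => ?_⟩
  have hre : ((1:ℂ) / 2 + t * I).re = 1 / 2 := by simp
  have him : ((1:ℂ) / 2 + t * I).im = t := by simp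
  have h1 : 1 ≤ |((1:ℂ) / 2 + t * I).im| := by rw [him, abs_of_pos] <;> linarith
  obtain ⟨hs1, hs2⟩ := hc _ (by rw [hre]; norm_num) (ne_one_of_abs_im h1) hz
  have h2 := le_tsum_trivialTerm ht hre him hs1
  have h4 := abs_le.mp (abs_re_one_div_sub_one_le h1)
  have h5 : zeroSum (1 / 2 + t * I) = 0 := by
    unfold zeroSum
    rw [hre]
    simp
  have h6 := neg_abs_le c
  rw [Real.log_div (by linarith) (by norm_num)] at h2
  have h7 : 0 ≤ Real.log 4 := Real.log_nonneg (by norm_num)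
  rw [hs2, h5]
  linarith

open ArithmeticFunction in
theorem norm_zeta_logDeriv_le : ∃ C : ℝ, 0 < C ∧ ∀ s : ℂ, 2 ≤ s.re →
    ‖deriv riemannZeta s / riemannZeta s‖ ≤ C := by
  have h2 : LSeriesSummable (fun n => ((vonMangoldt n : ℝ) : ℂ)) 2 :=
    LSeriesSummable_vonMangoldt (by norm_num)
  refine ⟨∑' n, ‖LSeries.term (fun n => ((vonMangoldt n : ℝ) : ℂ)) 2 n‖ + 1, by positivity, fun s hs => ?_⟩
  have h1 := LSeries_vonMangoldt_eq_deriv_riemannZeta_div (s := s) (by linarith)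
  rw [neg_div] at h1
  rw [← norm_neg, ← h1, LSeries]
  have hle : ∀ n, ‖LSeries.term (fun n => ((vonMangoldt n : ℝ) : ℂ)) s n‖ ≤
      ‖LSeries.term (fun n => ((vonMangoldt n : ℝ) : ℂ)) 2 n‖ := fun n =>
    LSeries.norm_term_le_of_re_le_re _ (by simpa using hs) n
  have := tsum_of_norm_bounded h2.norm.hasSum hle
  linarith

/-- Weighted zero count far from the critical line. -/
theorem tsum_zetaOrd_shift_le (H : SimpleRH) : ∃ C : ℝ, 0 < C ∧ ∀ T : ℝ, 2 ≤ T → ∀ t : ℝ,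
    T ≤ t → t ≤ 2 * T →
    ∑' γ : zetaOrd, 1 / (T ^ 2 + (t - (γ:ℝ)) ^ 2) ≤ C * Real.log T / T := by
  obtain ⟨C1, hC1, h1⟩ := zeroSum_sub_le H
  obtain ⟨C2, hC2, h2⟩ := norm_zeta_logDeriv_le
  refine ⟨1 / 2 + (C1 + C2) / Real.log 2, by positivity, fun T hT t htT ht2 => ?_⟩
  set s : ℂ := ((1 / 2 + T : ℝ) : ℂ) + t * I with hs
  have hre : s.re = 1 / 2 + T := by simp [hs]
  have him : s.im = t := by simp [hs]
  have ha : |s.im| = t := by rw [him, abs_of_pos]; linarith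
  have hb := h1 T hT s (by linarith) (by linarith) (by linarith) (by linarith)
    (zeta_ne_zero_of_half_lt H (by linarith))
  have hc := (abs_le.mp ((abs_re_le_norm _).trans (h2 s (by linarith)))).2
  have hF : zeroSum s = T * ∑' γ : zetaOrd, 1 / (T ^ 2 + (t - (γ:ℝ)) ^ 2) := by
    rw [← tsum_mul_left, zeroSum]
    refine tsum_congr fun γ => ?_
    rw [hre, him]
    ring
  have hlog : Real.log 2 ≤ Real.log T := Real.log_le_log (by norm_num) hT
  have hl2 : 0 < Real.log 2 := Real.log_pos (by norm_num)
  rw [le_div_iff₀ (by linarith), mul_comm, ← hF, add_mul]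
  have : C1 + C2 ≤ (C1 + C2) / Real.log 2 * Real.log T := by
    rw [div_mul_eq_mul_div, le_div_iff₀ hl2]
    gcongr
  linarith

section Laplace
open MeasureTheory Set

theorem norm_exp_neg_mul_ofReal {w : ℂ} (X : ℝ) : ‖cexp (-w * X)‖ = Real.exp (-(w.re * X)) := by
  rw [norm_exp]; simp

theorem laplace_tsum {ι : Type*} [Countable ι] {F : ι → ℝ → ℂ} {u : ι → ℝ}
    (hF : ∀ i, Continuous (F i)) (hu : Summable u)
    (hb : ∀ i X, 0 ≤ X → ‖F i X‖ ≤ u i * Real.exp X) :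
    ContinuousOn (fun X => ∑' i, F i X) (Ici 0) ∧
    ∀ w : ℂ, w.re = 3 → IntegrableOn (fun X : ℝ => cexp (-w * X) * ∑' i, F i X) (Ioi 0) ∧
    HasSum (fun i => ∫ X in Ioi (0:ℝ), cexp (-w * X) * F i X)
      (∫ X in Ioi (0:ℝ), cexp (-w * X) * ∑' i, F i X) := by
  have hcont : ContinuousOn (fun X => ∑' i, F i X) (Ici 0) := by
    intro x hx
    have h1 : ContinuousOn (fun X => ∑' i, F i X) (Icc 0 (x + 1)) := by
      refine continuousOn_tsum (fun i => (hF i).continuousOn) (hu.mul_right (Real.exp (x + 1))) ?_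
      intro i y hy
      refine (hb i y hy.1).trans ?_
      have hui : 0 ≤ u i := by
        have := (norm_nonneg _).trans (hb i 0 le_rfl); simpa using this
      gcongr
      exact hy.2
    have h2 : Icc 0 (x + 1) ∈ nhdsWithin x (Ici 0) := by
      have : Iio (x + 1) ∈ nhds x := Iio_mem_nhds (by linarith)
      filter_upwards [self_mem_nhdsWithin, mem_nhdsWithin_of_mem_nhds this] with y h1 h2
      exact ⟨h1, le_of_lt h2⟩
    exact (h1 x ⟨hx, by linarith⟩).mono_of_mem_nhdsWithin h2
  refine ⟨hcont, fun w hw => ?_⟩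
  have hub : ∀ i, 0 ≤ u i := fun i => by
    have := (norm_nonneg _).trans (hb i 0 le_rfl); simpa using this
  have hexp : IntegrableOn (fun X : ℝ => Real.exp (-2 * X)) (Ioi 0) :=
    integrableOn_exp_mul_Ioi (by norm_num) 0
  have hpt : ∀ (v : ℝ) (z : ℂ) (X : ℝ), ‖z‖ ≤ v * Real.exp X →
      ‖cexp (-w * X) * z‖ ≤ v * Real.exp (-2 * X) := by
    intro v z X h
    rw [norm_mul, norm_exp_neg_mul_ofReal, hw]
    calc Real.exp (-(3 * X)) * ‖z‖ ≤ Real.exp (-(3 * X)) * (v * Real.exp X) := by gcongr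
      _ = v * (Real.exp (-(3 * X)) * Real.exp X) := by ring
      _ = v * Real.exp (-2 * X) := by rw [← Real.exp_add]; congr 2; ring
  have hint : ∀ i, IntegrableOn (fun X : ℝ => cexp (-w * X) * F i X) (Ioi 0) := by
    intro i
    refine Integrable.mono' (hexp.const_mul (u i)) ?_ ?_
    · have := hF i
      exact Continuous.aestronglyMeasurable (by fun_prop)
    · refine (ae_restrict_iff' measurableSet_Ioi).mpr (ae_of_all _ fun X hX => ?_)
      exact hpt _ _ _ (hb i X (le_of_lt hX))
  constructor
  · refine Integrable.mono' (hexp.const_mul (∑' i, u i)) ?_ ?_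
    · have h1 : ContinuousOn (fun X : ℝ => cexp (-w * X) * ∑' i, F i X) (Ioi 0) :=
        ContinuousOn.mul (by fun_prop) (hcont.mono Ioi_subset_Ici_self)
      exact h1.aestronglyMeasurable measurableSet_Ioi
    · refine (ae_restrict_iff' measurableSet_Ioi).mpr (ae_of_all _ fun X hX => ?_)
      refine hpt _ _ _ ?_
      rw [← tsum_mul_right]
      exact tsum_of_norm_bounded (hu.mul_right _).hasSum fun i => hb i X (le_of_lt hX)
  · have := hasSum_integral_of_summable_integral_norm (μ := volume.restrict (Ioi (0:ℝ)))
      (F := fun i (X : ℝ) => cexp (-w * X) * F i X) hint ?_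
    · simpa only [tsum_mul_left] using this
    · refine Summable.of_nonneg_of_le (fun i => integral_nonneg fun X => norm_nonneg _) (fun i => ?_)
        (hu.mul_right (∫ X in Ioi (0:ℝ), Real.exp (-2 * X)))
      rw [← integral_const_mul]
      refine setIntegral_mono_on (hint i).norm (hexp.const_mul _) measurableSet_Ioi ?_
      intro X hX
      exact hpt _ _ _ (hb i X (le_of_lt hX))

theorem eq_zero_of_laplace_eq_zero {G : ℝ → ℂ} (hG : ContinuousOn G (Ici 0)) (h0 : G 0 = 0)
    (hint : ∀ w : ℂ, w.re = 3 → IntegrableOn (fun X : ℝ => cexp (-w * X) * G X) (Ioi 0))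
    (hzero : ∀ w : ℂ, w.re = 3 → ∫ X in Ioi (0:ℝ), cexp (-w * X) * G X = 0) {X : ℝ} (hX : 0 ≤ X) :
    G X = 0 := by
  set f : ℝ → ℂ := fun X => cexp (-3 * X) * G (max X 0) with hf
  have hfc : Continuous f := by
    have : Continuous fun X : ℝ => G (max X 0) :=
      hG.comp_continuous (by fun_prop) fun X => Set.mem_Ici.mpr (le_max_right _ _)
    exact Continuous.mul (by fun_prop) this
  have hf0 : ∀ x ∉ Ioi (0:ℝ), f x = 0 := by
    intro x hx
    have : max x 0 = 0 := max_eq_right (not_lt.mp hx)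
    simp [hf, this, h0]
  have hfpos : ∀ x ∈ Ioi (0:ℝ), f x = cexp (-3 * x) * G x := by
    intro x hx
    have : max x 0 = x := max_eq_left (le_of_lt hx)
    simp [hf, this]
  have hfi : Integrable f := by
    rw [← integrableOn_iff_integrable_of_support_subset (s := Ioi (0:ℝ))]
    · exact (hint 3 (by simp)).congr_fun (fun x hx => (hfpos x hx).symm) measurableSet_Ioi
    · intro x hx
      by_contra h
      exact hx (hf0 x h)
  have hF : FourierTransform.fourier f = 0 := by
    ext y
    rw [Real.fourier_real_eq_integral_exp_smul, ← setIntegral_eq_integral_of_forall_compl_eq_zero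
      (s := Ioi (0:ℝ)) (fun x hx => by rw [hf0 x hx, smul_zero])]
    refine Eq.trans ?_ (hzero (3 + 2 * Real.pi * y * I) (by simp))
    refine setIntegral_congr_fun measurableSet_Ioi fun x hx => ?_
    rw [hfpos x hx, smul_eq_mul, ← mul_assoc, ← Complex.exp_add]
    congr 2
    push_cast
    ring
  have := hfc.fourierInv_fourier_eq hfi (by rw [hF]; exact integrable_zero _ _ _)
  rw [hF] at this
  have h2 : f X = 0 := by
    rw [← this, Real.fourierInv_eq]; simp
  simp only [hf, max_eq_left hX] at h2
  exact (mul_eq_zero.mp h2).resolve_left (exp_ne_zero _)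

theorem integral_exp_neg_mul {w : ℂ} (hw : 0 < w.re) :
    ∫ X in Ioi (0:ℝ), cexp (-w * X) = 1 / w := by
  rw [integral_exp_mul_complex_Ioi (by simpa using hw)]
  simp

theorem laplace_tent {w : ℂ} (hw : w.re = 3) {u : ℝ} (hu : 0 ≤ u) :
    ∫ X in Ioi (0:ℝ), cexp (-w * X) * ((max (X - u) 0 : ℝ) : ℂ) = cexp (-w * u) / w ^ 2 := by
  have hw0 : w ≠ 0 := fun h => by rw [h] at hw; simp at hw
  have hle : ∀ y : ℝ, max y 0 ≤ Real.exp y := fun y => by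
    have := Real.add_one_le_exp y
    exact max_le (by linarith) (Real.exp_pos y).le
  have hint : IntegrableOn (fun X : ℝ => cexp (-w * X) * ((max (X - u) 0 : ℝ) : ℂ)) (Ioi 0) := by
    have hexp : IntegrableOn (fun X : ℝ => Real.exp (-2 * X)) (Ioi 0) :=
      integrableOn_exp_mul_Ioi (by norm_num) 0
    refine Integrable.mono' hexp (Continuous.aestronglyMeasurable (by fun_prop)) ?_
    refine ae_of_all _ fun X => ?_
    rw [norm_mul, norm_exp_neg_mul_ofReal, hw, norm_real, Real.norm_of_nonneg (le_max_right _ _)]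
    calc _ ≤ Real.exp (-(3 * X)) * Real.exp (X - u) := by gcongr; exact hle _
      _ = Real.exp (-2 * X - u) := by rw [← Real.exp_add]; congr 1; ring
      _ ≤ _ := by gcongr; linarith
  have hsub : ∫ X in Ioi (0:ℝ), cexp (-w * X) * ((max (X - u) 0 : ℝ) : ℂ) =
      ∫ X in Ioi u, cexp (-w * X) * ((max (X - u) 0 : ℝ) : ℂ) := by
    refine (setIntegral_eq_of_subset_of_forall_sdiff_eq_zero measurableSet_Ioi
      (Ioi_subset_Ioi hu) ?_)
    intro x hx
    have : x ≤ u := not_lt.mp hx.2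
    rw [max_eq_right (by linarith)]
    simp
  rw [hsub]
  have hder : ∀ x ∈ Ioi u, HasDerivAt (fun X : ℝ => -(((X - u : ℝ) : ℂ) / w + 1 / w ^ 2) * cexp (-w * X))
      (cexp (-w * x) * ((max (x - u) 0 : ℝ) : ℂ)) x := by
    intro x hx
    rw [max_eq_left (by have : u < x := hx; linarith)]
    have h1 : HasDerivAt (fun X : ℝ => ((X - u : ℝ) : ℂ)) 1 x := by
      simpa using ((hasDerivAt_id x).sub_const u).ofReal_comp
    have h2 : HasDerivAt (fun X : ℝ => cexp (-w * X)) (cexp (-w * x) * (-w * 1)) x :=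
      (((hasDerivAt_id x).ofReal_comp).const_mul (-w)).cexp
    have := (((h1.div_const w).add_const (1 / w ^ 2)).neg).mul h2
    refine this.congr_deriv ?_
    simp only [Pi.neg_apply]
    field_simp
    ring
  have hlim : Tendsto (fun X : ℝ => -(((X - u : ℝ) : ℂ) / w + 1 / w ^ 2) * cexp (-w * X)) atTop
      (nhds 0) := by
    have e : ∀ X : ℝ, -(((X - u : ℝ) : ℂ) / w + 1 / w ^ 2) * cexp (-w * X) =
      -(1 / w) * (((X:ℝ):ℂ) * cexp (-w * X)) + ((u:ℂ) / w - 1 / w ^ 2) * cexp (-w * X) := by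
      intro X; push_cast; field_simp; ring
    simp only [e]
    have t1 : Tendsto (fun X : ℝ => cexp (-w * X)) atTop (nhds 0) := by
      rw [tendsto_zero_iff_norm_tendsto_zero]
      simp only [norm_exp_neg_mul_ofReal, hw]
      exact Real.tendsto_exp_neg_atTop_nhds_zero.comp (tendsto_id.const_mul_atTop (by norm_num))
    have t2 : Tendsto (fun X : ℝ => ((X:ℝ):ℂ) * cexp (-w * X)) atTop (nhds 0) := by
      rw [tendsto_zero_iff_norm_tendsto_zero]
      simp only [norm_mul, norm_exp_neg_mul_ofReal, hw, norm_real]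
      have := Real.tendsto_pow_mul_exp_neg_atTop_nhds_zero 1
      refine squeeze_zero' (Eventually.of_forall fun X => by positivity) ?_ this
      filter_upwards [eventually_ge_atTop 0] with X hX
      rw [Real.norm_of_nonneg hX, pow_one]
      gcongr
      linarith
    have t3 := (t2.const_mul (-(1 / w))).add (t1.const_mul ((u:ℂ) / w - 1 / w ^ 2))
    rw [mul_zero, mul_zero, add_zero] at t3
    exact t3
  have hc : Continuous (fun X : ℝ => -(((X - u : ℝ) : ℂ) / w + 1 / w ^ 2) * cexp (-w * X)) := by
    fun_prop
  have hint' := hint.mono_set (Ioi_subset_Ioi hu)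
  have hfin := integral_Ioi_of_hasDerivAt_of_tendsto hc.continuousWithinAt hder hint' hlim
  rw [hfin]
  simp
  field_simp

theorem laplace_one_sub_exp {w a : ℂ} (hw : w.re = 3) (ha : -1 ≤ a.re) (ha0 : a ≠ 0) :
    ∫ X in Ioi (0:ℝ), cexp (-w * X) * ((1 - cexp (-a * X)) / a ^ 2) =
      -(1 / w ^ 2) * (1 / (a + w) - 1 / a) := by
  have hw0 : w ≠ 0 := fun h => by rw [h] at hw; simp at hw
  have haw : a + w ≠ 0 := fun h => by
    have := congrArg Complex.re h; simp [hw] at this; linarith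
  have h1 : IntegrableOn (fun X : ℝ => cexp (-w * X)) (Ioi 0) :=
    integrableOn_exp_mul_complex_Ioi (by simp [hw]) 0
  have h2 : IntegrableOn (fun X : ℝ => cexp (-(a + w) * X)) (Ioi 0) :=
    integrableOn_exp_mul_complex_Ioi (by simp [hw]; linarith) 0
  have e : ∀ X : ℝ, cexp (-w * X) * ((1 - cexp (-a * X)) / a ^ 2) =
      (1 / a ^ 2) * (cexp (-w * X) - cexp (-(a + w) * X)) := by
    intro X
    rw [show -(a + w) * (X:ℂ) = -w * X + -a * X by ring, Complex.exp_add]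
    field_simp
  simp only [e]
  rw [integral_const_mul, integral_sub h1 h2, integral_exp_neg_mul (by rw [hw]; norm_num),
    integral_exp_neg_mul (by simp [hw]; linarith)]
  field_simp
  ring

theorem norm_one_sub_exp_div_le {a : ℂ} (ha : -1 ≤ a.re) {X : ℝ} (hX : 0 ≤ X) :
    ‖(1 - cexp (-a * X)) / a ^ 2‖ ≤ 2 * (1 / ‖a‖ ^ 2) * Real.exp X := by
  rw [norm_div, norm_pow, mul_right_comm, mul_one_div]
  gcongr
  refine (norm_sub_le _ _).trans ?_
  rw [norm_one, norm_exp_neg_mul_ofReal]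
  have h1 : 1 ≤ Real.exp X := Real.one_le_exp hX
  have h2 : Real.exp (-(a.re * X)) ≤ Real.exp X := by gcongr; nlinarith
  linarith

end Laplace

instance : Countable zetaOrd := by
  have h : (⋃ n : ℕ, zetaOrd ∩ Set.Icc (-(n:ℝ)) n) = zetaOrd := by
    ext x
    simp only [Set.mem_iUnion, Set.mem_inter_iff, Set.mem_Icc]
    constructor
    · rintro ⟨n, h, -⟩; exact h
    · intro h
      obtain ⟨n, hn⟩ := exists_nat_ge |x|
      exact ⟨n, h, abs_le.mp hn⟩
  have : zetaOrd.Countable := by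
    rw [← h]
    exact Set.countable_iUnion fun n => (finite_zetaOrd_inter n).countable
  exact this.to_subtype

/-- Terms of the Dirichlet series of the von Mangoldt function. -/
noncomputable def vmTerm (s : ℂ) (n : ℕ) : ℂ :=
  LSeries.term (fun n => ((ArithmeticFunction.vonMangoldt n : ℝ) : ℂ)) s n

theorem vmTerm_add (s w : ℂ) (n : ℕ) :
    vmTerm (s + w) n = vmTerm s n * cexp (-w * (Real.log n : ℝ)) := by
  unfold vmTerm
  rcases eq_or_ne n 0 with rfl | hn
  · simp
  · have hn' : (n:ℂ) ≠ 0 := by exact_mod_cast hn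
    rw [LSeries.term_of_ne_zero hn, LSeries.term_of_ne_zero hn, cpow_add _ _ hn',
      cpow_def_of_ne_zero hn' w, ← natCast_log, neg_mul, Complex.exp_neg, mul_comm (Complex.ofReal _) w]
    field_simp

theorem summable_vmTerm {s : ℂ} (hs : 1 < s.re) : Summable (vmTerm s) :=
  ArithmeticFunction.LSeriesSummable_vonMangoldt hs

theorem tsum_vmTerm {s : ℂ} (hs : 1 < s.re) :
    ∑' n, vmTerm s n = -(deriv riemannZeta s / riemannZeta s) := by
  rw [← neg_div]
  exact ArithmeticFunction.LSeries_vonMangoldt_eq_deriv_riemannZeta_div hs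

theorem norm_vmTerm_tent_le (s : ℂ) (n : ℕ) (X : ℝ) :
    ‖vmTerm s n * ((max (X - Real.log n) 0 : ℝ) : ℂ)‖ ≤ ‖vmTerm (s + 1) n‖ * Real.exp X := by
  rw [vmTerm_add, norm_mul, norm_mul, norm_real, Real.norm_of_nonneg (le_max_right _ _), norm_exp]
  rw [mul_assoc, ← Real.exp_add]
  gcongr
  have := Real.add_one_le_exp (X - Real.log n)
  refine max_le ?_ (Real.exp_pos _).le
  have e : (-1 * ((Real.log n : ℝ) : ℂ)).re + X = X - Real.log n := by
    rw [neg_one_mul, neg_re, ofReal_re]; ring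
  rw [e]
  linarith

theorem integral_mul_comb {e f1 f2 f3 f4 f5 : ℝ → ℂ} {μ : MeasureTheory.Measure ℝ}
    (i1 : MeasureTheory.Integrable (fun X => e X * f1 X) μ)
    (i2 : MeasureTheory.Integrable (fun X => e X * f2 X) μ)
    (i3 : MeasureTheory.Integrable (fun X => e X * f3 X) μ)
    (i4 : MeasureTheory.Integrable (fun X => e X * f4 X) μ)
    (i5 : MeasureTheory.Integrable (fun X => e X * f5 X) μ) :
    (∫ X, e X * (f1 X + f5 X - f2 X - f3 X + f4 X) ∂μ) =
      (∫ X, e X * f1 X ∂μ) + (∫ X, e X * f5 X ∂μ) - (∫ X, e X * f2 X ∂μ) -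
        (∫ X, e X * f3 X ∂μ) + (∫ X, e X * f4 X ∂μ) := by
  have h15 := MeasureTheory.integral_add i1 i5
  have h152 := MeasureTheory.integral_sub (i1.add i5) i2
  have h1523 := MeasureTheory.integral_sub ((i1.add i5).sub i2) i3
  have h := MeasureTheory.integral_add (((i1.add i5).sub i2).sub i3) i4
  simp only [Pi.add_apply, Pi.sub_apply] at h152 h1523 h
  rw [← h15, ← h152, ← h1523, ← h]
  congr 1
  ext X
  ring

theorem tent_identity (H : SimpleRH) {s : ℂ} (hs : 1 / 2 ≤ s.re) (hs1 : s ≠ 1)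
    (hz : riemannZeta s ≠ 0) {X : ℝ} (hX : 0 ≤ X) :
    ∑' n : ℕ, vmTerm s n * ((max (X - Real.log n) 0 : ℝ) : ℂ) =
      -X * (deriv riemannZeta s / riemannZeta s) +
      (∑' γ : zetaOrd, (1 - cexp (-(s - 1 / 2 - (γ:ℝ) * I) * X)) / (s - 1 / 2 - (γ:ℝ) * I) ^ 2) +
      (∑' j : ℕ, (1 - cexp (-(s + 2 * ((j:ℂ) + 1)) * X)) / (s + 2 * ((j:ℂ) + 1)) ^ 2) -
      (1 - cexp (-(s - 1) * X)) / (s - 1) ^ 2 := by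
  have hs0 : 0 < s.re := by linarith
  obtain ⟨c1, L1⟩ := laplace_tsum (F := fun (n : ℕ) (X : ℝ) =>
      vmTerm s n * ((max (X - Real.log n) 0 : ℝ) : ℂ)) (u := fun n => ‖vmTerm (s + 1) n‖)
    (fun n => by fun_prop) (summable_vmTerm (by simp; linarith)).norm
    (fun n X _ => norm_vmTerm_tent_le s n X)
  obtain ⟨c2, L2⟩ := laplace_tsum (F := fun (γ : zetaOrd) (X : ℝ) =>
      (1 - cexp (-(s - 1 / 2 - (γ:ℝ) * I) * X)) / (s - 1 / 2 - (γ:ℝ) * I) ^ 2)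
    (fun n => by fun_prop) ((summable_zetaOrd_inv_sq H s).mul_left 2)
    (fun γ X hX => norm_one_sub_exp_div_le (by simp; linarith) hX)
  obtain ⟨c3, L3⟩ := laplace_tsum (F := fun (j : ℕ) (X : ℝ) =>
      (1 - cexp (-(s + 2 * ((j:ℂ) + 1)) * X)) / (s + 2 * ((j:ℂ) + 1)) ^ 2)
    (fun n => by fun_prop) ((summable_trivial_inv_sq hs0).mul_left 2)
    (fun j X hX => norm_one_sub_exp_div_le (by
      have : (0:ℝ) ≤ j := Nat.cast_nonneg j
      simp; linarith) hX)
  obtain ⟨c4, L4⟩ := laplace_tsum (F := fun (_ : Unit) (X : ℝ) =>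
      (1 - cexp (-(s - 1) * X)) / (s - 1) ^ 2) (u := fun _ => 2 * (1 / ‖s - 1‖ ^ 2))
    (fun n => by fun_prop) Summable.of_finite
    (fun _ X hX => norm_one_sub_exp_div_le (by simp; linarith) hX)
  obtain ⟨c5, L5⟩ := laplace_tsum (F := fun (_ : Unit) (X : ℝ) =>
      (deriv riemannZeta s / riemannZeta s) * ((max (X - 0) 0 : ℝ) : ℂ))
      (u := fun _ => ‖deriv riemannZeta s / riemannZeta s‖)
    (fun n => by fun_prop) Summable.of_finite
    (fun _ X hX => by
      rw [norm_mul, norm_real, Real.norm_of_nonneg (le_max_right _ _)]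
      gcongr
      have := Real.add_one_le_exp X
      exact max_le (by linarith) (Real.exp_pos X).le)
  simp only [tsum_fintype, Finset.univ_unique, Finset.sum_singleton] at c4 c5 L4 L5
  set G1 : ℝ → ℂ := fun X => ∑' n : ℕ, vmTerm s n * ((max (X - Real.log n) 0 : ℝ) : ℂ) with hG1
  set G2 : ℝ → ℂ := fun X => ∑' γ : zetaOrd,
    (1 - cexp (-(s - 1 / 2 - (γ:ℝ) * I) * X)) / (s - 1 / 2 - (γ:ℝ) * I) ^ 2 with hG2
  set G3 : ℝ → ℂ := fun X => ∑' j : ℕ,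
    (1 - cexp (-(s + 2 * ((j:ℂ) + 1)) * X)) / (s + 2 * ((j:ℂ) + 1)) ^ 2 with hG3
  set G4 : ℝ → ℂ := fun X => (1 - cexp (-(s - 1) * X)) / (s - 1) ^ 2 with hG4
  set G5 : ℝ → ℂ := fun X => (deriv riemannZeta s / riemannZeta s) * ((max (X - 0) 0 : ℝ) : ℂ) with hG5
  have key : (fun X => G1 X + G5 X - G2 X - G3 X + G4 X) X = 0 := by
    refine eq_zero_of_laplace_eq_zero
      ((((c1.add c5).sub c2).sub c3).add c4) ?_ ?_ ?_ hX
    · have : ∀ n : ℕ, max (-Real.log n) 0 = 0 := fun n =>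
        max_eq_right (by have := Real.log_natCast_nonneg n; linarith)
      simp [hG1, hG2, hG3, hG4, hG5, this]
    · intro w hw
      have := ((((L1 w hw).1.add (L5 w hw).1).sub (L2 w hw).1).sub (L3 w hw).1).add (L4 w hw).1
      refine this.congr (MeasureTheory.ae_of_all _ fun x => ?_)
      simp only [Pi.add_apply, Pi.sub_apply]
      ring
    · intro w hw
      have hw0 : w ≠ 0 := fun h => by rw [h] at hw; simp at hw
      obtain ⟨i1, S1⟩ := L1 w hw
      obtain ⟨i2, S2⟩ := L2 w hw
      obtain ⟨i3, S3⟩ := L3 w hw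
      obtain ⟨i4, -⟩ := L4 w hw
      obtain ⟨i5, -⟩ := L5 w hw
      have E : (∫ X in Set.Ioi (0:ℝ), cexp (-w * X) * (G1 X + G5 X - G2 X - G3 X + G4 X)) =
        (∫ X in Set.Ioi (0:ℝ), cexp (-w * X) * G1 X) + (∫ X in Set.Ioi (0:ℝ), cexp (-w * X) * G5 X) -
        (∫ X in Set.Ioi (0:ℝ), cexp (-w * X) * G2 X) - (∫ X in Set.Ioi (0:ℝ), cexp (-w * X) * G3 X) +
        (∫ X in Set.Ioi (0:ℝ), cexp (-w * X) * G4 X) := by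
        exact integral_mul_comb i1 i2 i3 i4 i5
      have e5 : (∫ X in Set.Ioi (0:ℝ), cexp (-w * X) * G5 X) =
          (deriv riemannZeta s / riemannZeta s) * (1 / w ^ 2) := by
        have := laplace_tent hw le_rfl
        simp only [ofReal_zero, mul_zero, Complex.exp_zero] at this
        rw [← this, ← MeasureTheory.integral_const_mul]
        congr 1
        ext X
        simp only [hG5]
        ring
      have e4 : (∫ X in Set.Ioi (0:ℝ), cexp (-w * X) * G4 X) =
          -(1 / w ^ 2) * (1 / (s + w - 1) - 1 / (s - 1)) := by
        rw [laplace_one_sub_exp hw (by simp; linarith) (sub_ne_zero.mpr hs1)]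
        rw [show s - 1 + w = s + w - 1 by ring]
      have hsw : 1 < (s + w).re := by simp; linarith
      have e1 : (∫ X in Set.Ioi (0:ℝ), cexp (-w * X) * G1 X) =
          -(deriv riemannZeta (s + w) / riemannZeta (s + w)) / w ^ 2 := by
        rw [← tsum_vmTerm hsw, ← S1.tsum_eq, ← tsum_div_const]
        refine tsum_congr fun n => ?_
        rw [vmTerm_add, mul_div_assoc, ← laplace_tent hw (Real.log_natCast_nonneg n),
          ← MeasureTheory.integral_const_mul]
        congr 1
        ext X
        ring
      have e2 : (∫ X in Set.Ioi (0:ℝ), cexp (-w * X) * G2 X) = -(1 / w ^ 2) *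
          ∑' γ : zetaOrd, (1 / (s + w - 1 / 2 - (γ:ℝ) * I) - 1 / (s - 1 / 2 - (γ:ℝ) * I)) := by
        rw [← S2.tsum_eq, ← tsum_mul_left]
        refine tsum_congr fun γ => ?_
        rw [laplace_one_sub_exp hw (by simp; linarith) (sub_zetaOrd_ne_zero hz γ)]
        rw [show s - 1 / 2 - (γ:ℝ) * I + w = s + w - 1 / 2 - (γ:ℝ) * I by ring]
      have e3 : (∫ X in Set.Ioi (0:ℝ), cexp (-w * X) * G3 X) = -(1 / w ^ 2) *
          ∑' j : ℕ, (1 / (s + w + 2 * ((j:ℂ) + 1)) - 1 / (s + 2 * ((j:ℂ) + 1))) := by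
        rw [← S3.tsum_eq, ← tsum_mul_left]
        refine tsum_congr fun j => ?_
        have hj : (0:ℝ) ≤ j := Nat.cast_nonneg j
        rw [laplace_one_sub_exp hw (by simp; linarith) (fun h => by
          have := congrArg Complex.re h
          simp at this
          linarith)]
        rw [show s + 2 * ((j:ℂ) + 1) + w = s + w + 2 * ((j:ℂ) + 1) by ring]
      have hP2 := zeta_logDeriv_sub H hs0 hs1 hz (s' := s + w) (by linarith)
        (fun h => by rw [h] at hsw; simp at hsw) (riemannZeta_ne_zero_of_one_le_re hsw.le)
      refine Eq.trans E ?_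
      rw [e1, e2, e3, e4, e5]
      linear_combination -(1 / w ^ 2) * hP2
  have hG5X : G5 X = (deriv riemannZeta s / riemannZeta s) * X := by
    simp [hG5, max_eq_left hX]
  simp only at key
  rw [hG5X] at key
  change G1 X = _ + G2 X + G3 X - G4 X
  linear_combination key

/-- The Fejér-type kernel `(2 sin (v h / 2) / v)²`. -/
noncomputable def fejer (h v : ℝ) : ℝ := (2 * Real.sin (v * h / 2) / v) ^ 2

theorem fejer_nonneg (h v : ℝ) : 0 ≤ fejer h v := sq_nonneg _

theorem fejer_le (h v : ℝ) : fejer h v ≤ 4 * (1 / v ^ 2) := by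
  unfold fejer
  rw [div_pow, mul_pow, mul_one_div]
  have := Real.sin_sq_le_one (v * h / 2)
  gcongr
  linarith

theorem fejer_le_sq (h v : ℝ) : fejer h v ≤ h ^ 2 := by
  unfold fejer
  rcases eq_or_ne v 0 with rfl | hv
  · simp; positivity
  · have h1 := Real.abs_sin_le_abs (x := v * h / 2)
    rw [← sq_abs, ← sq_abs h, abs_div, abs_mul]
    have hv' : 0 < |v| := abs_pos.mpr hv
    have : |2| * |Real.sin (v * h / 2)| / |v| ≤ |h| := by
      rw [div_le_iff₀ hv']
      calc |2| * |Real.sin (v * h / 2)| ≤ |2| * |v * h / 2| := by gcongr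
        _ = |h| * |v| := by rw [abs_div, abs_mul]; norm_num; ring
    gcongr

theorem exp_second_diff (v h : ℝ) :
    cexp (-(v * I * h)) - 2 + cexp (v * I * h) = -4 * (Real.sin (v * h / 2) : ℂ) ^ 2 := by
  have h1 : cexp (v * I * h) = cos ((v * h : ℝ) : ℂ) + sin ((v * h : ℝ) : ℂ) * I := by
    rw [← exp_mul_I]; push_cast; ring_nf
  have h2 : cexp (-(v * I * h)) = cos ((v * h : ℝ) : ℂ) - sin ((v * h : ℝ) : ℂ) * I := by
    rw [show -(v * I * h : ℂ) = (-((v * h : ℝ) : ℂ)) * I by push_cast; ring, exp_mul_I]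
    simp only [cos_neg, sin_neg]; ring
  have h3 : ((v * h : ℝ) : ℂ) = 2 * ((v * h / 2 : ℝ) : ℂ) := by push_cast; ring
  rw [h1, h2, h3, cos_two_mul, ofReal_sin]
  have := sin_sq_add_cos_sq ((v * h / 2 : ℝ) : ℂ)
  linear_combination 4 * this

theorem one_sub_exp_second_diff (a : ℂ) (X h : ℝ) :
    (1 - cexp (-a * ((X + h : ℝ) : ℂ))) / a ^ 2 - 2 * ((1 - cexp (-a * (X : ℂ))) / a ^ 2) +
      (1 - cexp (-a * ((X - h : ℝ) : ℂ))) / a ^ 2 =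
    -(cexp (-a * X) * (cexp (-(a * h)) - 2 + cexp (a * h))) / a ^ 2 := by
  have h1 : cexp (-a * ((X + h : ℝ) : ℂ)) = cexp (-a * X) * cexp (-(a * h)) := by
    rw [← Complex.exp_add]; push_cast; ring_nf
  have h2 : cexp (-a * ((X - h : ℝ) : ℂ)) = cexp (-a * X) * cexp (a * h) := by
    rw [← Complex.exp_add]; push_cast; ring_nf
  rw [h1, h2]
  ring

theorem zero_second_diff {v : ℝ} (hv : v ≠ 0) (X h : ℝ) :
    (1 - cexp (-(v * I) * ((X + h : ℝ) : ℂ))) / (v * I) ^ 2 -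
      2 * ((1 - cexp (-(v * I) * (X : ℂ))) / (v * I) ^ 2) +
      (1 - cexp (-(v * I) * ((X - h : ℝ) : ℂ))) / (v * I) ^ 2 =
    -((fejer h v : ℂ) * cexp (-(v * I) * X)) := by
  rw [one_sub_exp_second_diff, exp_second_diff]
  have hv' : (v:ℂ) ≠ 0 := by exact_mod_cast hv
  unfold fejer
  push_cast
  rw [mul_pow, I_sq]
  field_simp
  ring

theorem norm_second_diff_le {a : ℂ} {X h : ℝ} (h0 : 0 ≤ h) :
    ‖-(cexp (-a * X) * (cexp (-(a * h)) - 2 + cexp (a * h))) / a ^ 2‖ ≤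
      4 * Real.exp (-a.re * X + |a.re| * h) * (1 / ‖a‖ ^ 2) := by
  rw [norm_div, norm_neg, norm_pow, mul_one_div, norm_mul, norm_exp]
  have e1 : (-a * (X:ℂ)).re = -a.re * X := by simp
  rw [e1, Real.exp_add, ← mul_assoc, mul_comm 4, mul_assoc]
  refine div_le_div_of_nonneg_right (mul_le_mul_of_nonneg_left ?_ (Real.exp_pos _).le) (by positivity)
  have b1 : ‖cexp (-(a * h))‖ ≤ Real.exp (|a.re| * h) := by
    rw [norm_exp]
    apply Real.exp_le_exp.mpr
    have : (-(a * (h:ℂ))).re = -a.re * h := by simp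
    rw [this]
    gcongr
    exact neg_le_abs _
  have b2 : ‖cexp (a * h)‖ ≤ Real.exp (|a.re| * h) := by
    rw [norm_exp]
    apply Real.exp_le_exp.mpr
    have : (a * (h:ℂ)).re = a.re * h := by simp
    rw [this]
    gcongr
    exact le_abs_self _
  have b3 : (1:ℝ) ≤ Real.exp (|a.re| * h) := Real.one_le_exp (by positivity)
  calc ‖cexp (-(a * h)) - 2 + cexp (a * h)‖ ≤ ‖cexp (-(a * h)) - 2‖ + ‖cexp (a * h)‖ := norm_add_le _ _
    _ ≤ ‖cexp (-(a * h))‖ + ‖(2:ℂ)‖ + ‖cexp (a * h)‖ := by gcongr; exact norm_sub_le _ _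
    _ ≤ 4 * Real.exp (|a.re| * h) := by rw [RCLike.norm_ofNat]; linarith

/-- The Fejér-weighted sum of cosines over the ordinates. -/
noncomputable def fejerSum (h t X : ℝ) : ℝ := ∑' γ : zetaOrd, fejer h (t - γ) * Real.cos (γ * X)

theorem line_sub (t γ : ℝ) : (1 / 2 + t * I - 1 / 2 - γ * I : ℂ) = ((t - γ : ℝ) : ℂ) * I := by
  push_cast; ring

theorem summable_fejer (H : SimpleRH) (h t : ℝ) :
    Summable (fun γ : zetaOrd => fejer h (t - γ)) := by
  refine Summable.of_nonneg_of_le (fun γ => fejer_nonneg _ _) (fun γ => fejer_le _ _) ?_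
  refine Summable.mul_left 4 ?_
  refine (summable_zetaOrd_inv_sq H (1 / 2 + t * I)).congr fun γ => ?_
  rw [line_sub, norm_mul, norm_I, mul_one, norm_real, Real.norm_eq_abs, sq_abs]

theorem summable_fejer_mul (H : SimpleRH) (h t : ℝ) {f : zetaOrd → ℝ} {M : ℝ}
    (hf : ∀ γ, |f γ| ≤ M) : Summable (fun γ : zetaOrd => fejer h (t - γ) * f γ) := by
  refine Summable.of_norm_bounded ((summable_fejer H h t).mul_right M) fun γ => ?_
  rw [norm_mul, Real.norm_of_nonneg (fejer_nonneg _ _), Real.norm_eq_abs]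
  exact mul_le_mul_of_nonneg_left (hf γ) (fejer_nonneg _ _)

theorem tent_second_diff (X h l : ℝ) (hh : 0 ≤ h) :
    max (X + h - l) 0 - 2 * max (X - l) 0 + max (X - h - l) 0 = max (h - |X - l|) 0 := by
  rcases abs_cases (X - l) with ⟨h1, h2⟩ | ⟨h1, h2⟩ <;> rw [h1] <;>
    simp only [max_def] <;> split_ifs <;> linarith

theorem summable_vmTerm_tent {s : ℂ} (hs : 0 < s.re) (X : ℝ) :
    Summable (fun n => vmTerm s n * ((max (X - Real.log n) 0 : ℝ) : ℂ)) :=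
  Summable.of_norm_bounded ((summable_vmTerm (s := s + 1) (by simp; linarith)).norm.mul_right _)
    (fun n => norm_vmTerm_tent_le s n X)

theorem fejerSum_cexp (H : SimpleRH) {t h X : ℝ} (h0 : 0 ≤ h) (hX : h ≤ X)
    (hz : riemannZeta (1 / 2 + t * I) ≠ 0) :
    ∑' γ : zetaOrd, (fejer h (t - γ) : ℂ) * cexp (-(((t - γ : ℝ) : ℂ) * I) * X) =
      -∑' n : ℕ, vmTerm (1 / 2 + t * I) n * ((max (h - |X - Real.log n|) 0 : ℝ) : ℂ) +
      (∑' j : ℕ, -(cexp (-(1 / 2 + t * I + 2 * ((j:ℂ) + 1)) * X) *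
        (cexp (-((1 / 2 + t * I + 2 * ((j:ℂ) + 1)) * h)) - 2 +
          cexp ((1 / 2 + t * I + 2 * ((j:ℂ) + 1)) * h))) / (1 / 2 + t * I + 2 * ((j:ℂ) + 1)) ^ 2) -
      -(cexp (-(1 / 2 + t * I - 1) * X) *
        (cexp (-((1 / 2 + t * I - 1) * h)) - 2 +
          cexp ((1 / 2 + t * I - 1) * h))) / (1 / 2 + t * I - 1) ^ 2 := by
  set s : ℂ := 1 / 2 + t * I with hs
  have hre : s.re = 1 / 2 := by simp [hs]
  have hs1 : s ≠ 1 := fun h => by rw [h] at hre; norm_num at hre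
  have sumZ : ∀ Y : ℝ, 0 ≤ Y → Summable (fun γ : zetaOrd =>
      (1 - cexp (-(s - 1 / 2 - (γ:ℝ) * I) * Y)) / (s - 1 / 2 - (γ:ℝ) * I) ^ 2) := fun Y hY =>
    Summable.of_norm_bounded (((summable_zetaOrd_inv_sq H s).mul_left 2).mul_right _)
      (fun γ => norm_one_sub_exp_div_le (by simp; linarith) hY)
  have sumR : ∀ Y : ℝ, 0 ≤ Y → Summable (fun j : ℕ =>
      (1 - cexp (-(s + 2 * ((j:ℂ) + 1)) * Y)) / (s + 2 * ((j:ℂ) + 1)) ^ 2) := fun Y hY =>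
    Summable.of_norm_bounded (((summable_trivial_inv_sq (s := s) (by linarith)).mul_left 2).mul_right _)
      (fun j => norm_one_sub_exp_div_le (by
        have : (0:ℝ) ≤ j := Nat.cast_nonneg j
        simp; linarith) hY)
  have I1 := tent_identity H hre.ge hs1 hz (X := X + h) (by linarith)
  have I2 := tent_identity H hre.ge hs1 hz (X := X) (by linarith)
  have I3 := tent_identity H hre.ge hs1 hz (X := X - h) (by linarith)
  have eT : ∑' n : ℕ, vmTerm s n * ((max (h - |X - Real.log n|) 0 : ℝ) : ℂ) =
      (∑' n : ℕ, vmTerm s n * ((max (X + h - Real.log n) 0 : ℝ) : ℂ)) -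
      2 * (∑' n : ℕ, vmTerm s n * ((max (X - Real.log n) 0 : ℝ) : ℂ)) +
      (∑' n : ℕ, vmTerm s n * ((max (X - h - Real.log n) 0 : ℝ) : ℂ)) := by
    have k := fun Y => summable_vmTerm_tent (s := s) (by linarith) Y
    rw [← tsum_mul_left, ← (k _).tsum_sub ((k _).mul_left 2),
      ← ((k _).sub ((k _).mul_left 2)).tsum_add (k _)]
    refine tsum_congr fun n => ?_
    rw [← tent_second_diff X h (Real.log n) h0]
    push_cast
    ring
  have eZ : ∑' γ : zetaOrd, -((fejer h (t - γ) : ℂ) * cexp (-(((t - γ : ℝ) : ℂ) * I) * X)) =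
      (∑' γ : zetaOrd, (1 - cexp (-(s - 1 / 2 - (γ:ℝ) * I) * ((X + h : ℝ):ℂ))) / (s - 1 / 2 - (γ:ℝ) * I) ^ 2) -
      2 * (∑' γ : zetaOrd, (1 - cexp (-(s - 1 / 2 - (γ:ℝ) * I) * X)) / (s - 1 / 2 - (γ:ℝ) * I) ^ 2) +
      (∑' γ : zetaOrd, (1 - cexp (-(s - 1 / 2 - (γ:ℝ) * I) * ((X - h : ℝ):ℂ))) / (s - 1 / 2 - (γ:ℝ) * I) ^ 2) := by
    have k := sumZ
    rw [← tsum_mul_left, ← (k _ (by linarith)).tsum_sub ((k _ (by linarith)).mul_left 2),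
      ← ((k _ (by linarith)).sub ((k _ (by linarith)).mul_left 2)).tsum_add (k _ (by linarith))]
    refine tsum_congr fun γ => ?_
    have hne := sub_zetaOrd_ne_zero hz (γ := γ)
    rw [hs, line_sub] at hne
    rw [hs, line_sub, zero_second_diff (by
      intro h
      apply hne
      rw [h]; simp)]
  have eR : (∑' j : ℕ, -(cexp (-(s + 2 * ((j:ℂ) + 1)) * X) *
        (cexp (-((s + 2 * ((j:ℂ) + 1)) * h)) - 2 +
          cexp ((s + 2 * ((j:ℂ) + 1)) * h))) / (s + 2 * ((j:ℂ) + 1)) ^ 2) =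
      (∑' j : ℕ, (1 - cexp (-(s + 2 * ((j:ℂ) + 1)) * ((X + h : ℝ):ℂ))) / (s + 2 * ((j:ℂ) + 1)) ^ 2) -
      2 * (∑' j : ℕ, (1 - cexp (-(s + 2 * ((j:ℂ) + 1)) * X)) / (s + 2 * ((j:ℂ) + 1)) ^ 2) +
      (∑' j : ℕ, (1 - cexp (-(s + 2 * ((j:ℂ) + 1)) * ((X - h : ℝ):ℂ))) / (s + 2 * ((j:ℂ) + 1)) ^ 2) := by
    have k := sumR
    rw [← tsum_mul_left, ← (k _ (by linarith)).tsum_sub ((k _ (by linarith)).mul_left 2),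
      ← ((k _ (by linarith)).sub ((k _ (by linarith)).mul_left 2)).tsum_add (k _ (by linarith))]
    refine tsum_congr fun j => ?_
    rw [one_sub_exp_second_diff]
  have eP := one_sub_exp_second_diff (s - 1) X h
  rw [tsum_neg] at eZ
  rw [eT, eR, I1, I2, I3, ← eP]
  push_cast at eZ ⊢
  linear_combination -eZ

theorem tsum_trivial_line_le {t : ℝ} (ht : 4 ≤ t) :
    ∑' j : ℕ, 1 / ‖(1 / 2 + t * I + 2 * ((j:ℂ) + 1))‖ ^ 2 ≤ 4 / t := by
  have hfl : 0 < ⌊t⌋₊ := Nat.floor_pos.mpr (by linarith)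
  have hfl1 : (⌊t⌋₊ : ℝ) ≤ t := Nat.floor_le (by linarith)
  have hfl2 : t < ⌊t⌋₊ + 1 := Nat.lt_floor_add_one t
  have hfl3 : (1:ℝ) ≤ ⌊t⌋₊ := by exact_mod_cast hfl
  refine Real.tsum_le_of_sum_range_le (fun j => by positivity) fun n => ?_
  calc ∑ j ∈ Finset.range n, 1 / ‖(1 / 2 + t * I + 2 * ((j:ℂ) + 1))‖ ^ 2
      ≤ ∑ j ∈ Finset.range n, 2 * (1 / (((j + ⌊t⌋₊ : ℕ) : ℝ) + 1) ^ 2) := by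
        refine Finset.sum_le_sum fun j _ => ?_
        have hj : (0:ℝ) ≤ j := Nat.cast_nonneg j
        have e : ‖(1 / 2 + t * I + 2 * ((j:ℂ) + 1))‖ ^ 2 = (2 * j + 5 / 2) ^ 2 + t ^ 2 := by
          rw [Complex.sq_norm, normSq_apply]; simp; ring
        rw [e, mul_one_div, div_le_div_iff₀ (by positivity) (by positivity)]
        push_cast
        nlinarith [sq_nonneg ((j:ℝ) + 1 - ⌊t⌋₊), mul_self_le_mul_self (by linarith) hfl1]
    _ = 2 * ∑ j ∈ Finset.range n, (1 / (((j + ⌊t⌋₊ : ℕ) : ℝ) + 1) ^ 2) := by rw [Finset.mul_sum]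
    _ ≤ 2 * (1 / (⌊t⌋₊ : ℝ)) := by gcongr; exact sum_inv_sq_tail_le hfl n
    _ ≤ 4 / t := by
        rw [mul_one_div, div_le_div_iff₀ (by positivity) (by linarith)]
        linarith

theorem vmTerm_line (t : ℝ) (d : ℕ) (hd : d ≠ 0) :
    cexp ((t * Real.log d : ℝ) * I) * vmTerm (1 / 2 + t * I) d =
      ((ArithmeticFunction.vonMangoldt d / Real.sqrt d : ℝ) : ℂ) := by
  rw [vmTerm_add, mul_left_comm, ← Complex.exp_add]
  have : ((t * Real.log d : ℝ) * I + -(t * I) * (Real.log d : ℝ) : ℂ) = 0 := by push_cast; ring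
  rw [this, Complex.exp_zero, mul_one]
  unfold vmTerm
  rw [LSeries.term_of_ne_zero hd, Real.sqrt_eq_rpow, ofReal_div, ofReal_cpow (Nat.cast_nonneg d)]
  push_cast
  rfl

theorem log_ratio_ge {a b : ℕ} (ha : 0 < a) (hab : a < b) :
    1 / (b:ℝ) ≤ Real.log b - Real.log a := by
  have ha' : (0:ℝ) < a := by exact_mod_cast ha
  have hb' : (0:ℝ) < b := by exact_mod_cast ha.trans hab
  have hab' : (a:ℝ) + 1 ≤ b := by exact_mod_cast hab
  have := Real.add_one_le_exp (-(Real.log b - Real.log a))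
  have e : Real.exp (-(Real.log b - Real.log a)) = a / b := by
    rw [neg_sub, Real.exp_sub, Real.exp_log ha', Real.exp_log hb']
  rw [e] at this
  have h2 : (a:ℝ) / b ≤ 1 - 1 / b := by
    rw [div_le_iff₀ hb']
    field_simp
    linarith
  linarith

theorem log_ratio_ge_of_lt {a b N : ℕ} (ha : 0 < a) (hN : 0 < N) (hab : a < b) (haN : a ≤ N) :
    1 / (2 * (N:ℝ)) ≤ Real.log b - Real.log a := by
  have h1 := log_ratio_ge ha (Nat.lt_succ_self a)
  have hb : Real.log ((a + 1 : ℕ) : ℝ) ≤ Real.log b := by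
    apply Real.log_le_log (by positivity)
    exact_mod_cast hab
  have h2 : 1 / (2 * (N:ℝ)) ≤ 1 / ((a.succ : ℕ) : ℝ) := by
    have : (a:ℝ) ≤ N := by exact_mod_cast haN
    have : (1:ℝ) ≤ N := by exact_mod_cast hN
    push_cast
    apply one_div_le_one_div_of_le <;> first | positivity | linarith
  have h3 : Real.log ((a.succ : ℕ) : ℝ) = Real.log ((a + 1 : ℕ) : ℝ) := rfl
  linarith

theorem fejerSum_eq_re (H : SimpleRH) (h t X : ℝ) :
    fejerSum h t X = (cexp ((t * X : ℝ) * I) *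
      ∑' γ : zetaOrd, (fejer h (t - γ) : ℂ) * cexp (-(((t - γ : ℝ) : ℂ) * I) * X)).re := by
  have hsum : Summable (fun γ : zetaOrd =>
      cexp ((t * X : ℝ) * I) * ((fejer h (t - γ) : ℂ) * cexp (-(((t - γ : ℝ) : ℂ) * I) * X))) := by
    refine Summable.of_norm_bounded (summable_fejer H h t) fun γ => ?_
    rw [norm_mul, norm_mul, norm_exp_ofReal_mul_I, norm_real, Real.norm_of_nonneg (fejer_nonneg _ _)]
    have : -(((t - γ : ℝ) : ℂ) * I) * X = ((-(t - γ) * X : ℝ) : ℂ) * I := by push_cast; ring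
    rw [this, norm_exp_ofReal_mul_I]
    simp
  rw [← tsum_mul_left, re_tsum hsum]
  refine tsum_congr fun γ => ?_
  have : cexp ((t * X : ℝ) * I) * ((fejer h (t - γ) : ℂ) * cexp (-(((t - γ : ℝ) : ℂ) * I) * X)) =
      (fejer h (t - γ) : ℂ) * cexp (((γ * X : ℝ) : ℂ) * I) := by
    rw [mul_left_comm, ← Complex.exp_add]
    congr 2
    push_cast
    ring
  rw [this, re_ofReal_mul, exp_ofReal_mul_I_re]

/-- Main term of the off-diagonal contribution. -/
noncomputable def vmRatio (m n : ℕ) : ℝ :=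
  if m ∣ n then ArithmeticFunction.vonMangoldt (n / m) / Real.sqrt ((n / m : ℕ) : ℝ) else 0

theorem tsum_vmTerm_peak {m n N : ℕ} (hm : 0 < m) (hmn : m < n) (hnN : n ≤ N) {t h : ℝ}
    (h0 : 0 ≤ h) (hN : h ≤ 1 / (2 * (N:ℝ))) :
    cexp ((t * (Real.log n - Real.log m) : ℝ) * I) * ∑' d : ℕ, vmTerm (1 / 2 + t * I) d *
      ((max (h - |Real.log n - Real.log m - Real.log d|) 0 : ℝ) : ℂ) =
      ((h * vmRatio m n : ℝ) : ℂ) := by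
  have hNpos : 0 < N := by omega
  have hm0 : (m:ℝ) ≠ 0 := by positivity
  have hzero : ∀ d : ℕ, m * d ≠ n → vmTerm (1 / 2 + t * I) d *
      ((max (h - |Real.log n - Real.log m - Real.log d|) 0 : ℝ) : ℂ) = 0 := by
    intro d hd
    rcases Nat.eq_zero_or_pos d with rfl | hd0
    · simp [vmTerm]
    have e : Real.log m + Real.log d = Real.log ((m * d : ℕ) : ℝ) := by
      push_cast
      rw [Real.log_mul (by positivity) (by positivity)]
    have hge : 1 / (2 * (N:ℝ)) ≤ |Real.log n - Real.log m - Real.log d| := by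
      rw [sub_sub, e]
      rcases lt_or_gt_of_ne hd with h1 | h1
      · refine (log_ratio_ge_of_lt (Nat.mul_pos hm hd0) hNpos h1 (h1.le.trans hnN)).trans (le_abs_self _)
      · rw [abs_sub_comm]
        exact (log_ratio_ge_of_lt (by omega) hNpos h1 hnN).trans (le_abs_self _)
    rw [max_eq_right (by linarith)]
    simp
  by_cases hdvd : m ∣ n
  · obtain ⟨d, rfl⟩ := hdvd
    have hd0 : d ≠ 0 := by rintro rfl; simp at hmn
    rw [tsum_eq_single d (fun d' hd' => hzero d' (fun h => hd' (Nat.eq_of_mul_eq_mul_left hm h)))]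
    have e : Real.log ((m * d : ℕ) : ℝ) - Real.log m = Real.log d := by
      push_cast
      rw [Real.log_mul (by positivity) (by positivity)]
      ring
    rw [e, sub_self, abs_zero, sub_zero, max_eq_left h0, ← mul_assoc, vmTerm_line t d hd0]
    unfold vmRatio
    rw [if_pos (dvd_mul_right m d), Nat.mul_div_cancel_left d hm]
    push_cast
    ring
  · have : ∀ d : ℕ, vmTerm (1 / 2 + t * I) d *
        ((max (h - |Real.log n - Real.log m - Real.log d|) 0 : ℝ) : ℂ) = 0 :=
      fun d => hzero d (fun h => hdvd ⟨d, h.symm⟩)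
    simp only [this, tsum_zero, mul_zero]
    unfold vmRatio
    rw [if_neg hdvd]
    simp

theorem fejerSum_offdiag (H : SimpleRH) {m n N : ℕ} (hm : 0 < m) (hmn : m < n) (hnN : n ≤ N)
    {t h : ℝ} (ht : 4 ≤ t) (h0 : 0 ≤ h) (hN : h ≤ 1 / (2 * (N:ℝ)))
    (hz : riemannZeta (1 / 2 + t * I) ≠ 0) :
    |fejerSum h t (Real.log n - Real.log m) + h * vmRatio m n| ≤ 18 * N / t := by
  have hN1 : (1:ℝ) ≤ N := by exact_mod_cast (by omega : 1 ≤ N)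
  have hm0 : (0:ℝ) < m := by exact_mod_cast hm
  have hn0 : (0:ℝ) < n := by exact_mod_cast hm.trans hmn
  set X := Real.log n - Real.log m with hXdef
  have hX : 1 / (2 * (N:ℝ)) ≤ X := log_ratio_ge_of_lt hm (by omega) hmn (by omega)
  have hhX : h ≤ X := hN.trans hX
  have hXN : X ≤ Real.log N := by
    have := Real.log_natCast_nonneg m
    have : Real.log n ≤ Real.log N := Real.log_le_log hn0 (by exact_mod_cast hnN)
    linarith
  have hh : h ≤ 1 / 2 := hN.trans (by
    rw [div_le_div_iff₀ (by positivity) (by norm_num)]; linarith)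
  have K := fejerSum_cexp H h0 hhX hz
  have P := tsum_vmTerm_peak hm hmn hnN (t := t) h0 hN
  rw [fejerSum_eq_re H, K]
  set E := cexp ((t * X : ℝ) * I)
  set R : ℂ := ∑' j : ℕ, -(cexp (-(1 / 2 + t * I + 2 * ((j:ℂ) + 1)) * X) *
        (cexp (-((1 / 2 + t * I + 2 * ((j:ℂ) + 1)) * h)) - 2 +
          cexp ((1 / 2 + t * I + 2 * ((j:ℂ) + 1)) * h))) / (1 / 2 + t * I + 2 * ((j:ℂ) + 1)) ^ 2
  set Q : ℂ := -(cexp (-(1 / 2 + t * I - 1) * X) *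
        (cexp (-((1 / 2 + t * I - 1) * h)) - 2 +
          cexp ((1 / 2 + t * I - 1) * h))) / (1 / 2 + t * I - 1) ^ 2
  have hR : ‖R‖ ≤ 16 / t := by
    have hs : Summable (fun j : ℕ => 4 * (1 / ‖(1 / 2 + t * I + 2 * ((j:ℂ) + 1))‖ ^ 2)) :=
      (summable_trivial_inv_sq (by simp)).mul_left 4
    refine (tsum_of_norm_bounded hs.hasSum fun j => ?_).trans ?_
    · refine (norm_second_diff_le h0).trans ?_
      have hj : (0:ℝ) ≤ j := Nat.cast_nonneg j
      have : (1 / 2 + t * I + 2 * ((j:ℂ) + 1)).re = 2 * j + 5 / 2 := by simp; ring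
      rw [this, abs_of_nonneg (by positivity)]
      have : Real.exp (-(2 * j + 5 / 2) * X + (2 * j + 5 / 2) * h) ≤ 1 := by
        apply Real.exp_le_one_iff.mpr
        nlinarith
      gcongr
      linarith
    · rw [tsum_mul_left]
      have := tsum_trivial_line_le ht
      calc _ ≤ 4 * (4 / t) := by gcongr
        _ = 16 / t := by ring
  have hQ : ‖Q‖ ≤ 2 * N / t := by
    refine (norm_second_diff_le h0).trans ?_
    have e1 : (1 / 2 + t * I - 1 : ℂ).re = -(1 / 2) := by simp; norm_num
    have e2 : ‖(1 / 2 + t * I - 1 : ℂ)‖ ^ 2 = 1 / 4 + t ^ 2 := by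
      rw [Complex.sq_norm, normSq_apply]; simp; ring
    rw [e1, e2, abs_neg, abs_of_pos (by norm_num : (0:ℝ) < 1 / 2)]
    have e3 : Real.exp (- -(1 / 2) * X + 1 / 2 * h) ≤ 2 * N := by
      have : - -(1 / 2) * X + 1 / 2 * h ≤ Real.log (2 * N) := by
        rw [Real.log_mul (by norm_num) (by positivity)]
        have := Real.log_two_gt_d9
        have := Real.log_nonneg hN1
        linarith
      calc _ ≤ Real.exp (Real.log (2 * N)) := Real.exp_le_exp.mpr this
        _ = 2 * N := Real.exp_log (by positivity)
    calc _ ≤ 4 * (2 * N) * (1 / t ^ 2) := by gcongr; linarith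
      _ = 2 * N * (4 / t) / t := by field_simp
      _ ≤ 2 * N * 1 / t := by
          gcongr
          rw [div_le_one (by linarith)]; exact ht
      _ = 2 * N / t := by ring
  have hE : ‖E‖ = 1 := norm_exp_ofReal_mul_I _
  have e : (E * (-∑' d : ℕ, vmTerm (1 / 2 + t * I) d *
      ((max (h - |X - Real.log d|) 0 : ℝ) : ℂ) + R - Q)).re + h * vmRatio m n = (E * (R - Q)).re := by
    rw [show E * (-∑' d : ℕ, vmTerm (1 / 2 + t * I) d *
      ((max (h - |X - Real.log d|) 0 : ℝ) : ℂ) + R - Q) = -(E * ∑' d : ℕ, vmTerm (1 / 2 + t * I) d *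
      ((max (h - |X - Real.log d|) 0 : ℝ) : ℂ)) + E * (R - Q) by ring, P, add_re, neg_re, ofReal_re]
    ring
  rw [e]
  calc _ ≤ ‖E * (R - Q)‖ := abs_re_le_norm _
    _ = ‖R - Q‖ := by rw [norm_mul, hE, one_mul]
    _ ≤ ‖R‖ + ‖Q‖ := norm_sub_le _ _
    _ ≤ 16 / t + 2 * N / t := add_le_add hR hQ
    _ ≤ 18 * N / t := by
        rw [← add_div]
        gcongr
        linarith

theorem fejerSum_diag (H : SimpleRH) {t h : ℝ} (ht : 4 ≤ t) (h0 : 0 ≤ h) (h1 : h ≤ 1 / 2)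
    (hz : riemannZeta (1 / 2 + t * I) ≠ 0) :
    |fejerSum h t 0 + 2 * h * (deriv riemannZeta (1 / 2 + t * I) / riemannZeta (1 / 2 + t * I)).re|
      ≤ 18 / t := by
  set s : ℂ := 1 / 2 + t * I with hs
  have hre : s.re = 1 / 2 := by simp [hs]
  have hs1 : s ≠ 1 := fun h => by rw [h] at hre; norm_num at hre
  have K := tent_identity H hre.ge hs1 hz h0
  have hL : ∑' n : ℕ, vmTerm s n * ((max (h - Real.log n) 0 : ℝ) : ℂ) = 0 := by
    have : ∀ n : ℕ, vmTerm s n * ((max (h - Real.log n) 0 : ℝ) : ℂ) = 0 := by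
      intro n
      rcases Nat.lt_or_ge n 2 with hn | hn
      · interval_cases n
        · simp [vmTerm]
        · simp [vmTerm]
      · have : Real.log 2 ≤ Real.log n := Real.log_le_log (by norm_num) (by exact_mod_cast hn)
        have := Real.log_two_gt_d9
        rw [max_eq_right (by linarith)]
        simp
    simp only [this, tsum_zero]
  have hbd : ∀ γ : zetaOrd, ‖(1 - cexp (-(s - 1 / 2 - (γ:ℝ) * I) * h)) / (s - 1 / 2 - (γ:ℝ) * I) ^ 2‖ ≤
      2 * (1 / ‖s - 1 / 2 - (γ:ℝ) * I‖ ^ 2) * Real.exp h :=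
    fun γ => norm_one_sub_exp_div_le (by simp; linarith) h0
  have hZ : (∑' γ : zetaOrd, (1 - cexp (-(s - 1 / 2 - (γ:ℝ) * I) * h)) / (s - 1 / 2 - (γ:ℝ) * I) ^ 2).re =
      -(fejerSum h t 0 / 2) := by
    rw [re_tsum (Summable.of_norm_bounded (((summable_zetaOrd_inv_sq H s).mul_left 2).mul_right _) hbd)]
    unfold fejerSum
    rw [← tsum_div_const, ← tsum_neg]
    refine tsum_congr fun γ => ?_
    have hne := sub_zetaOrd_ne_zero hz (γ := γ)
    rw [hs, line_sub] at hne ⊢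
    have e1 : -(((t - γ : ℝ) : ℂ) * I) * h = ((-((t - γ) * h) : ℝ) : ℂ) * I := by push_cast; ring
    have e2 : (((t - γ : ℝ) : ℂ) * I) ^ 2 = ((-(t - γ) ^ 2 : ℝ) : ℂ) := by
      rw [mul_pow, I_sq]; push_cast; ring
    rw [e1, e2, div_ofReal_re, sub_re, exp_ofReal_mul_I_re, one_re, Real.cos_neg]
    have e3 : Real.cos ((t - γ) * h) = 1 - 2 * Real.sin ((t - γ) * h / 2) ^ 2 := by
      have h2 := Real.cos_two_mul ((t - γ) * h / 2)
      have h3 := Real.sin_sq_add_cos_sq ((t - γ) * h / 2)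
      rw [show 2 * ((t - γ) * h / 2) = (t - γ) * h by ring] at h2
      linarith
    rw [e3]
    unfold fejer
    rw [mul_zero, Real.cos_zero, div_pow, div_neg]
    ring
  set R : ℂ := ∑' j : ℕ, (1 - cexp (-(s + 2 * ((j:ℂ) + 1)) * h)) / (s + 2 * ((j:ℂ) + 1)) ^ 2
  set Q : ℂ := (1 - cexp (-(s - 1) * h)) / (s - 1) ^ 2
  have hR : ‖R‖ ≤ 8 / t := by
    have hsum : Summable (fun j : ℕ => 2 * (1 / ‖(1 / 2 + t * I + 2 * ((j:ℂ) + 1))‖ ^ 2)) :=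
      (summable_trivial_inv_sq (by simp)).mul_left 2
    refine (tsum_of_norm_bounded hsum.hasSum fun j => ?_).trans ?_
    · have hj : (0:ℝ) ≤ j := Nat.cast_nonneg j
      rw [norm_div, norm_pow, mul_one_div]
      gcongr
      refine (norm_sub_le _ _).trans ?_
      rw [norm_one, norm_exp]
      have : Real.exp (-(s + 2 * ((j:ℂ) + 1)) * h).re ≤ 1 := by
        apply Real.exp_le_one_iff.mpr
        have : (-(s + 2 * ((j:ℂ) + 1)) * h).re = -((1 / 2 + 2 * (j + 1)) * h) := by
          simp [hs]; ring
        rw [this]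
        have : 0 ≤ (1 / 2 + 2 * ((j:ℝ) + 1)) * h := by positivity
        linarith
      linarith
    · rw [tsum_mul_left]
      have := tsum_trivial_line_le ht
      calc _ ≤ 2 * (4 / t) := by gcongr
        _ = 8 / t := by ring
  have hQ : ‖Q‖ ≤ 1 / t := by
    have e2 : ‖s - 1‖ ^ 2 = 1 / 4 + t ^ 2 := by
      rw [Complex.sq_norm, normSq_apply]; simp [hs]; ring
    rw [norm_div, norm_pow, e2]
    have : ‖1 - cexp (-(s - 1) * h)‖ ≤ 4 := by
      refine (norm_sub_le _ _).trans ?_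
      rw [norm_one, norm_exp]
      have : (-(s - 1) * h).re = h / 2 := by simp [hs]; ring
      rw [this]
      have := Real.exp_le_exp.mpr (by linarith : h / 2 ≤ 1)
      have := Real.exp_one_lt_d9
      linarith
    calc _ ≤ 4 / t ^ 2 := by gcongr; linarith
      _ = (4 / t) / t := by field_simp
      _ ≤ 1 / t := by
        gcongr
        rw [div_le_one (by linarith)]; exact ht
  have e : fejerSum h t 0 + 2 * h * (deriv riemannZeta s / riemannZeta s).re = 2 * (R - Q).re := by
    have := congrArg Complex.re K
    rw [hL] at this
    simp only [sub_re, add_re, zero_re] at this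
    rw [hZ, ← ofReal_neg, re_ofReal_mul] at this
    rw [sub_re]
    linarith
  rw [e, abs_mul, abs_two]
  have h3 : |(R - Q).re| ≤ 8 / t + 1 / t :=
    (abs_re_le_norm _).trans ((norm_sub_le _ _).trans (add_le_add hR hQ))
  calc _ ≤ 2 * (8 / t + 1 / t) := by gcongr
    _ = 18 / t := by ring

theorem sum_vonMangoldt_div_le {N : ℕ} (hN : 0 < N) :
    ∑ d ∈ Finset.Icc 1 N, ArithmeticFunction.vonMangoldt d / d ≤ Real.log N + (Real.log 4 + 4) := by
  have hN0 : (0:ℝ) < N := by exact_mod_cast hN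
  have hfac : ∑ n ∈ Finset.Icc 1 N, Real.log n =
      ∑ d ∈ Finset.Icc 1 N, ArithmeticFunction.vonMangoldt d * ((N / d : ℕ) : ℝ) := by
    have e : ∀ n ∈ Finset.Icc 1 N, Real.log n =
        ∑ d ∈ Finset.Icc 1 N, if d ∣ n then ArithmeticFunction.vonMangoldt d else 0 := by
      intro n hn
      rw [Finset.mem_Icc] at hn
      rw [← ArithmeticFunction.vonMangoldt_sum, ← Finset.sum_filter]
      refine Finset.sum_congr ?_ fun _ _ => rfl
      ext d
      simp only [Nat.mem_divisors, Finset.mem_filter, Finset.mem_Icc]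
      constructor
      · rintro ⟨h1, h2⟩
        exact ⟨⟨Nat.pos_of_dvd_of_pos h1 (by omega), (Nat.le_of_dvd (by omega) h1).trans hn.2⟩, h1⟩
      · rintro ⟨-, h⟩
        exact ⟨h, by omega⟩
    rw [Finset.sum_congr rfl e, Finset.sum_comm]
    refine Finset.sum_congr rfl fun d _ => ?_
    rw [← Finset.sum_filter, Finset.sum_const, nsmul_eq_mul, mul_comm]
    congr 2
    have := Nat.Ioc_filter_dvd_card_eq_div N d
    rw [← this]
    rfl
  have hle : ∑ n ∈ Finset.Icc 1 N, Real.log n ≤ N * Real.log N := by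
    calc _ ≤ ∑ n ∈ Finset.Icc 1 N, Real.log N := by
          refine Finset.sum_le_sum fun n hn => ?_
          rw [Finset.mem_Icc] at hn
          exact Real.log_le_log (by exact_mod_cast hn.1) (by exact_mod_cast hn.2)
      _ = _ := by simp
  have hpsi : ∑ d ∈ Finset.Icc 1 N, ArithmeticFunction.vonMangoldt d ≤ (Real.log 4 + 4) * N := by
    have := Chebyshev.psi_le_const_mul_self (x := N) hN0.le
    rw [Chebyshev.psi_eq_sum_Icc, Nat.floor_natCast] at this
    refine le_trans (Finset.sum_le_sum_of_subset_of_nonneg ?_ fun _ _ _ =>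
      ArithmeticFunction.vonMangoldt_nonneg) this
    intro x; simp
  have key : ∑ d ∈ Finset.Icc 1 N, ArithmeticFunction.vonMangoldt d * ((N:ℝ) / d) ≤
      ∑ d ∈ Finset.Icc 1 N, (ArithmeticFunction.vonMangoldt d * ((N / d : ℕ) : ℝ) +
        ArithmeticFunction.vonMangoldt d) := by
    refine Finset.sum_le_sum fun d _ => ?_
    rw [← mul_add_one]
    refine mul_le_mul_of_nonneg_left ?_ ArithmeticFunction.vonMangoldt_nonneg
    have := Nat.lt_floor_add_one ((N:ℝ) / d)
    rw [Nat.floor_div_eq_div] at this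
    exact this.le
  rw [Finset.sum_add_distrib, ← hfac] at key
  have e : ∑ d ∈ Finset.Icc 1 N, ArithmeticFunction.vonMangoldt d * ((N:ℝ) / d) =
      N * ∑ d ∈ Finset.Icc 1 N, ArithmeticFunction.vonMangoldt d / d := by
    rw [Finset.mul_sum]
    exact Finset.sum_congr rfl fun d _ => by ring
  rw [e] at key
  have : N * ∑ d ∈ Finset.Icc 1 N, ArithmeticFunction.vonMangoldt d / (d:ℝ) ≤
      N * (Real.log N + (Real.log 4 + 4)) := by linarith
  exact le_of_mul_le_mul_left this hN0

theorem vmRatio_nonneg (m n : ℕ) : 0 ≤ vmRatio m n := by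
  unfold vmRatio
  split_ifs
  · exact div_nonneg ArithmeticFunction.vonMangoldt_nonneg (Real.sqrt_nonneg _)
  · exact le_rfl

theorem two_mul_vmRatio_le (m n : ℕ) (a b : ℝ) :
    2 * (a * b) * vmRatio m n ≤
      (if m ∣ n then ArithmeticFunction.vonMangoldt (n / m) / ((n / m : ℕ) : ℝ) else 0) * a ^ 2 +
      (if m ∣ n then ArithmeticFunction.vonMangoldt (n / m) else 0) * b ^ 2 := by
  unfold vmRatio
  split_ifs
  · set L := ArithmeticFunction.vonMangoldt (n / m) with hL
    have hL0 : 0 ≤ L := ArithmeticFunction.vonMangoldt_nonneg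
    set d := ((n / m : ℕ) : ℝ)
    have hd : 0 ≤ d := Nat.cast_nonneg _
    have h2 : (1 / Real.sqrt d) ^ 2 = 1 / d := by rw [div_pow, Real.sq_sqrt hd, one_pow]
    have e : L / d * a ^ 2 + L * b ^ 2 - 2 * (a * b) * (L / Real.sqrt d) =
        L * (1 / Real.sqrt d * a - b) ^ 2 := by
      rw [sub_sq, mul_pow, h2]; ring
    have : 0 ≤ L * (1 / Real.sqrt d * a - b) ^ 2 := by positivity
    linarith
  · simp

theorem sum_vmRatio_le {N : ℕ} (hN : 0 < N) {S : Finset ℕ} (hS : S ⊆ Finset.Icc 1 N) (b : ℕ → ℝ) :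
    ∑ m ∈ S, ∑ n ∈ S, 2 * (|b m| * |b n|) * vmRatio m n ≤
      (2 * Real.log N + (Real.log 4 + 4)) * ∑ n ∈ S, b n ^ 2 := by
  have hN0 : (0:ℝ) < N := by exact_mod_cast hN
  have h1 : ∀ m ∈ S, ∑ n ∈ S, (if m ∣ n then
      ArithmeticFunction.vonMangoldt (n / m) / ((n / m : ℕ) : ℝ) else 0) ≤
      Real.log N + (Real.log 4 + 4) := by
    intro m hm
    have hm1 := Finset.mem_Icc.mp (hS hm)
    refine le_trans ?_ (sum_vonMangoldt_div_le hN)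
    rw [← Finset.sum_filter]
    have hinj : Set.InjOn (fun n => n / m) (S.filter (fun n => m ∣ n) : Finset ℕ) := by
      intro x hx y hy hxy
      simp only [Finset.mem_coe, Finset.mem_filter] at hx hy hxy
      rw [← Nat.div_mul_cancel hx.2, ← Nat.div_mul_cancel hy.2, hxy]
    rw [← Finset.sum_image (f := fun d : ℕ => ArithmeticFunction.vonMangoldt d / (d:ℝ)) hinj]
    refine Finset.sum_le_sum_of_subset_of_nonneg ?_ fun d _ _ =>
      div_nonneg ArithmeticFunction.vonMangoldt_nonneg (Nat.cast_nonneg _)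
    intro d hd
    simp only [Finset.mem_image, Finset.mem_filter] at hd
    obtain ⟨n, ⟨hn, hmn⟩, rfl⟩ := hd
    have hn1 := Finset.mem_Icc.mp (hS hn)
    rw [Finset.mem_Icc]
    exact ⟨Nat.div_pos (Nat.le_of_dvd (by omega) hmn) (by omega), (Nat.div_le_self _ _).trans hn1.2⟩
  have h2 : ∀ n ∈ S, ∑ m ∈ S, (if m ∣ n then ArithmeticFunction.vonMangoldt (n / m) else 0) ≤
      Real.log N := by
    intro n hn
    have hn1 := Finset.mem_Icc.mp (hS hn)
    refine le_trans ?_ (Real.log_le_log (by exact_mod_cast hn1.1) (by exact_mod_cast hn1.2) :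
      Real.log n ≤ Real.log N)
    rw [← Finset.sum_filter, ← ArithmeticFunction.vonMangoldt_sum,
      ← Nat.sum_div_divisors n (fun d => ArithmeticFunction.vonMangoldt d)]
    refine Finset.sum_le_sum_of_subset_of_nonneg ?_ fun d _ _ => ArithmeticFunction.vonMangoldt_nonneg
    intro m hm
    rw [Finset.mem_filter] at hm
    rw [Nat.mem_divisors]
    exact ⟨hm.2, by omega⟩
  calc _ ≤ ∑ m ∈ S, ∑ n ∈ S, ((if m ∣ n then
        ArithmeticFunction.vonMangoldt (n / m) / ((n / m : ℕ) : ℝ) else 0) * b m ^ 2 +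
        (if m ∣ n then ArithmeticFunction.vonMangoldt (n / m) else 0) * b n ^ 2) := by
        refine Finset.sum_le_sum fun m _ => Finset.sum_le_sum fun n _ => ?_
        have := two_mul_vmRatio_le m n |b m| |b n|
        rwa [sq_abs, sq_abs] at this
    _ = ∑ m ∈ S, (∑ n ∈ S, (if m ∣ n then
        ArithmeticFunction.vonMangoldt (n / m) / ((n / m : ℕ) : ℝ) else 0)) * b m ^ 2 +
        ∑ n ∈ S, (∑ m ∈ S, (if m ∣ n then ArithmeticFunction.vonMangoldt (n / m) else 0)) * b n ^ 2 := by
        simp only [Finset.sum_add_distrib]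
        congr 1
        · simp only [Finset.sum_mul]
        · rw [Finset.sum_comm]
          simp only [Finset.sum_mul]
    _ ≤ ∑ m ∈ S, (Real.log N + (Real.log 4 + 4)) * b m ^ 2 + ∑ n ∈ S, Real.log N * b n ^ 2 := by
        refine add_le_add (Finset.sum_le_sum fun m hm => ?_) (Finset.sum_le_sum fun n hn => ?_)
        · exact mul_le_mul_of_nonneg_right (h1 m hm) (sq_nonneg _)
        · exact mul_le_mul_of_nonneg_right (h2 n hn) (sq_nonneg _)
    _ = _ := by rw [← Finset.mul_sum, ← Finset.mul_sum]; ring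

/-- The value at height `γ` of the Dirichlet polynomial `∑ bₙ n^{-iγ}`. -/
noncomputable def dirVal (S : Finset ℕ) (b : ℕ → ℝ) (γ : ℝ) : ℂ :=
  ∑ n ∈ S, (b n : ℂ) * cexp ((-(γ * Real.log n) : ℝ) * I)

theorem normSq_dirVal (S : Finset ℕ) (b : ℕ → ℝ) (γ : ℝ) :
    ‖dirVal S b γ‖ ^ 2 =
      ∑ m ∈ S, ∑ n ∈ S, b m * b n * Real.cos (γ * (Real.log n - Real.log m)) := by
  have h : ((‖dirVal S b γ‖ ^ 2 : ℝ) : ℂ) = dirVal S b γ * (starRingEnd ℂ) (dirVal S b γ) := by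
    rw [mul_conj, normSq_eq_norm_sq]
  have h2 := congrArg Complex.re h
  rw [ofReal_re] at h2
  rw [h2]
  unfold dirVal
  rw [map_sum, Finset.sum_mul_sum, re_sum]
  refine Finset.sum_congr rfl fun m _ => ?_
  rw [re_sum]
  refine Finset.sum_congr rfl fun n _ => ?_
  rw [map_mul, conj_ofReal, ← exp_conj, map_mul, conj_I, conj_ofReal, mul_mul_mul_comm,
    ← Complex.exp_add, ← ofReal_mul, re_ofReal_mul]
  congr 1
  rw [show ((-(γ * Real.log m) : ℝ) : ℂ) * I + ((-(γ * Real.log n) : ℝ) : ℂ) * -I =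
    ((γ * (Real.log n - Real.log m) : ℝ) : ℂ) * I by push_cast; ring, exp_ofReal_mul_I_re]

theorem sq_sum_abs_le {N : ℕ} {S : Finset ℕ} (hS : S ⊆ Finset.Icc 1 N) (b : ℕ → ℝ) :
    (∑ n ∈ S, |b n|) ^ 2 ≤ N * ∑ n ∈ S, b n ^ 2 := by
  have h := sq_sum_le_card_mul_sum_sq (s := S) (f := fun n => |b n|)
  simp only [sq_abs] at h
  refine h.trans ?_
  have : (S.card : ℝ) ≤ N := by
    have := Finset.card_le_card hS
    rw [Nat.card_Icc] at this
    exact_mod_cast (by omega : S.card ≤ N)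
  exact mul_le_mul_of_nonneg_right this (Finset.sum_nonneg fun _ _ => sq_nonneg _)

theorem norm_dirVal_sq_le {N : ℕ} {S : Finset ℕ} (hS : S ⊆ Finset.Icc 1 N) (b : ℕ → ℝ) (γ : ℝ) :
    ‖dirVal S b γ‖ ^ 2 ≤ N * ∑ n ∈ S, b n ^ 2 := by
  refine le_trans ?_ (sq_sum_abs_le hS b)
  gcongr
  unfold dirVal
  refine (norm_sum_le _ _).trans (Finset.sum_le_sum fun n _ => ?_)
  rw [norm_mul, norm_exp_ofReal_mul_I, mul_one, norm_real, Real.norm_eq_abs]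

theorem fejerSum_neg (h t X : ℝ) : fejerSum h t (-X) = fejerSum h t X := by
  unfold fejerSum
  refine tsum_congr fun γ => ?_
  rw [mul_neg, Real.cos_neg]

theorem fejer_dirVal_eq (H : SimpleRH) (h t : ℝ) (S : Finset ℕ) (b : ℕ → ℝ) :
    ∑' γ : zetaOrd, fejer h (t - γ) * ‖dirVal S b γ‖ ^ 2 =
      ∑ m ∈ S, ∑ n ∈ S, b m * b n * fejerSum h t (Real.log n - Real.log m) := by
  have hs : ∀ m n : ℕ, Summable (fun γ : zetaOrd => b m * b n *
      (fejer h (t - γ) * Real.cos (γ * (Real.log n - Real.log m)))) := fun m n =>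
    (summable_fejer_mul H h t (M := 1) (fun γ => Real.abs_cos_le_one _)).mul_left _
  simp only [normSq_dirVal]
  calc _ = ∑' γ : zetaOrd, ∑ m ∈ S, ∑ n ∈ S, b m * b n *
      (fejer h (t - γ) * Real.cos (γ * (Real.log n - Real.log m))) := by
        refine tsum_congr fun γ => ?_
        rw [Finset.mul_sum]
        refine Finset.sum_congr rfl fun m _ => ?_
        rw [Finset.mul_sum]
        exact Finset.sum_congr rfl fun n _ => by ring
    _ = _ := by
        rw [Summable.tsum_finsetSum fun m _ => summable_sum fun n _ => hs m n]
        refine Finset.sum_congr rfl fun m _ => ?_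
        rw [Summable.tsum_finsetSum fun n _ => hs m n]
        refine Finset.sum_congr rfl fun n _ => ?_
        rw [tsum_mul_left]
        rfl

theorem fejer_dirVal_sub_le (H : SimpleRH) {N : ℕ} (hN0 : 0 < N) {S : Finset ℕ}
    (hS : S ⊆ Finset.Icc 1 N) (b : ℕ → ℝ) {t h : ℝ} (ht : 4 ≤ t) (h0 : 0 ≤ h)
    (hN : h ≤ 1 / (2 * (N:ℝ))) (hz : riemannZeta (1 / 2 + t * I) ≠ 0) :
    |∑' γ : zetaOrd, fejer h (t - γ) * ‖dirVal S b γ‖ ^ 2 - fejerSum h t 0 * ∑ n ∈ S, b n ^ 2| ≤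
      (h * (2 * Real.log N + (Real.log 4 + 4)) + 18 * N ^ 2 / t) * ∑ n ∈ S, b n ^ 2 := by
  have hD : ∀ m ∈ S, ∀ n ∈ S, |if m = n then 0 else fejerSum h t (Real.log n - Real.log m)| ≤
      h * (vmRatio m n + vmRatio n m) + 18 * N / t := by
    intro m hm n hn
    have hm1 := Finset.mem_Icc.mp (hS hm)
    have hn1 := Finset.mem_Icc.mp (hS hn)
    have v1 := mul_nonneg h0 (vmRatio_nonneg m n)
    have v2 := mul_nonneg h0 (vmRatio_nonneg n m)
    have hpos : 0 ≤ 18 * (N:ℝ) / t := by positivity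
    rw [mul_add]
    split_ifs with heq
    · rw [abs_zero]; positivity
    · rcases lt_or_gt_of_ne heq with hlt | hlt
      · have := abs_le.mp (fejerSum_offdiag H (by omega) hlt hn1.2 ht h0 hN hz)
        exact abs_le.mpr ⟨by linarith, by linarith⟩
      · have := abs_le.mp (fejerSum_offdiag H (by omega) hlt hm1.2 ht h0 hN hz)
        rw [← fejerSum_neg, neg_sub] at this
        exact abs_le.mpr ⟨by linarith, by linarith⟩
  have e : ∑' γ : zetaOrd, fejer h (t - γ) * ‖dirVal S b γ‖ ^ 2 - fejerSum h t 0 * ∑ n ∈ S, b n ^ 2 =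
      ∑ m ∈ S, ∑ n ∈ S, b m * b n *
        (if m = n then 0 else fejerSum h t (Real.log n - Real.log m)) := by
    rw [fejer_dirVal_eq H, Finset.mul_sum, ← Finset.sum_sub_distrib]
    refine Finset.sum_congr rfl fun m hm => ?_
    have : fejerSum h t 0 * b m ^ 2 =
        ∑ n ∈ S, if m = n then b m * b n * fejerSum h t (Real.log n - Real.log m) else 0 := by
      rw [Finset.sum_ite_eq, if_pos hm, sub_self]; ring
    rw [this, ← Finset.sum_sub_distrib]
    refine Finset.sum_congr rfl fun n _ => ?_
    split_ifs <;> ring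
  rw [e]
  calc _ ≤ ∑ m ∈ S, ∑ n ∈ S, |b m| * |b n| * (h * (vmRatio m n + vmRatio n m) + 18 * N / t) := by
        refine (Finset.abs_sum_le_sum_abs _ _).trans (Finset.sum_le_sum fun m hm => ?_)
        refine (Finset.abs_sum_le_sum_abs _ _).trans (Finset.sum_le_sum fun n hn => ?_)
        rw [abs_mul, abs_mul]
        exact mul_le_mul_of_nonneg_left (hD m hm n hn) (by positivity)
    _ = h * ∑ m ∈ S, ∑ n ∈ S, 2 * (|b m| * |b n|) * vmRatio m n +
        18 * N / t * (∑ n ∈ S, |b n|) ^ 2 := by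
        have sw : ∑ m ∈ S, ∑ n ∈ S, |b m| * |b n| * (h * vmRatio n m) =
            ∑ m ∈ S, ∑ n ∈ S, |b m| * |b n| * (h * vmRatio m n) := by
          rw [Finset.sum_comm]
          exact Finset.sum_congr rfl fun m _ => Finset.sum_congr rfl fun n _ => by ring
        have sq : 18 * N / t * (∑ n ∈ S, |b n|) ^ 2 =
            ∑ m ∈ S, ∑ n ∈ S, |b m| * |b n| * (18 * N / t) := by
          rw [pow_two, Finset.sum_mul_sum, Finset.mul_sum]
          refine Finset.sum_congr rfl fun m _ => ?_
          rw [Finset.mul_sum]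
          exact Finset.sum_congr rfl fun n _ => by ring
        simp only [mul_add, Finset.sum_add_distrib]
        rw [sw, sq, Finset.mul_sum, ← Finset.sum_add_distrib]
        congr 1
        refine Finset.sum_congr rfl fun m _ => ?_
        rw [Finset.mul_sum, ← Finset.sum_add_distrib]
        exact Finset.sum_congr rfl fun n _ => by ring
    _ ≤ h * ((2 * Real.log N + (Real.log 4 + 4)) * ∑ n ∈ S, b n ^ 2) +
        18 * N / t * (N * ∑ n ∈ S, b n ^ 2) := by
        gcongr
        · exact sum_vmRatio_le hN0 hS b
        · exact sq_sum_abs_le hS b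
    _ = _ := by ring

theorem finite_zetaOrd_Ioc (T : ℝ) : {γ : zetaOrd | T < (γ:ℝ) ∧ (γ:ℝ) ≤ 2 * T}.Finite := by
  have h := (finite_zetaOrd_inter (2 * T)).preimage (f := fun γ : zetaOrd => (γ:ℝ))
    Subtype.val_injective.injOn
  refine h.subset fun γ hγ => ?_
  obtain ⟨h1, h2⟩ := hγ
  exact ⟨γ.2, by constructor <;> linarith⟩

/-- The ordinates in `(T, 2T]`. -/
noncomputable def zetaWindow (T : ℝ) : Finset zetaOrd := (finite_zetaOrd_Ioc T).toFinset

theorem mem_zetaWindow {T : ℝ} {γ : zetaOrd} :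
    γ ∈ zetaWindow T ↔ T < (γ:ℝ) ∧ (γ:ℝ) ≤ 2 * T := by
  unfold zetaWindow
  rw [Set.Finite.mem_toFinset]
  exact Iff.rfl

theorem fejer_far {T v : ℝ} (hT : 0 < T) (hv : T / 4 ≤ |v|) (h : ℝ) :
    fejer h v ≤ 68 * (1 / (T ^ 2 + v ^ 2)) := by
  have hsq : (T / 4) ^ 2 ≤ v ^ 2 := by
    rw [← sq_abs v]; gcongr
  have hpos : 0 < v ^ 2 := lt_of_lt_of_le (by positivity) hsq
  refine (fejer_le _ _).trans ?_
  rw [mul_one_div, mul_one_div, div_le_div_iff₀ hpos (by positivity)]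
  nlinarith

theorem tsum_fejer_le_window (H : SimpleRH) {T t : ℝ} (hT : 0 < T) (ht1 : 5 / 4 * T ≤ t)
    (ht2 : t ≤ 7 / 4 * T) (h : ℝ) {g : zetaOrd → ℝ} {M : ℝ} (hg0 : ∀ γ, 0 ≤ g γ) (hg : ∀ γ, g γ ≤ M)
    (hM : 0 ≤ M) :
    ∑' γ : zetaOrd, fejer h (t - γ) * g γ ≤ (∑ γ ∈ zetaWindow T, fejer h (t - γ) * g γ) +
      68 * M * ∑' γ : zetaOrd, (1 / (T ^ 2 + (t - γ) ^ 2)) := by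
  have hsum := summable_fejer_mul H h t (f := g) (M := M)
    (fun γ => by rw [abs_of_nonneg (hg0 γ)]; exact hg γ)
  have hs2 : Summable (fun γ : zetaOrd => 68 * M * (1 / (T ^ 2 + (t - γ) ^ 2))) :=
    (summable_zetaOrd_shift H _ _).mul_left _
  have hs1 : HasSum (fun γ : zetaOrd => if γ ∈ zetaWindow T then fejer h (t - γ) * g γ else 0)
      (∑ γ ∈ zetaWindow T, fejer h (t - γ) * g γ) := by
    have : HasSum (fun γ : zetaOrd => if γ ∈ zetaWindow T then fejer h (t - γ) * g γ else 0)
        (∑ γ ∈ zetaWindow T, if γ ∈ zetaWindow T then fejer h (t - γ) * g γ else 0) :=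
      hasSum_sum_of_ne_finset_zero (fun γ hγ => if_neg hγ)
    rwa [Finset.sum_congr rfl (fun γ hγ => if_pos hγ)] at this
  rw [← tsum_mul_left, ← hs1.tsum_eq, ← hs1.summable.tsum_add hs2]
  refine hsum.tsum_le_tsum (fun γ => ?_) (hs1.summable.add hs2)
  split_ifs with hγ
  · have : 0 ≤ 68 * M * (1 / (T ^ 2 + (t - γ) ^ 2)) := by positivity
    linarith
  · rw [zero_add]
    have hfar : T / 4 ≤ |t - γ| := by
      rw [mem_zetaWindow, not_and_or, not_lt, not_le] at hγ
      rcases hγ with hγ | hγ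
      · exact le_trans (by linarith) (le_abs_self _)
      · exact le_trans (by linarith) (neg_le_abs _)
    calc _ ≤ 68 * (1 / (T ^ 2 + (t - γ) ^ 2)) * M :=
          mul_le_mul (fejer_far hT hfar h) (hg γ) (hg0 γ) (by positivity)
      _ = _ := by ring

set_option maxHeartbeats 1000000 in
theorem fejer_window_bounds (H : SimpleRH) : ∃ Y₀ : ℝ, 2 ≤ Y₀ ∧ ∀ Y ≥ Y₀, ∀ t : ℝ,
    5 / 4 * Y ^ 8 ≤ t → t ≤ 7 / 4 * Y ^ 8 → riemannZeta (1 / 2 + t * I) ≠ 0 →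
    ∀ N : ℕ, 0 < N → (N:ℝ) ≤ Y → ∀ S : Finset ℕ, S ⊆ Finset.Icc 1 N → ∀ b : ℕ → ℝ,
    1 / (2 * Y ^ 2) * Real.log Y * ∑ n ∈ S, b n ^ 2 ≤
      ∑ γ ∈ zetaWindow (Y ^ 8), fejer (1 / Y ^ 2) (t - γ) * ‖dirVal S b γ‖ ^ 2 ∧
    ∑ γ ∈ zetaWindow (Y ^ 8), fejer (1 / Y ^ 2) (t - γ) * ‖dirVal S b γ‖ ^ 2 ≤
      11 / Y ^ 2 * Real.log Y * ∑ n ∈ S, b n ^ 2 := by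
  obtain ⟨C1, hC1, lowA⟩ := neg_re_logDeriv_ge H
  obtain ⟨C2, hC2, upA⟩ := zeroSum_sub_le H
  obtain ⟨C3, hC3, tailB⟩ := tsum_zetaOrd_shift_le H
  set c4 : ℝ := Real.log 4 + 4 with hc4
  have hc4pos : 0 < c4 := by have := Real.log_pos (by norm_num : (1:ℝ) < 4); linarith
  obtain ⟨Y1, hY1⟩ := eventually_atTop.mp
    (Real.tendsto_log_atTop.eventually_ge_atTop (2 * C1 + 2 * C2 + c4 + 36))
  refine ⟨max Y1 (max 5 (1088 * C3)), by
    exact le_trans (by norm_num) ((le_max_left 5 _).trans (le_max_right _ _)), ?_⟩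
  intro Y hY t ht1 ht2 hz N hN0 hNY S hS b
  have hYlog := hY1 Y ((le_max_left _ _).trans hY)
  have hY5 : 5 ≤ Y := ((le_max_left 5 _).trans (le_max_right _ _)).trans hY
  have hYC3 : 1088 * C3 ≤ Y := ((le_max_right 5 _).trans (le_max_right _ _)).trans hY
  have hYpos : 0 < Y := by linarith
  set l := Real.log Y with hl
  have hl0 : 0 < l := Real.log_pos (by linarith)
  have hT : 4 ≤ Y ^ 8 := by
    calc (4:ℝ) ≤ 5 ^ 8 := by norm_num
      _ ≤ Y ^ 8 := by gcongr
  have hlT : Real.log (Y ^ 8) = 8 * l := by rw [Real.log_pow]; norm_num [hl]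
  have ht4 : 4 ≤ t := by linarith
  set B := ∑ n ∈ S, b n ^ 2 with hB
  have hB0 : 0 ≤ B := Finset.sum_nonneg fun _ _ => sq_nonneg _
  set h : ℝ := 1 / Y ^ 2 with hh
  have h0 : 0 < h := by positivity
  have hhalf : h ≤ 1 / 2 := by
    rw [hh, div_le_div_iff₀ (by positivity) (by norm_num)]; nlinarith
  have hN1 : (1:ℝ) ≤ N := by exact_mod_cast hN0
  have hhN : h ≤ 1 / (2 * (N:ℝ)) := by
    apply one_div_le_one_div_of_le (by positivity)
    nlinarith
  have hlogN : Real.log N ≤ l := Real.log_le_log (by positivity) hNY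
  have hY6 : 18 * Y ^ 2 / t ≤ 18 * h := by
    rw [hh, mul_one_div, div_le_div_iff₀ (by linarith) (by positivity)]
    have : Y ^ 4 ≤ Y ^ 8 := pow_le_pow_right₀ (by linarith) (by norm_num)
    nlinarith
  have h18 : 18 / t ≤ 18 * h := by
    refine le_trans ?_ hY6
    gcongr
    nlinarith
  have hN18 : 18 * (N:ℝ) ^ 2 / t ≤ 18 * h := by
    refine le_trans ?_ hY6
    gcongr
  have M := abs_le.mp (fejer_dirVal_sub_le H hN0 hS b ht4 h0.le hhN hz)
  have D := abs_le.mp (fejerSum_diag H ht4 h0.le hhalf hz)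
  have lo := lowA t ht4 hz
  have hlogt : 8 * l ≤ Real.log t := by
    rw [← hlT]; exact Real.log_le_log (by positivity) (by linarith)
  have up := upA (Y ^ 8) (by linarith) (1 / 2 + t * I) (by simp) (by simp; linarith)
    (by simp; rw [abs_of_nonneg (by linarith)]; linarith)
    (by simp; rw [abs_of_nonneg (by linarith)]; linarith) hz
  have hzs : zeroSum (1 / 2 + t * I) = 0 := by
    unfold zeroSum
    simp
  rw [hzs, hlT] at up
  set A := (deriv riemannZeta (1 / 2 + t * I) / riemannZeta (1 / 2 + t * I)).re
  have hDlo : h * (4 * l - 2 * C1 - 18) ≤ fejerSum h t 0 := by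
    have : h * (8 * l / 4 - C1) ≤ h * (-A) := by gcongr; linarith
    linarith [D.1]
  have hDup : fejerSum h t 0 ≤ h * (8 * l + 2 * C2 + 18) := by
    have : h * (-A) ≤ h * (4 * l + C2) := by gcongr; linarith
    linarith [D.2]
  have hE : (h * (2 * Real.log N + c4) + 18 * (N:ℝ) ^ 2 / t) * B ≤ h * (2 * l + c4 + 18) * B := by
    apply mul_le_mul_of_nonneg_right _ hB0
    have : h * (2 * Real.log N + c4) ≤ h * (2 * l + c4) := by gcongr
    linarith
  have hlo : h * l * B ≤ ∑' γ : zetaOrd, fejer h (t - γ) * ‖dirVal S b γ‖ ^ 2 := by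
    have h1 : h * (4 * l - 2 * C1 - 18) * B ≤ fejerSum h t 0 * B := by gcongr
    have h2 : h * l * B ≤ h * (4 * l - 2 * C1 - 18 - (2 * l + c4 + 18)) * B := by
      gcongr; linarith
    linarith [M.1]
  have hup : ∑' γ : zetaOrd, fejer h (t - γ) * ‖dirVal S b γ‖ ^ 2 ≤ h * (11 * l) * B := by
    have h1 : fejerSum h t 0 * B ≤ h * (8 * l + 2 * C2 + 18) * B := by gcongr
    have h2 : h * (8 * l + 2 * C2 + 18 + (2 * l + c4 + 18)) * B ≤ h * (11 * l) * B := by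
      gcongr; linarith
    linarith [M.2]
  have hsum : Summable (fun γ : zetaOrd => fejer h (t - γ) * ‖dirVal S b γ‖ ^ 2) :=
    summable_fejer_mul H h t (M := N * B) (fun γ => by
      rw [abs_of_nonneg (by positivity)]; exact norm_dirVal_sq_le hS b γ)
  have hnn : ∀ γ : zetaOrd, 0 ≤ fejer h (t - γ) * ‖dirVal S b γ‖ ^ 2 := fun γ =>
    mul_nonneg (fejer_nonneg _ _) (sq_nonneg _)
  constructor
  · have hle := tsum_fejer_le_window H (T := Y ^ 8) (by positivity) ht1 ht2 h
      (g := fun γ => ‖dirVal S b γ‖ ^ 2) (M := N * B) (fun γ => sq_nonneg _)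
      (fun γ => norm_dirVal_sq_le hS b γ) (by positivity)
    have htail : 68 * (N * B) * ∑' γ : zetaOrd, (1 / ((Y ^ 8) ^ 2 + (t - γ) ^ 2)) ≤
        h * l * B / 2 := by
      have h3 := tailB (Y ^ 8) (by linarith) t (by linarith) (by linarith)
      rw [hlT] at h3
      calc _ ≤ 68 * (N * B) * (C3 * (8 * l) / Y ^ 8) := by gcongr
        _ ≤ 68 * (Y * B) * (C3 * (8 * l) / Y ^ 8) := by gcongr
        _ = (1088 * C3) * Y * (l * B / 2) / Y ^ 8 := by ring
        _ ≤ Y * Y * (l * B / 2) / Y ^ 8 := by gcongr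
        _ ≤ (1 / Y ^ 2) * l * B / 2 := by
          have : Y * Y * (l * B / 2) / Y ^ 8 = (1 / Y ^ 4) * (1 / Y ^ 2) * (l * B / 2) := by
            field_simp
          rw [this]
          have : 1 / Y ^ 4 ≤ 1 := by
            rw [div_le_one (by positivity)]
            exact one_le_pow₀ (by linarith)
          calc _ ≤ 1 * (1 / Y ^ 2) * (l * B / 2) := by gcongr
            _ = _ := by ring
    have e : 1 / (2 * Y ^ 2) * l * B = h * l * B / 2 := by rw [hh]; field_simp
    rw [e]
    linarith
  · have := hsum.sum_le_tsum (zetaWindow (Y ^ 8)) (fun γ _ => hnn γ)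
    have e : 11 / Y ^ 2 * l * B = h * (11 * l) * B := by rw [hh]; ring
    rw [e]
    linarith

theorem sub_ge_of_deriv_ge_tsum {ι : Type*} {Φ Φ' : ℝ → ℝ} {g ψ ψ' : ι → ℝ → ℝ} {u v : ι → ℝ}
    {a b r : ℝ} (hab : a ≤ b) (hΦ : ∀ σ ∈ Set.Icc a b, HasDerivAt Φ (Φ' σ) σ)
    (hψ : ∀ i, ∀ σ ∈ Set.Icc a b, HasDerivAt (ψ i) (ψ' i σ) σ)
    (hg : ∀ i, ∀ σ ∈ Set.Icc a b, ψ' i σ ≤ g i σ)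
    (hgu : ∀ i, ∀ σ ∈ Set.Icc a b, |g i σ| ≤ u i) (hu : Summable u)
    (hv : ∀ i, -v i ≤ ψ i b - ψ i a) (hv0 : ∀ i, 0 ≤ v i) (hvs : Summable v)
    (h : ∀ σ ∈ Set.Icc a b, ∑' i, g i σ - r ≤ Φ' σ) :
    -∑' i, v i - r * (b - a) ≤ Φ b - Φ a := by
  have key : ∀ ε > 0, -∑' i, v i - r * (b - a) - ε * (b - a) ≤ Φ b - Φ a := by
    intro ε hε
    obtain ⟨F, hF⟩ := (hu.hasSum.eventually (lt_mem_nhds (show ∑' i, u i - ε < ∑' i, u i by linarith))).exists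
    have hmono : MonotoneOn (fun σ => Φ σ - ∑ i ∈ F, ψ i σ + (r + ε) * σ) (Set.Icc a b) := by
      have hd : ∀ σ ∈ Set.Icc a b, HasDerivAt (fun σ => Φ σ - ∑ i ∈ F, ψ i σ + (r + ε) * σ)
          (Φ' σ - ∑ i ∈ F, ψ' i σ + (r + ε) * 1) σ := fun σ hσ =>
        ((hΦ σ hσ).sub (HasDerivAt.fun_sum fun i _ => hψ i σ hσ)).add ((hasDerivAt_id σ).const_mul _)
      refine monotoneOn_of_deriv_nonneg (convex_Icc a b)
        (fun σ hσ => (hd σ hσ).continuousAt.continuousWithinAt)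
        (fun σ hσ => (hd σ (interior_subset hσ)).differentiableAt.differentiableWithinAt) ?_
      intro σ hσ'
      have hσ := interior_subset hσ'
      rw [(hd σ hσ).deriv]
      have hgs : Summable (fun i => g i σ) := Summable.of_norm_bounded hu fun i => hgu i σ hσ
      have h1 : ∑ i ∈ F, (g i σ + u i) ≤ ∑' i, (g i σ + u i) :=
        (hgs.add hu).sum_le_tsum F fun i _ => by have := (abs_le.mp (hgu i σ hσ)).1; linarith
      rw [hgs.tsum_add hu, Finset.sum_add_distrib] at h1
      have h2 : ∑ i ∈ F, ψ' i σ ≤ ∑ i ∈ F, g i σ := Finset.sum_le_sum fun i _ => hg i σ hσ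
      have := h σ hσ
      linarith
    have := hmono (Set.left_mem_Icc.mpr hab) (Set.right_mem_Icc.mpr hab) hab
    simp only at this
    have h3 : -∑' i, v i ≤ ∑ i ∈ F, ψ i b - ∑ i ∈ F, ψ i a := by
      rw [← Finset.sum_sub_distrib]
      have h4 : ∑ i ∈ F, v i ≤ ∑' i, v i := hvs.sum_le_tsum F fun i _ => hv0 i
      have h5 : ∑ i ∈ F, -v i ≤ ∑ i ∈ F, (ψ i b - ψ i a) := Finset.sum_le_sum fun i _ => hv i
      rw [Finset.sum_neg_distrib] at h5
      linarith
    linarith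
  rcases hab.eq_or_lt with rfl | hlt
  · have := key 1 one_pos
    simpa using this
  · refine le_of_forall_pos_le_add fun ε hε => ?_
    have := key (ε / (b - a)) (div_pos hε (by linarith))
    rw [div_mul_cancel₀ _ (by linarith : b - a ≠ 0)] at this
    linarith

theorem hasDerivAt_log_norm_zeta {σ t : ℝ} (h1 : (σ + t * I : ℂ) ≠ 1)
    (hz : riemannZeta (σ + t * I) ≠ 0) :
    HasDerivAt (fun σ : ℝ => Real.log ‖riemannZeta (σ + t * I)‖)
      (deriv riemannZeta (σ + t * I) / riemannZeta (σ + t * I)).re σ := by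
  have hd : HasDerivAt (fun w : ℂ => riemannZeta (w + t * I)) (deriv riemannZeta (σ + t * I)) (σ : ℂ) :=
    (differentiableAt_riemannZeta h1).hasDerivAt.comp_add_const (σ : ℂ) (t * I)
  have hr : HasDerivAt (fun σ : ℝ => riemannZeta (σ + t * I)) (deriv riemannZeta (σ + t * I)) σ :=
    hd.comp_ofReal
  have hre : HasDerivAt (fun σ : ℝ => (riemannZeta (σ + t * I)).re)
      (deriv riemannZeta (σ + t * I)).re σ := by
    have := (Complex.reCLM.hasFDerivAt).comp_hasDerivAt σ hr
    exact this
  have him : HasDerivAt (fun σ : ℝ => (riemannZeta (σ + t * I)).im)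
      (deriv riemannZeta (σ + t * I)).im σ := by
    have := (Complex.imCLM.hasFDerivAt).comp_hasDerivAt σ hr
    exact this
  have hsq := (hre.fun_pow 2).add (him.fun_pow 2)
  have e : (fun σ : ℝ => Real.log ‖riemannZeta (σ + t * I)‖) = fun σ : ℝ =>
      1 / 2 * Real.log ((riemannZeta (σ + t * I)).re ^ 2 + (riemannZeta (σ + t * I)).im ^ 2) := by
    ext σ
    have : (riemannZeta (σ + t * I)).re ^ 2 + (riemannZeta (σ + t * I)).im ^ 2 =
        ‖riemannZeta (σ + t * I)‖ ^ 2 := by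
      rw [Complex.sq_norm, normSq_apply]; ring
    rw [this, Real.log_pow]
    push_cast
    ring
  have hne : (riemannZeta (σ + t * I)).re ^ 2 + (riemannZeta (σ + t * I)).im ^ 2 ≠ 0 := by
    have : (riemannZeta (σ + t * I)).re ^ 2 + (riemannZeta (σ + t * I)).im ^ 2 =
        normSq (riemannZeta (σ + t * I)) := by
      rw [normSq_apply]; ring
    rw [this]
    exact (normSq_pos.mpr hz).ne'
  rw [e]
  have := (hsq.log hne).const_mul (1 / 2)
  refine this.congr_deriv ?_
  rw [div_re, normSq_apply]
  simp only [Pi.add_apply]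
  have h2 : (riemannZeta (σ + t * I)).re * (riemannZeta (σ + t * I)).re +
    (riemannZeta (σ + t * I)).im * (riemannZeta (σ + t * I)).im =
    (riemannZeta (σ + t * I)).re ^ 2 + (riemannZeta (σ + t * I)).im ^ 2 := by ring
  rw [h2]
  push_cast
  field_simp

theorem zeroSum_ge (H : SimpleRH) {γ : ℝ} (hγ : γ ∈ zetaOrd) {ε : ℝ} (hε : 0 < ε) :
    1 / ε ≤ zeroSum ((1 / 2 + ε : ℝ) + γ * I) := by
  have hre : (((1 / 2 + ε : ℝ) : ℂ) + γ * I).re = 1 / 2 + ε := by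
    rw [add_re, ofReal_re, re_ofReal_mul, I_re]; ring
  have him : (((1 / 2 + ε : ℝ) : ℂ) + γ * I).im = γ := by
    rw [add_im, ofReal_im, im_ofReal_mul, I_im]; ring
  have hs := summable_zeroSum H (((1 / 2 + ε : ℝ) : ℂ) + γ * I)
  unfold zeroSum
  have h1 := hs.le_tsum (⟨γ, hγ⟩ : zetaOrd) (fun j _ => by
    rw [hre]; have : 0 ≤ 1 / 2 + ε - 1 / 2 := by linarith
    positivity)
  refine le_trans (le_of_eq ?_) h1
  rw [hre, him]
  field_simp
  ring

theorem norm_deriv_zeta_le (H : SimpleRH) : ∃ C > 0, ∀ T ≥ (2:ℝ), ∀ γ ∈ zetaOrd, T < γ → γ ≤ 2 * T →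
    ∀ δ : ℝ, 0 < δ → δ ≤ 1 →
    ‖deriv riemannZeta (1 / 2 + γ * I)‖ ≤ ‖riemannZeta ((1 / 2 + δ : ℝ) + γ * I)‖ / δ *
      Real.exp ((1 / 2 * Real.log T + C) * δ) := by
  obtain ⟨C, hC, hF⟩ := zeroSum_sub_le H
  refine ⟨C, hC, fun T hT γ hγ h1 h2 δ hδ hδ1 => ?_⟩
  set K := 1 / 2 * Real.log T + C with hK
  have hre : ∀ ε : ℝ, (((1 / 2 + ε : ℝ) : ℂ) + γ * I).re = 1 / 2 + ε := fun ε => by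
    rw [add_re, ofReal_re, re_ofReal_mul, I_re]; ring
  have him : ∀ ε : ℝ, (((1 / 2 + ε : ℝ) : ℂ) + γ * I).im = γ := fun ε => by
    rw [add_im, ofReal_im, im_ofReal_mul, I_im]; ring
  have hne1 : ∀ ε : ℝ, (((1 / 2 + ε : ℝ) : ℂ) + γ * I) ≠ 1 := fun ε h => by
    have := congrArg Complex.im h
    rw [him, one_im] at this
    linarith
  have hz : ∀ ε : ℝ, 0 < ε → riemannZeta ((1 / 2 + ε : ℝ) + γ * I) ≠ 0 := fun ε hε =>
    zeta_ne_zero_of_half_lt H (by rw [hre]; linarith)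
  have hd : ∀ ε ∈ Set.Ioc (0:ℝ) 1, HasDerivAt (fun ε : ℝ =>
      Real.log ‖riemannZeta ((1 / 2 + ε : ℝ) + γ * I)‖ - Real.log ε + K * ε)
      ((deriv riemannZeta ((1 / 2 + ε : ℝ) + γ * I) / riemannZeta ((1 / 2 + ε : ℝ) + γ * I)).re
        - ε⁻¹ + K * 1) ε := by
    intro ε hε
    have := (hasDerivAt_log_norm_zeta (hne1 ε) (hz ε hε.1)).comp_const_add (1 / 2) ε
    exact (this.sub (Real.hasDerivAt_log hε.1.ne')).add ((hasDerivAt_id ε).const_mul K)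
  have hmono : MonotoneOn (fun ε : ℝ =>
      Real.log ‖riemannZeta ((1 / 2 + ε : ℝ) + γ * I)‖ - Real.log ε + K * ε) (Set.Ioc 0 1) := by
    refine monotoneOn_of_deriv_nonneg (convex_Ioc 0 1)
      (fun σ hσ => (hd σ hσ).continuousAt.continuousWithinAt)
      (fun σ hσ => (hd σ (interior_subset hσ)).differentiableAt.differentiableWithinAt) ?_
    intro ε hε'
    have hε := interior_subset hε'
    rw [(hd ε hε).deriv]
    have a1 := zeroSum_ge H hγ hε.1
    have a2 := hF T hT ((1 / 2 + ε : ℝ) + γ * I) (by rw [hre]; linarith [hε.1])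
      (by rw [hre]; linarith [hε.2]) (by rw [him, abs_of_nonneg] <;> linarith)
      (by rw [him, abs_of_nonneg] <;> linarith) (hz ε hε.1)
    rw [one_div] at a1
    linarith
  set M := ‖riemannZeta ((1 / 2 + δ : ℝ) + γ * I)‖ / δ * Real.exp (K * δ) with hM
  have hbound : ∀ ε ∈ Set.Ioc (0:ℝ) δ, ‖riemannZeta ((1 / 2 + ε : ℝ) + γ * I)‖ / ε * Real.exp (K * ε) ≤ M := by
    intro ε hε
    have := hmono ⟨hε.1, hε.2.trans hδ1⟩ ⟨hδ, hδ1⟩ hε.2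
    simp only at this
    have ex : ∀ ε : ℝ, 0 < ε → ‖riemannZeta ((1 / 2 + ε : ℝ) + γ * I)‖ / ε * Real.exp (K * ε) =
        Real.exp (Real.log ‖riemannZeta ((1 / 2 + ε : ℝ) + γ * I)‖ - Real.log ε + K * ε) := by
      intro ε hε
      rw [Real.exp_add, Real.exp_sub, Real.exp_log hε, Real.exp_log (norm_pos_iff.mpr (hz ε hε))]
    rw [hM, ex ε hε.1, ex δ hδ]
    exact Real.exp_le_exp.mpr this
  have hz0 : riemannZeta (1 / 2 + γ * I) = 0 := hγ
  have h12 : ((1 / 2 : ℝ) : ℂ) = 1 / 2 := by push_cast; rfl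
  have hda : HasDerivAt (fun ε : ℝ => riemannZeta ((1 / 2 + ε : ℝ) + γ * I))
      (deriv riemannZeta (1 / 2 + γ * I)) 0 := by
    have h0 := hne1 0
    have hdz := (differentiableAt_riemannZeta h0).hasDerivAt
    have hdz2 : HasDerivAt (fun w : ℂ => riemannZeta (w + γ * I))
      (deriv riemannZeta ((1 / 2 + 0 : ℝ) + γ * I)) (((1 / 2 + 0 : ℝ) : ℝ) : ℂ) :=
      hdz.comp_add_const _ (γ * I)
    have h3 := (HasDerivAt.comp_ofReal hdz2).comp_const_add (1 / 2) 0
    rw [add_zero, h12] at h3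
    exact h3
  have hlim : Tendsto (fun ε : ℝ => ‖riemannZeta ((1 / 2 + ε : ℝ) + γ * I)‖ / ε * Real.exp (K * ε))
      (nhdsWithin 0 (Set.Ioi 0)) (nhds ‖deriv riemannZeta (1 / 2 + γ * I)‖) := by
    have s1 := (hasDerivAt_iff_tendsto_slope_zero.mp hda).norm
    have s2 := s1.mono_left (nhdsWithin_mono 0 (fun x (hx : x ∈ Set.Ioi (0:ℝ)) => (ne_of_gt hx : x ≠ 0)))
    have s3 : Tendsto (fun ε : ℝ => Real.exp (K * ε)) (nhdsWithin 0 (Set.Ioi 0)) (nhds 1) := by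
      have : Tendsto (fun ε : ℝ => Real.exp (K * ε)) (nhds 0) (nhds (Real.exp (K * 0))) :=
        (by fun_prop : Continuous fun ε : ℝ => Real.exp (K * ε)).tendsto 0
      rw [mul_zero, Real.exp_zero] at this
      exact this.mono_left nhdsWithin_le_nhds
    have s4 := s2.mul s3
    rw [mul_one] at s4
    refine s4.congr' ?_
    filter_upwards [self_mem_nhdsWithin] with ε (hε : 0 < ε)
    simp only [zero_add, add_zero, h12, hz0, sub_zero, norm_smul, norm_inv, Real.norm_eq_abs, abs_of_pos hε]
    congr 1
    exact (div_eq_inv_mul _ _).symm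
  refine le_of_tendsto hlim ?_
  filter_upwards [Ioc_mem_nhdsGT hδ] with ε hε using hbound ε hε

/-- The Dirichlet polynomial `∑_{n ≤ M} Λ(n)/log n (1 - log n/log M) n^{-σ} cos(t log n)`. -/
noncomputable def tentPoly (M : ℕ) (σ t : ℝ) : ℝ :=
  ∑ n ∈ Finset.Icc 1 M, ArithmeticFunction.vonMangoldt n / Real.log n *
    (1 - Real.log n / Real.log M) * (Real.exp (-(σ * Real.log n)) * Real.cos (t * Real.log n))

theorem vmTerm_re (σ t : ℝ) {n : ℕ} (hn : n ≠ 0) :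
    (vmTerm (σ + t * I) n).re =
      ArithmeticFunction.vonMangoldt n * (Real.exp (-(σ * Real.log n)) * Real.cos (t * Real.log n)) := by
  have h0 : vmTerm (0 + (σ + t * I)) n = _ := vmTerm_add 0 (σ + t * I) n
  have e0 : vmTerm 0 n = ((ArithmeticFunction.vonMangoldt n : ℝ) : ℂ) := by
    unfold vmTerm
    rw [LSeries.term_of_ne_zero hn, cpow_zero, div_one]
  rw [zero_add, e0] at h0
  rw [h0, re_ofReal_mul, exp_re]
  have e1 : (-(σ + t * I) * (Real.log n : ℝ) : ℂ).re = -(σ * Real.log n) := by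
    rw [re_mul_ofReal]; simp
  have e2 : (-(σ + t * I) * (Real.log n : ℝ) : ℂ).im = -(t * Real.log n) := by
    rw [im_mul_ofReal]; simp
  rw [e1, e2, Real.cos_neg]

theorem re_tsum_vmTerm_tent {M : ℕ} (hM : 0 < M) (σ t : ℝ) :
    (∑' n : ℕ, vmTerm (σ + t * I) n * ((max (Real.log M - Real.log n) 0 : ℝ) : ℂ)).re =
      ∑ n ∈ Finset.Icc 1 M, ArithmeticFunction.vonMangoldt n * (Real.log M - Real.log n) *
        (Real.exp (-(σ * Real.log n)) * Real.cos (t * Real.log n)) := by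
  have hz : ∀ n ∉ Finset.Icc 1 M, vmTerm (σ + t * I) n * ((max (Real.log M - Real.log n) 0 : ℝ) : ℂ) = 0 := by
    intro n hn
    rw [Finset.mem_Icc, not_and_or] at hn
    rcases hn with hn | hn
    · have : n = 0 := by omega
      subst this
      unfold vmTerm
      simp
    · have : Real.log M ≤ Real.log n :=
        Real.log_le_log (by exact_mod_cast hM) (by exact_mod_cast (by omega : M ≤ n))
      rw [max_eq_right (by linarith), ofReal_zero, mul_zero]
  rw [tsum_eq_sum hz, re_sum]
  refine Finset.sum_congr rfl fun n hn => ?_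
  obtain ⟨h1, h2⟩ := Finset.mem_Icc.mp hn
  have : Real.log n ≤ Real.log M :=
    Real.log_le_log (by exact_mod_cast h1) (by exact_mod_cast h2)
  rw [re_mul_ofReal, vmTerm_re σ t (by omega), max_eq_left (by linarith)]
  ring

theorem hasDerivAt_tentPoly {M : ℕ} (hM : 1 < M) (σ t : ℝ) :
    HasDerivAt (fun σ => Real.log M * tentPoly M σ t)
      (-(∑ n ∈ Finset.Icc 1 M, ArithmeticFunction.vonMangoldt n * (Real.log M - Real.log n) *
        (Real.exp (-(σ * Real.log n)) * Real.cos (t * Real.log n)))) σ := by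
  have hX : 0 < Real.log M := Real.log_pos (by exact_mod_cast hM)
  unfold tentPoly
  have : HasDerivAt (fun σ => ∑ n ∈ Finset.Icc 1 M, ArithmeticFunction.vonMangoldt n / Real.log n *
    (1 - Real.log n / Real.log M) * (Real.exp (-(σ * Real.log n)) * Real.cos (t * Real.log n)))
    (∑ n ∈ Finset.Icc 1 M, ArithmeticFunction.vonMangoldt n / Real.log n *
    (1 - Real.log n / Real.log M) * (Real.exp (-(σ * Real.log n)) * (-(1 * Real.log n)) * Real.cos (t * Real.log n))) σ :=
    HasDerivAt.fun_sum fun n _ =>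
      ((((hasDerivAt_id σ).mul_const (Real.log n)).neg.exp.mul_const _).const_mul _)
  refine (this.const_mul (Real.log M)).congr_deriv ?_
  rw [Finset.mul_sum, ← Finset.sum_neg_distrib]
  refine Finset.sum_congr rfl fun n hn => ?_
  rcases eq_or_ne n 1 with rfl | h1
  · simp
  · have h2 : 1 < n := by have := (Finset.mem_Icc.mp hn).1; omega
    have : 0 < Real.log n := Real.log_pos (by exact_mod_cast h2)
    field_simp

theorem abs_tentPoly_two_le {M : ℕ} (hM : 1 < M) (t : ℝ) :
    |tentPoly M 2 t| ≤ 1 + ∑' j : ℕ, 1 / ((j:ℝ) + 1) ^ 2 := by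
  have hX : 0 < Real.log M := Real.log_pos (by exact_mod_cast hM)
  unfold tentPoly
  refine (Finset.abs_sum_le_sum_abs _ _).trans ?_
  have h : ∀ n ∈ Finset.Icc 1 M, |ArithmeticFunction.vonMangoldt n / Real.log n *
    (1 - Real.log n / Real.log M) * (Real.exp (-(2 * Real.log n)) * Real.cos (t * Real.log n))| ≤
      1 / (((n - 1 : ℕ) : ℝ) + 1) ^ 2 := by
    intro n hn
    obtain ⟨h1, h2⟩ := Finset.mem_Icc.mp hn
    have hn0 : (0:ℝ) < n := by exact_mod_cast h1
    have l1 : Real.log n ≤ Real.log M := Real.log_le_log hn0 (by exact_mod_cast h2)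
    have l0 : 0 ≤ Real.log n := Real.log_natCast_nonneg n
    have e : (((n - 1 : ℕ) : ℝ) + 1) = n := by exact_mod_cast Nat.sub_add_cancel h1
    rw [e, abs_mul, abs_mul, abs_mul]
    have a1 : |ArithmeticFunction.vonMangoldt n / Real.log n| ≤ 1 := by
      rw [abs_of_nonneg (div_nonneg ArithmeticFunction.vonMangoldt_nonneg l0)]
      exact div_le_one_of_le₀ ArithmeticFunction.vonMangoldt_le_log l0
    have a2 : |1 - Real.log n / Real.log M| ≤ 1 := by
      have b1 : Real.log n / Real.log M ≤ 1 := (div_le_one hX).mpr l1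
      have b2 : 0 ≤ Real.log n / Real.log M := by positivity
      rw [abs_of_nonneg] <;> linarith
    have a3 : |Real.exp (-(2 * Real.log n))| = 1 / (n:ℝ) ^ 2 := by
      rw [abs_of_pos (Real.exp_pos _), Real.exp_neg, mul_comm, Real.exp_mul, Real.exp_log hn0]
      norm_num
    rw [a3]
    calc _ ≤ (1 * 1) * (1 / (n:ℝ) ^ 2 * 1) := by
          gcongr
          exact Real.abs_cos_le_one _
      _ = _ := by ring
  refine (Finset.sum_le_sum h).trans ?_
  have e2 : ∑ n ∈ Finset.Icc 1 M, 1 / (((n - 1 : ℕ) : ℝ) + 1) ^ 2 =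
      ∑ j ∈ Finset.range M, 1 / ((j:ℝ) + 1) ^ 2 := by
    have e3 : Finset.Icc 1 M = Finset.Ico (0 + 1) (M + 1) := by ext; simp
    rw [e3, Finset.range_eq_Ico,
      ← Finset.sum_Ico_add' (fun n : ℕ => 1 / (((n - 1 : ℕ) : ℝ) + 1) ^ 2) 0 M 1]
    simp
  have h3 := summable_one_div_nat_add_one_sq.sum_le_tsum (Finset.range M) (fun i _ => by positivity)
  linarith

theorem norm_zeta_two_le (t : ℝ) : ‖riemannZeta ((2 : ℝ) + t * I)‖ ≤ 1 + ∑' j : ℕ, 1 / ((j:ℝ) + 1) ^ 2 := by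
  have hre : ((2 : ℝ) + t * I : ℂ).re = 2 := by simp
  rw [zeta_eq_tsum_one_div_nat_add_one_cpow (by rw [hre]; norm_num)]
  refine (tsum_of_norm_bounded summable_one_div_nat_add_one_sq.hasSum fun n => ?_).trans (by linarith)
  rw [norm_div, norm_one]
  have : ((n : ℂ) + 1) = ((n + 1 : ℕ) : ℂ) := by push_cast; rfl
  rw [this, norm_natCast_cpow_of_pos (Nat.succ_pos n), hre]
  push_cast
  norm_num

theorem hasDerivAt_neg_re_inv {x y : ℝ} (h : x ^ 2 + y ^ 2 ≠ 0) :
    HasDerivAt (fun x : ℝ => -(x / (x ^ 2 + y ^ 2))) (1 / ((x : ℂ) + y * I) ^ 2).re x := by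
  have h1 : HasDerivAt (fun x : ℝ => x ^ 2 + y ^ 2) (2 * x) x := by
    have := (hasDerivAt_pow 2 x).add_const (y ^ 2)
    simpa using this
  refine ((hasDerivAt_id x).div h1 h).neg.congr_deriv ?_
  have e : (1 / ((x : ℂ) + y * I) ^ 2).re = (x ^ 2 - y ^ 2) / (x ^ 2 + y ^ 2) ^ 2 := by
    rw [one_div, inv_re, normSq_apply]
    have a : (((x : ℂ) + y * I) ^ 2).re = x ^ 2 - y ^ 2 := by simp [pow_two]
    have b : (((x : ℂ) + y * I) ^ 2).im = 2 * x * y := by simp [pow_two]; ring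
    rw [a, b]
    congr 1
    ring
  rw [e]
  simp only [id]
  field_simp
  ring

theorem re_one_sub_exp_div_ge {a : ℂ} {X A : ℝ} (hA : 0 < A) (h : A ≤ ‖a‖) :
    (1 / a ^ 2).re - Real.exp (-(a.re * X)) / A ^ 2 ≤ ((1 - cexp (-a * X)) / a ^ 2).re := by
  rw [sub_div, sub_re]
  have h1 : (cexp (-a * X) / a ^ 2).re ≤ Real.exp (-(a.re * X)) / A ^ 2 := by
    refine (re_le_norm _).trans ?_
    rw [norm_div, norm_pow, norm_exp_neg_mul_ofReal]
    gcongr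
  linarith

theorem tent_remainder_le {σ t X : ℝ} (hσ : 1 / 2 ≤ σ) (hX : 0 ≤ X) (ht : 1 ≤ t)
    (hXt : Real.exp X ≤ t) :
    -(2 * (∑' j : ℕ, 1 / ((j:ℝ) + 1) ^ 2) + 2) ≤
    ((∑' j : ℕ, (1 - cexp (-((σ + t * I : ℂ) + 2 * ((j:ℂ) + 1)) * X)) / ((σ + t * I : ℂ) + 2 * ((j:ℂ) + 1)) ^ 2) -
      (1 - cexp (-((σ + t * I : ℂ) - 1) * X)) / ((σ + t * I : ℂ) - 1) ^ 2).re := by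
  have h1 : ‖∑' j : ℕ, (1 - cexp (-((σ + t * I : ℂ) + 2 * ((j:ℂ) + 1)) * X)) /
      ((σ + t * I : ℂ) + 2 * ((j:ℂ) + 1)) ^ 2‖ ≤ 2 * (∑' j : ℕ, 1 / ((j:ℝ) + 1) ^ 2) := by
    refine tsum_of_norm_bounded (summable_one_div_nat_add_one_sq.hasSum.mul_left 2) fun j => ?_
    have hre : ((σ + t * I : ℂ) + 2 * ((j:ℂ) + 1)).re = σ + 2 * (j + 1) := by simp
    have hj : (0:ℝ) ≤ j := Nat.cast_nonneg j
    have hn : (j:ℝ) + 1 ≤ ‖(σ + t * I : ℂ) + 2 * ((j:ℂ) + 1)‖ := by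
      refine le_trans ?_ (re_le_norm _)
      rw [hre]; linarith
    have he : ‖1 - cexp (-((σ + t * I : ℂ) + 2 * ((j:ℂ) + 1)) * X)‖ ≤ 2 := by
      refine (norm_sub_le _ _).trans ?_
      rw [norm_one, norm_exp_neg_mul_ofReal, hre]
      have : Real.exp (-((σ + 2 * (j + 1)) * X)) ≤ 1 := by
        rw [Real.exp_le_one_iff]
        have : 0 ≤ (σ + 2 * (j + 1)) * X := by positivity
        linarith
      linarith
    rw [norm_div, norm_pow]
    calc _ ≤ 2 / ((j:ℝ) + 1) ^ 2 := by gcongr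
      _ = _ := by ring
  have h2 : ‖(1 - cexp (-((σ + t * I : ℂ) - 1) * X)) / ((σ + t * I : ℂ) - 1) ^ 2‖ ≤ 2 := by
    refine (norm_one_sub_exp_div_le (by simp; linarith) hX).trans ?_
    have hn : t ≤ ‖(σ + t * I : ℂ) - 1‖ := by
      refine le_trans (le_of_eq ?_) (im_le_norm _)
      simp
    calc 2 * (1 / ‖(σ + t * I : ℂ) - 1‖ ^ 2) * Real.exp X ≤ 2 * (1 / t ^ 2) * t := by gcongr
      _ = 2 / t := by field_simp
      _ ≤ 2 := div_le_self (by norm_num) ht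
  refine (abs_le.mp ((abs_re_le_norm _).trans ?_)).1
  refine (norm_sub_le _ _).trans ?_
  linarith

theorem log_norm_zeta_sub_ge (H : SimpleRH) {M : ℕ} (hM : 3 ≤ M) {t : ℝ} (hMt : (M:ℝ) ≤ t) :
    -zeroSum ((2:ℝ) + t * I) - (2 * (∑' j : ℕ, 1 / ((j:ℝ) + 1) ^ 2) + 2) * (2 - (1 / 2 + 1 / Real.log M)) ≤
    (Real.log M * Real.log ‖riemannZeta ((2:ℝ) + t * I)‖ - Real.log M * tentPoly M 2 t) -
    (Real.log M * Real.log ‖riemannZeta ((1 / 2 + 1 / Real.log M : ℝ) + t * I)‖ -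
      Real.log M * tentPoly M (1 / 2 + 1 / Real.log M) t) := by
  have hM3 : (3:ℝ) ≤ M := by exact_mod_cast hM
  have hX1 : 1 ≤ Real.log M := by
    rw [Real.le_log_iff_exp_le (by linarith)]
    have := Real.exp_one_lt_d9
    linarith
  set X := Real.log M with hX
  set δ := 1 / X with hδ
  have hδ0 : 0 < δ := by positivity
  have hδ1 : δ ≤ 1 := div_le_one_of_le₀ hX1 (by linarith)
  have hδX : δ * X = 1 := div_mul_cancel₀ _ (by linarith)
  have hexp : Real.exp X = M := Real.exp_log (by linarith)
  set r := (2 * (∑' j : ℕ, 1 / ((j:ℝ) + 1) ^ 2) + 2) with hr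
  have hne1 : ∀ σ : ℝ, (σ + t * I : ℂ) ≠ 1 := fun σ h => by
    have := congrArg Complex.im h
    simp at this
    linarith
  have hz : ∀ σ : ℝ, 1 / 2 < σ → riemannZeta (σ + t * I) ≠ 0 := fun σ hσ =>
    zeta_ne_zero_of_half_lt H (by simp; linarith)
  set s0 : ℂ := ((1 / 2 + δ : ℝ) : ℂ) + t * I with hs0
  have hs0re : s0.re = 1 / 2 + δ := by rw [hs0]; simp
  have hs0im : s0.im = t := by rw [hs0]; simp
  have are : ∀ σ γ : ℝ, ((σ + t * I : ℂ) - 1 / 2 - γ * I).re = σ - 1 / 2 := fun σ γ => by simp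
  have aeq : ∀ σ γ : ℝ, ((σ + t * I : ℂ) - 1 / 2 - γ * I) = ((σ - 1 / 2 : ℝ) : ℂ) + (t - γ : ℝ) * I :=
    fun σ γ => by push_cast; ring
  have asq : ∀ σ γ : ℝ, ‖(σ + t * I : ℂ) - 1 / 2 - γ * I‖ ^ 2 = (σ - 1 / 2) ^ 2 + (t - γ) ^ 2 :=
    fun σ γ => by rw [normSq_sub_zetaOrd]; simp
  have A0 : ∀ γ : ℝ, 0 < ‖s0 - 1 / 2 - γ * I‖ := fun γ => by
    rw [norm_pos_iff]
    intro h
    have := congrArg Complex.re h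
    rw [hs0, are, zero_re] at this
    linarith
  have Amono : ∀ σ γ : ℝ, 1 / 2 + δ ≤ σ → ‖s0 - 1 / 2 - γ * I‖ ≤ ‖(σ + t * I : ℂ) - 1 / 2 - γ * I‖ := by
    intro σ γ h
    have e : ‖s0 - 1 / 2 - γ * I‖ ^ 2 ≤ ‖(σ + t * I : ℂ) - 1 / 2 - γ * I‖ ^ 2 := by
      rw [hs0, asq, asq]
      have : (1 / 2 + δ - 1 / 2) ≤ σ - 1 / 2 := by linarith
      have h0 : 0 ≤ 1 / 2 + δ - 1 / 2 := by linarith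
      gcongr
    exact le_of_sq_le_sq e (norm_nonneg _)
  refine sub_ge_of_deriv_ge_tsum (ι := zetaOrd) (a := 1 / 2 + δ) (b := 2) (r := r)
    (Φ := fun σ => X * Real.log ‖riemannZeta (σ + t * I)‖ - X * tentPoly M σ t)
    (Φ' := fun σ => X * (deriv riemannZeta (σ + t * I) / riemannZeta (σ + t * I)).re -
      -(∑' n : ℕ, vmTerm (σ + t * I) n * ((max (X - Real.log n) 0 : ℝ) : ℂ)).re)
    (g := fun (γ : zetaOrd) (σ : ℝ) => ((1 - cexp (-((σ + t * I : ℂ) - 1 / 2 - (γ:ℝ) * I) * X)) /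
      ((σ + t * I : ℂ) - 1 / 2 - (γ:ℝ) * I) ^ 2).re)
    (ψ := fun (γ : zetaOrd) (σ : ℝ) => -((σ - 1 / 2) / ((σ - 1 / 2) ^ 2 + (t - γ) ^ 2)) +
      Real.exp (-((σ - 1 / 2) * X)) / (X * ‖s0 - 1 / 2 - (γ:ℝ) * I‖ ^ 2))
    (ψ' := fun (γ : zetaOrd) (σ : ℝ) => (1 / ((σ + t * I : ℂ) - 1 / 2 - (γ:ℝ) * I) ^ 2).re -
      Real.exp (-((σ - 1 / 2) * X)) / ‖s0 - 1 / 2 - (γ:ℝ) * I‖ ^ 2)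
    (u := fun γ : zetaOrd => 2 * (1 / ‖s0 - 1 / 2 - (γ:ℝ) * I‖ ^ 2))
    (v := fun γ : zetaOrd => (((2:ℝ) + t * I : ℂ).re - 1 / 2) /
      ((((2:ℝ) + t * I : ℂ).re - 1 / 2) ^ 2 + (((2:ℝ) + t * I : ℂ).im - γ) ^ 2))
    (by linarith) ?_ ?_ ?_ ?_ ?_ ?_ ?_ (summable_zeroSum H _) ?_
  · intro σ hσ
    have h1 := (hasDerivAt_log_norm_zeta (hne1 σ) (hz σ (by linarith [hσ.1]))).const_mul X
    have h2 := hasDerivAt_tentPoly (by omega : 1 < M) σ t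
    rw [← re_tsum_vmTerm_tent (by omega : 0 < M) σ t] at h2
    exact h1.sub h2
  · intro γ σ hσ
    have hne : (σ - 1 / 2) ^ 2 + (t - γ) ^ 2 ≠ 0 := by
      have : 0 < σ - 1 / 2 := by linarith [hσ.1]
      positivity
    have h1 := (hasDerivAt_neg_re_inv hne).comp_sub_const σ (1 / 2)
    rw [← aeq] at h1
    have h2 : HasDerivAt (fun σ : ℝ => Real.exp (-((σ - 1 / 2) * X)) / (X * ‖s0 - 1 / 2 - (γ:ℝ) * I‖ ^ 2))
        (Real.exp (-((σ - 1 / 2) * X)) * (-(1 * X)) / (X * ‖s0 - 1 / 2 - (γ:ℝ) * I‖ ^ 2)) σ :=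
      ((((hasDerivAt_id σ).sub_const (1 / 2)).mul_const X).neg.exp).div_const _
    refine (h1.add h2).congr_deriv ?_
    have := A0 γ
    field_simp
    ring
  · intro γ σ hσ
    have := re_one_sub_exp_div_ge (X := X) (A0 γ) (Amono σ γ hσ.1)
    rw [are] at this
    exact this
  · intro γ σ hσ
    refine (abs_re_le_norm _).trans ?_
    have h1 : ‖1 - cexp (-((σ + t * I : ℂ) - 1 / 2 - (γ:ℝ) * I) * X)‖ ≤ 2 := by
      refine (norm_sub_le _ _).trans ?_
      rw [norm_one, norm_exp_neg_mul_ofReal, are]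
      have : Real.exp (-((σ - 1 / 2) * X)) ≤ 1 := by
        rw [Real.exp_le_one_iff]
        have h3 : 0 ≤ σ - 1 / 2 := by linarith [hσ.1]
        have : 0 ≤ (σ - 1 / 2) * X := by positivity
        linarith
      linarith
    rw [norm_div, norm_pow]
    have h2 := Amono σ γ hσ.1
    have h3 := A0 γ
    calc _ ≤ 2 / ‖s0 - 1 / 2 - (γ:ℝ) * I‖ ^ 2 := by gcongr
      _ = _ := by ring
  · exact (summable_zetaOrd_inv_sq H s0).mul_left 2
  · intro γ
    have e1 : ((2:ℝ) + t * I : ℂ).re = 2 := by simp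
    have e2 : ((2:ℝ) + t * I : ℂ).im = t := by simp
    have hs := asq (1 / 2 + δ) γ
    rw [← hs0] at hs
    rw [e1, e2]
    have hA := A0 γ
    have hpos : 0 < (1 / 2 + δ - 1 / 2) ^ 2 + (t - γ) ^ 2 := by rw [← hs]; positivity
    rw [hs]
    have e3 : (1 / 2 + δ - 1 / 2) / ((1 / 2 + δ - 1 / 2) ^ 2 + (t - γ) ^ 2) =
        1 / (X * ((1 / 2 + δ - 1 / 2) ^ 2 + (t - γ) ^ 2)) := by
      rw [div_eq_div_iff hpos.ne' (by positivity)]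
      have : (1 / 2 + δ - 1 / 2) = δ := by ring
      rw [this]
      linear_combination (δ ^ 2 + (t - γ) ^ 2) * hδX
    rw [e3]
    have h4 : Real.exp (-((1 / 2 + δ - 1 / 2) * X)) / (X * ((1 / 2 + δ - 1 / 2) ^ 2 + (t - γ) ^ 2)) ≤
        1 / (X * ((1 / 2 + δ - 1 / 2) ^ 2 + (t - γ) ^ 2)) := by
      have : Real.exp (-((1 / 2 + δ - 1 / 2) * X)) ≤ 1 := by
        rw [Real.exp_le_one_iff, add_sub_cancel_left, hδX]
        norm_num
      gcongr
    have h5 : 0 ≤ Real.exp (-((2 - 1 / 2) * X)) / (X * ((1 / 2 + δ - 1 / 2) ^ 2 + (t - γ) ^ 2)) := by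
      positivity
    linarith
  · intro γ
    have e1 : ((2:ℝ) + t * I : ℂ).re = 2 := by simp
    rw [e1]
    have : (0:ℝ) ≤ 2 - 1 / 2 := by norm_num
    positivity
  · intro σ hσ
    have h := tent_identity H (s := σ + t * I) (by simp; linarith [hσ.1]) (hne1 σ)
      (hz σ (by linarith [hσ.1])) (by linarith : 0 ≤ X)
    rw [h]
    have h1 := tent_remainder_le (σ := σ) (by linarith [hσ.1]) (by linarith : 0 ≤ X)
      (by linarith : 1 ≤ t) (by rw [hexp]; exact hMt)
    have hsum : Summable (fun γ : zetaOrd => (1 - cexp (-((σ + t * I : ℂ) - 1 / 2 - (γ:ℝ) * I) * X)) /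
      ((σ + t * I : ℂ) - 1 / 2 - (γ:ℝ) * I) ^ 2) := by
      refine Summable.of_norm_bounded (((summable_zetaOrd_inv_sq H (σ + t * I)).mul_left 2).mul_right (Real.exp X))
        fun γ => norm_one_sub_exp_div_le ?_ (by linarith)
      rw [are]; linarith [hσ.1]
    rw [← re_tsum hsum]
    rw [sub_re] at h1
    rw [sub_re, add_re, add_re, ← ofReal_neg, re_ofReal_mul]
    linarith

theorem log_norm_zeta_le (H : SimpleRH) : ∃ C > 0, ∀ T ≥ (2:ℝ), ∀ t : ℝ, T < t → t ≤ 2 * T →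
    ∀ M : ℕ, 3 ≤ M → (M:ℝ) ≤ T →
    Real.log ‖riemannZeta ((1 / 2 + 1 / Real.log M : ℝ) + t * I)‖ ≤
      tentPoly M (1 / 2 + 1 / Real.log M) t + (1 / 2 * Real.log T) / Real.log M + C := by
  obtain ⟨C1, hC1, h1⟩ := zeroSum_sub_le H
  obtain ⟨C2, hC2, h2⟩ := norm_zeta_logDeriv_le
  set Z := ∑' j : ℕ, 1 / ((j:ℝ) + 1) ^ 2 with hZ
  have hZ0 : 0 ≤ Z := tsum_nonneg fun j => by positivity
  refine ⟨(1 + Z) + (1 + Z) + (C1 + C2 + 2 * (2 * Z + 2)), by positivity, ?_⟩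
  intro T hT t ht1 ht2 M hM hMT
  have hM3 : (3:ℝ) ≤ M := by exact_mod_cast hM
  have hX1 : 1 ≤ Real.log M := by
    rw [Real.le_log_iff_exp_le (by linarith)]
    have := Real.exp_one_lt_d9
    linarith
  have key := log_norm_zeta_sub_ge H hM (t := t) (by linarith)
  have hre : ((2:ℝ) + t * I : ℂ).re = 2 := by simp
  have him : ((2:ℝ) + t * I : ℂ).im = t := by simp
  have hz2 : riemannZeta ((2:ℝ) + t * I) ≠ 0 := zeta_ne_zero_of_half_lt H (by rw [hre]; norm_num)
  have a1 := h1 T hT ((2:ℝ) + t * I) (by rw [hre]; norm_num) (by rw [hre]; linarith)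
    (by rw [him, abs_of_nonneg] <;> linarith) (by rw [him, abs_of_nonneg] <;> linarith) hz2
  have a2 := (re_le_norm _).trans (h2 ((2:ℝ) + t * I) hre.ge)
  have a3 := (abs_le.mp (abs_tentPoly_two_le (by omega : 1 < M) t)).1
  have a4 : Real.log ‖riemannZeta ((2:ℝ) + t * I)‖ ≤ 1 + Z :=
    (Real.log_le_sub_one_of_pos (norm_pos_iff.mpr hz2)).trans (by linarith [norm_zeta_two_le t])
  set X := Real.log M with hX
  have hX0 : 0 < X := by linarith
  have a5 : (2 * Z + 2) * (2 - (1 / 2 + 1 / X)) ≤ 2 * (2 * Z + 2) := by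
    have : 0 < 1 / X := by positivity
    nlinarith
  have e : X * (tentPoly M (1 / 2 + 1 / X) t + (1 / 2 * Real.log T) / X +
    ((1 + Z) + (1 + Z) + (C1 + C2 + 2 * (2 * Z + 2)))) = X * tentPoly M (1 / 2 + 1 / X) t +
      1 / 2 * Real.log T + X * ((1 + Z) + (1 + Z)) + X * (C1 + C2 + 2 * (2 * Z + 2)) := by
    field_simp
    ring
  refine le_of_mul_le_mul_left ?_ hX0
  rw [e]
  have b1 : X * Real.log ‖riemannZeta ((2:ℝ) + t * I)‖ ≤ X * (1 + Z) := by gcongr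
  have b2 : X * (-(1 + Z)) ≤ X * tentPoly M 2 t := by gcongr
  have b3 : (C1 + C2 + 2 * (2 * Z + 2)) ≤ X * (C1 + C2 + 2 * (2 * Z + 2)) :=
    le_mul_of_one_le_left (by positivity) hX1
  linarith

/-- The smoothing weight `(1 - y/X)₊ e^{-y/X}`. -/
noncomputable def smoothWeight (X y : ℝ) : ℝ := max (1 - y / X) 0 * Real.exp (-(y / X))

theorem smoothWeight_nonneg (X y : ℝ) : 0 ≤ smoothWeight X y :=
  mul_nonneg (le_max_right _ _) (Real.exp_pos _).le

theorem smoothWeight_le_one {X y : ℝ} (hX : 0 ≤ X) (hy : 0 ≤ y) : smoothWeight X y ≤ 1 := by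
  have h : 0 ≤ y / X := by positivity
  have h1 : max (1 - y / X) 0 ≤ 1 := max_le (by linarith) zero_le_one
  have h2 : Real.exp (-(y / X)) ≤ 1 := Real.exp_le_one_iff.mpr (by linarith)
  calc _ ≤ 1 * 1 := mul_le_mul h1 h2 (Real.exp_pos _).le zero_le_one
    _ = 1 := one_mul 1

theorem smoothWeight_eq_zero {X y : ℝ} (hX : 0 < X) (hy : X ≤ y) : smoothWeight X y = 0 := by
  unfold smoothWeight
  rw [max_eq_right, zero_mul]
  have : 1 ≤ y / X := (one_le_div hX).mpr hy
  linarith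

theorem sum_vonMangoldt_div_log_mul {M : ℕ} (hM : 1 < M) (F : ℕ → ℝ) (hF : ∀ n, M < n → F n = 0) :
    ∑ n ∈ Finset.Icc 1 M, ArithmeticFunction.vonMangoldt n / Real.log n * F n =
      ∑ k ∈ Finset.Icc 1 (⌊Real.log M / Real.log 2⌋₊ + 2), ∑ p ∈ (Finset.Icc 1 M).filter Nat.Prime,
        1 / (k:ℝ) * F (p ^ k) := by
  have h := Chebyshev.sum_PrimePow_eq_sum_sum' (fun n => ArithmeticFunction.vonMangoldt n / Real.log n * F n)
    (x := (M:ℝ)) (Nat.cast_nonneg M) (Nat.le_add_right ⌊Real.log M / Real.log 2⌋₊ 2)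
  rw [Nat.floor_natCast] at h
  have e1 : Finset.Icc 1 M = Finset.Ioc 0 M := by ext; simp [Nat.succ_le_iff]
  rw [e1]
  rw [← Finset.sum_filter_of_ne (p := IsPrimePow) (fun n _ hn => by
    by_contra hp
    apply hn
    rw [ArithmeticFunction.vonMangoldt_eq_zero_iff.mpr hp, zero_div, zero_mul])]
  rw [h]
  refine Finset.sum_congr rfl fun k hk => ?_
  obtain ⟨hk1, _⟩ := Finset.mem_Icc.mp hk
  have hM0 : (0:ℝ) ≤ M := Nat.cast_nonneg M
  have hM1 : (1:ℝ) ≤ M := by exact_mod_cast hM.le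
  have hsub : (Finset.Ioc 0 ⌊(M:ℝ) ^ ((1:ℝ) / k)⌋₊).filter Nat.Prime ⊆ (Finset.Ioc 0 M).filter Nat.Prime := by
    intro p hp
    rw [Finset.mem_filter, Finset.mem_Ioc] at hp ⊢
    refine ⟨⟨hp.1.1, hp.1.2.trans ?_⟩, hp.2⟩
    refine Nat.floor_le_of_le ?_
    calc (M:ℝ) ^ ((1:ℝ) / k) ≤ (M:ℝ) ^ (1:ℝ) := by
          refine Real.rpow_le_rpow_of_exponent_le hM1 ?_
          refine div_le_one_of_le₀ (by exact_mod_cast hk1) (Nat.cast_nonneg k)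
      _ = M := Real.rpow_one _
  refine (Finset.sum_subset hsub fun p hp hnp => ?_).trans (Finset.sum_congr rfl fun p hp => ?_)
  · rw [Finset.mem_filter, Finset.mem_Ioc] at hp hnp
    have h2 : ⌊(M:ℝ) ^ ((1:ℝ) / k)⌋₊ < p := by
      by_contra hcon
      exact hnp ⟨⟨hp.1.1, not_lt.mp hcon⟩, hp.2⟩
    have h3 : (M:ℝ) ^ ((1:ℝ) / k) < p := Nat.lt_of_floor_lt h2
    have h4 : (M:ℝ) < ((p ^ k : ℕ) : ℝ) := by
      have := pow_lt_pow_left₀ h3 (by positivity) (by omega : k ≠ 0)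
      rw [← Real.rpow_natCast, ← Real.rpow_mul hM0, one_div,
        inv_mul_cancel₀ (by positivity), Real.rpow_one] at this
      push_cast
      exact this
    rw [hF _ (by exact_mod_cast h4), mul_zero]
  · have hpp := (Finset.mem_filter.mp hp).2
    have hl : 0 < Real.log p := Real.log_pos (by exact_mod_cast hpp.one_lt)
    rw [ArithmeticFunction.vonMangoldt_apply_pow (by omega), ArithmeticFunction.vonMangoldt_apply_prime hpp]
    push_cast
    rw [Real.log_pow]
    congr 1
    have : (k:ℝ) ≠ 0 := by positivity
    field_simp

/-- The contribution of the prime `p` and its square to the smoothed prime sum. -/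
noncomputable def primeTerm (X t : ℝ) (p : ℕ) : ℝ :=
  smoothWeight X (Real.log p) * Real.exp (-(Real.log p / 2)) * Real.cos (t * Real.log p) +
    1 / 2 * smoothWeight X (2 * Real.log p) * Real.exp (-Real.log p) * Real.cos (t * (2 * Real.log p))

theorem sum_prime_high_powers_le : ∃ C > 0, ∀ M N : ℕ, ∑ k ∈ Finset.Icc 3 N,
    ∑ p ∈ (Finset.Icc 1 M).filter Nat.Prime, Real.exp (-(k * Real.log p / 2)) ≤ C := by
  set q := Real.exp (-(Real.log 2 / 2)) with hq
  have hl2 : 0 < Real.log 2 := Real.log_pos one_lt_two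
  have hq0 : 0 < q := Real.exp_pos _
  have hq1 : q < 1 := Real.exp_lt_one_iff.mpr (by linarith)
  have hs : Summable (fun n : ℕ => (n:ℝ) ^ (-(3 / 2) : ℝ)) :=
    Real.summable_nat_rpow.mpr (by norm_num)
  set S := ∑' n : ℕ, (n:ℝ) ^ (-(3 / 2) : ℝ) with hS
  have hS0 : 0 ≤ S := tsum_nonneg fun n => by positivity
  have hq' : 0 < 1 - q := by linarith
  refine ⟨(1 - q)⁻¹ * S + 1, by positivity, fun M N => ?_⟩
  have h1 : ∀ k ∈ Finset.Icc 3 N, ∑ p ∈ (Finset.Icc 1 M).filter Nat.Prime,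
      Real.exp (-(k * Real.log p / 2)) ≤ q ^ (k - 3) * S := by
    intro k hk
    have hk3 := (Finset.mem_Icc.mp hk).1
    calc _ ≤ ∑ p ∈ (Finset.Icc 1 M).filter Nat.Prime, q ^ (k - 3) * (p:ℝ) ^ (-(3 / 2) : ℝ) := by
          refine Finset.sum_le_sum fun p hp => ?_
          have hpp := (Finset.mem_filter.mp hp).2
          have hp0 : (0:ℝ) < p := by exact_mod_cast hpp.pos
          have hlp : Real.log 2 ≤ Real.log p := Real.log_le_log two_pos (by exact_mod_cast hpp.two_le)
          rw [Real.rpow_def_of_pos hp0, hq, ← Real.exp_nat_mul, ← Real.exp_add, Real.exp_le_exp,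
            Nat.cast_sub hk3]
          have : (0:ℝ) ≤ (k:ℝ) - 3 := by
            have : (3:ℝ) ≤ k := by exact_mod_cast hk3
            linarith
          push_cast
          nlinarith
      _ ≤ q ^ (k - 3) * S := by
          rw [← Finset.mul_sum]
          have := hs.sum_le_tsum ((Finset.Icc 1 M).filter Nat.Prime) (fun i _ => by positivity)
          gcongr
  refine (Finset.sum_le_sum h1).trans ?_
  rw [← Finset.sum_mul]
  have h2 : ∑ k ∈ Finset.Icc 3 N, q ^ (k - 3) ≤ (1 - q)⁻¹ := by
    have e : ∑ k ∈ Finset.Icc 3 N, q ^ (k - 3) = ∑ k ∈ Finset.range (N + 1 - 3), q ^ k := by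
      refine Finset.sum_nbij' (· - 3) (· + 3) ?_ ?_ ?_ ?_ ?_
      · intro k hk
        simp only [Finset.mem_Icc, Finset.mem_range] at hk ⊢
        omega
      · intro k hk
        simp only [Finset.mem_Icc, Finset.mem_range] at hk ⊢
        omega
      · intro k hk
        simp only [Finset.mem_Icc] at hk
        omega
      · intro k hk
        omega
      · intro k hk
        rfl
    rw [e, ← tsum_geometric_of_lt_one hq0.le hq1]
    exact (summable_geometric_of_lt_one hq0.le hq1).sum_le_tsum _ (fun i _ => by positivity)
  have : (∑ k ∈ Finset.Icc 3 N, q ^ (k - 3)) * S ≤ (1 - q)⁻¹ * S := by gcongr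
  linarith

theorem tentPoly_le : ∃ C > 0, ∀ M : ℕ, 3 ≤ M → ∀ t : ℝ, tentPoly M (1 / 2 + 1 / Real.log M) t ≤
    ∑ p ∈ (Finset.Icc 1 M).filter Nat.Prime, primeTerm (Real.log M) t p + C := by
  obtain ⟨C, hC, h⟩ := sum_prime_high_powers_le
  refine ⟨C, hC, fun M hM t => ?_⟩
  have hX : 0 < Real.log M := Real.log_pos (by exact_mod_cast (by omega : 1 < M))
  set X := Real.log M with hXdef
  set F : ℕ → ℝ := fun n => smoothWeight X (Real.log n) * Real.exp (-(Real.log n / 2)) *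
    Real.cos (t * Real.log n) with hF
  have hFz : ∀ n, M < n → F n = 0 := by
    intro n hn
    have : X ≤ Real.log n := Real.log_le_log (by exact_mod_cast (by omega : 0 < M)) (by exact_mod_cast hn.le)
    rw [hF]
    simp only
    rw [smoothWeight_eq_zero hX this, zero_mul, zero_mul]
  have e1 : tentPoly M (1 / 2 + 1 / X) t =
      ∑ n ∈ Finset.Icc 1 M, ArithmeticFunction.vonMangoldt n / Real.log n * F n := by
    unfold tentPoly
    refine Finset.sum_congr rfl fun n hn => ?_
    obtain ⟨hn1, hn2⟩ := Finset.mem_Icc.mp hn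
    have : Real.log n / X ≤ 1 := (div_le_one hX).mpr
      (Real.log_le_log (by exact_mod_cast hn1) (by exact_mod_cast hn2))
    rw [← hXdef, hF]
    simp only [smoothWeight]
    rw [max_eq_left (by linarith)]
    have : Real.exp (-((1 / 2 + 1 / X) * Real.log n)) =
        Real.exp (-(Real.log n / X)) * Real.exp (-(Real.log n / 2)) := by
      rw [← Real.exp_add]; congr 1; ring
    rw [this]
    ring
  rw [e1, sum_vonMangoldt_div_log_mul (by omega) F hFz]
  set N := ⌊Real.log M / Real.log 2⌋₊ with hN
  have e2 : Finset.Icc 1 (N + 2) = insert 1 (insert 2 (Finset.Icc 3 (N + 2))) := by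
    ext k; simp; omega
  rw [e2, Finset.sum_insert (by simp), Finset.sum_insert (by simp), ← add_assoc, ← Finset.sum_add_distrib]
  refine add_le_add (le_of_eq (Finset.sum_congr rfl fun p hp => ?_)) (le_trans ?_ (h M (N + 2)))
  · unfold primeTerm
    rw [hF]
    push_cast
    simp only [pow_one, Real.log_pow]
    push_cast
    have : 2 * Real.log p / 2 = Real.log p := by ring
    rw [this]
    ring
  · refine Finset.sum_le_sum fun k hk => Finset.sum_le_sum fun p hp => ?_
    have hk3 := (Finset.mem_Icc.mp hk).1
    have hk1 : 1 / (k:ℝ) ≤ 1 := by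
      rw [div_le_one (by positivity)]
      exact_mod_cast (by omega : 1 ≤ k)
    have hl : 0 ≤ Real.log p := Real.log_natCast_nonneg p
    rw [hF]
    push_cast
    rw [Real.log_pow]
    have h0 := smoothWeight_nonneg X (k * Real.log p)
    have h1 := smoothWeight_le_one hX.le (by positivity : 0 ≤ k * Real.log p)
    have hE := Real.exp_pos (-(k * Real.log p / 2))
    have x1 := mul_le_of_le_one_left hE.le h1
    have x2 := mul_le_of_le_one_right (mul_nonneg h0 hE.le) (Real.cos_le_one (t * (k * Real.log p)))
    calc _ ≤ 1 / (k:ℝ) * Real.exp (-(k * Real.log p / 2)) :=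
          mul_le_mul_of_nonneg_left (x2.trans x1) (by positivity)
      _ ≤ _ := mul_le_of_le_one_left hE.le hk1

theorem norm_deriv_zeta_le_primeTerm (H : SimpleRH) : ∃ C > 0, ∀ T ≥ (2:ℝ), ∀ γ ∈ zetaOrd, T < γ → γ ≤ 2 * T →
    ∀ M : ℕ, 3 ≤ M → (M:ℝ) ≤ T → ‖deriv riemannZeta (1 / 2 + γ * I)‖ ≤
      Real.log M * Real.exp (∑ p ∈ (Finset.Icc 1 M).filter Nat.Prime, primeTerm (Real.log M) γ p +
        Real.log T / Real.log M + C) := by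
  obtain ⟨C1, hC1, h1⟩ := norm_deriv_zeta_le H
  obtain ⟨C2, hC2, h2⟩ := log_norm_zeta_le H
  obtain ⟨C3, hC3, h3⟩ := tentPoly_le
  refine ⟨C1 + C2 + C3, by positivity, fun T hT γ hγ hγ1 hγ2 M hM hMT => ?_⟩
  have hM3 : (3:ℝ) ≤ M := by exact_mod_cast hM
  have hX1 : 1 ≤ Real.log M := by
    rw [Real.le_log_iff_exp_le (by linarith)]
    have := Real.exp_one_lt_d9
    linarith
  have hX0 : 0 < Real.log M := by linarith
  have a1 := h1 T hT γ hγ hγ1 hγ2 (1 / Real.log M) (by positivity) (div_le_one_of_le₀ hX1 hX0.le)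
  have a2 := h2 T hT γ hγ1 hγ2 M hM hMT
  have a3 := h3 M hM γ
  set X := Real.log M with hX
  have hz : riemannZeta ((1 / 2 + 1 / X : ℝ) + γ * I) ≠ 0 :=
    zeta_ne_zero_of_half_lt H (by
      have : 0 < 1 / X := by positivity
      rw [add_re, ofReal_re, re_ofReal_mul, I_re]; linarith)
  refine a1.trans ?_
  have e1 : ‖riemannZeta ((1 / 2 + 1 / X : ℝ) + γ * I)‖ =
      Real.exp (Real.log ‖riemannZeta ((1 / 2 + 1 / X : ℝ) + γ * I)‖) :=
    (Real.exp_log (norm_pos_iff.mpr hz)).symm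
  rw [e1, div_div_eq_mul_div, div_one, mul_comm _ X, mul_assoc, ← Real.exp_add]
  refine mul_le_mul_of_nonneg_left (Real.exp_le_exp.mpr ?_) hX0.le
  have e2 : (1 / 2 * Real.log T + C1) * (1 / X) = (1 / 2 * Real.log T) / X + C1 / X := by ring
  have e3 : C1 / X ≤ C1 := div_le_self hC1.le hX1
  have e4 : (1 / 2 * Real.log T) / X + (1 / 2 * Real.log T) / X = Real.log T / X := by ring
  linarith

/-- The sum of the squares of the coefficients of a polynomial. -/
noncomputable def coeffNormSq (f : MvPolynomial ℕ ℝ) : ℝ := ∑ m ∈ f.support, f.coeff m ^ 2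

theorem coeffNormSq_nonneg (f : MvPolynomial ℕ ℝ) : 0 ≤ coeffNormSq f :=
  Finset.sum_nonneg fun _ _ => sq_nonneg _

theorem coeffNormSq_eq_sum {f : MvPolynomial ℕ ℝ} {S : Finset (ℕ →₀ ℕ)} (h : f.support ⊆ S) :
    coeffNormSq f = ∑ m ∈ S, f.coeff m ^ 2 :=
  Finset.sum_subset h fun m _ hm => by
    rw [MvPolynomial.notMem_support_iff.mp hm]
    norm_num

theorem sum_coeff_sq_le (f : MvPolynomial ℕ ℝ) (S : Finset (ℕ →₀ ℕ)) :
    ∑ m ∈ S, f.coeff m ^ 2 ≤ coeffNormSq f := by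
  rw [coeffNormSq_eq_sum (Finset.subset_union_left : f.support ⊆ f.support ∪ S)]
  exact Finset.sum_le_sum_of_subset_of_nonneg Finset.subset_union_right fun _ _ _ => sq_nonneg _

theorem support_sum_monomial_subset {ι : Type*} [DecidableEq ι] (I : Finset ι) (g : ι → ℕ →₀ ℕ) (c : ι → ℝ) :
    (∑ i ∈ I, MvPolynomial.monomial (g i) (c i)).support ⊆ I.image g := by
  intro m hm
  rw [MvPolynomial.mem_support_iff, MvPolynomial.coeff_sum] at hm
  obtain ⟨i, hi, hne⟩ := Finset.exists_ne_zero_of_sum_ne_zero hm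
  rw [MvPolynomial.coeff_monomial] at hne
  rw [Finset.mem_image]
  refine ⟨i, hi, ?_⟩
  by_contra h
  exact hne (if_neg h)

theorem coeff_sum_monomial {ι : Type*} [DecidableEq ι] (I : Finset ι) (g : ι → ℕ →₀ ℕ) (c : ι → ℝ)
    (m : ℕ →₀ ℕ) : (∑ i ∈ I, MvPolynomial.monomial (g i) (c i)).coeff m =
      ∑ i ∈ I with g i = m, c i := by
  rw [MvPolynomial.coeff_sum, Finset.sum_filter]
  exact Finset.sum_congr rfl fun i _ => MvPolynomial.coeff_monomial _ _ _

theorem coeffNormSq_sum_monomial_le {ι : Type*} [DecidableEq ι] (I : Finset ι) (g : ι → ℕ →₀ ℕ)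
    (c : ι → ℝ) {K : ℝ} (hK : ∀ m ∈ I.image g, ((I.filter fun i => g i = m).card : ℝ) ≤ K) :
    coeffNormSq (∑ i ∈ I, MvPolynomial.monomial (g i) (c i)) ≤ K * ∑ i ∈ I, c i ^ 2 := by
  rw [coeffNormSq_eq_sum (support_sum_monomial_subset I g c)]
  have e := Finset.sum_fiberwise_of_maps_to (s := I) (t := I.image g) (g := g)
    (fun i hi => Finset.mem_image_of_mem g hi) (fun i => c i ^ 2)
  rw [← e, Finset.mul_sum]
  refine Finset.sum_le_sum fun m hm => ?_
  rw [coeff_sum_monomial]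
  have h := sq_sum_le_card_mul_sum_sq (s := I.filter fun i => g i = m) (f := c)
  refine h.trans ?_
  exact mul_le_mul_of_nonneg_right (hK m hm) (Finset.sum_nonneg fun _ _ => sq_nonneg _)

theorem coeffNormSq_sum_monomial {ι : Type*} [DecidableEq ι] (I : Finset ι) (g : ι → ℕ →₀ ℕ)
    (c : ι → ℝ) (hg : Set.InjOn g I) :
    coeffNormSq (∑ i ∈ I, MvPolynomial.monomial (g i) (c i)) = ∑ i ∈ I, c i ^ 2 := by
  rw [coeffNormSq_eq_sum (support_sum_monomial_subset I g c), Finset.sum_image hg]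
  refine Finset.sum_congr rfl fun i hi => ?_
  rw [coeff_sum_monomial]
  congr 1
  have : I.filter (fun k => g k = g i) = {i} := by
    ext k
    simp only [Finset.mem_filter, Finset.mem_singleton]
    constructor
    · rintro ⟨hk, e⟩
      exact hg hk hi e
    · rintro rfl
      exact ⟨hi, rfl⟩
  rw [this, Finset.sum_singleton]

theorem mul_eq_sum_monomial (f g : MvPolynomial ℕ ℝ) :
    f * g = ∑ i ∈ f.support ×ˢ g.support, MvPolynomial.monomial (i.1 + i.2) (f.coeff i.1 * g.coeff i.2) := by
  conv_lhs => rw [MvPolynomial.as_sum f, MvPolynomial.as_sum g]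
  rw [Finset.sum_mul_sum, Finset.sum_product]
  simp only [MvPolynomial.monomial_mul]

theorem coeffNormSq_mul_of_disjoint {f g : MvPolynomial ℕ ℝ} {U V : Finset ℕ} (hf : f.vars ⊆ U)
    (hg : g.vars ⊆ V) (hUV : Disjoint U V) :
    coeffNormSq (f * g) = coeffNormSq f * coeffNormSq g := by
  rw [mul_eq_sum_monomial, coeffNormSq_sum_monomial, Finset.sum_product, coeffNormSq, coeffNormSq,
    Finset.sum_mul_sum]
  · simp only [mul_pow]
  · have hz : ∀ m ∈ f.support, ∀ p ∉ U, m p = 0 := fun m hm p hp => by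
      by_contra h
      exact hp (hf ((MvPolynomial.mem_vars_iff_mem_support p).mpr ⟨m, hm, Finsupp.mem_support_iff.mpr h⟩))
    have hz2 : ∀ m ∈ g.support, ∀ p ∈ U, m p = 0 := fun m hm p hp => by
      by_contra h
      exact Finset.disjoint_left.mp hUV hp
        (hg ((MvPolynomial.mem_vars_iff_mem_support p).mpr ⟨m, hm, Finsupp.mem_support_iff.mpr h⟩))
    rintro ⟨a, b⟩ h1 ⟨a', b'⟩ h2 e
    simp only [Finset.coe_product, Set.mem_prod, Finset.mem_coe] at h1 h2 e
    have ha : a = a' := by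
      ext p
      by_cases hp : p ∈ U
      · have := DFunLike.congr_fun e p
        simp only [Finsupp.add_apply, hz2 b h1.2 p hp, hz2 b' h2.2 p hp] at this
        omega
      · rw [hz a h1.1 p hp, hz a' h2.1 p hp]
    subst ha
    rw [add_left_cancel e]

theorem coeffNormSq_one : coeffNormSq 1 = 1 := by
  have : (1 : MvPolynomial ℕ ℝ) = ∑ i ∈ ({()} : Finset Unit), MvPolynomial.monomial 0 1 := by
    simp
  rw [this, coeffNormSq_sum_monomial]
  · simp
  · intro a _ b _ _
    rfl

theorem coeffNormSq_prod {ι : Type*} [DecidableEq ι] (s : Finset ι) (f : ι → MvPolynomial ℕ ℝ)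
    (U : ι → Finset ℕ) (hf : ∀ i ∈ s, (f i).vars ⊆ U i)
    (hU : ∀ i ∈ s, ∀ j ∈ s, i ≠ j → Disjoint (U i) (U j)) :
    coeffNormSq (∏ i ∈ s, f i) = ∏ i ∈ s, coeffNormSq (f i) := by
  induction s using Finset.induction_on with
  | empty => simp [coeffNormSq_one]
  | insert a s ha ih =>
    rw [Finset.prod_insert ha, Finset.prod_insert ha,
      coeffNormSq_mul_of_disjoint (hf a (Finset.mem_insert_self _ _)) (V := s.biUnion U),
      ih (fun i hi => hf i (Finset.mem_insert_of_mem hi))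
        (fun i hi j hj => hU i (Finset.mem_insert_of_mem hi) j (Finset.mem_insert_of_mem hj))]
    · refine (MvPolynomial.vars_prod f).trans ?_
      exact Finset.biUnion_mono fun i hi => hf i (Finset.mem_insert_of_mem hi)
    · rw [Finset.disjoint_biUnion_right]
      intro i hi
      refine hU a (Finset.mem_insert_self _ _) i (Finset.mem_insert_of_mem hi) ?_
      rintro rfl
      exact ha hi

/-- The polynomial `∑_{p ∈ I} (α_p x_p + β_p x_p²)`. -/
noncomputable def blockPoly (I : Finset ℕ) (α β : ℕ → ℝ) : MvPolynomial ℕ ℝ :=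
  ∑ p ∈ I, (MvPolynomial.monomial (Finsupp.single p 1) (α p) +
    MvPolynomial.monomial (Finsupp.single p 2) (β p))

theorem blockPoly_eq (I : Finset ℕ) (α β : ℕ → ℝ) : blockPoly I α β =
    ∑ i ∈ I ×ˢ ({1, 2} : Finset ℕ), MvPolynomial.monomial (Finsupp.single i.1 i.2)
      (if i.2 = 1 then α i.1 else β i.1) := by
  rw [Finset.sum_product]
  refine Finset.sum_congr rfl fun p _ => ?_
  rw [Finset.sum_pair (by norm_num)]
  simp

theorem vars_blockPoly (I : Finset ℕ) (α β : ℕ → ℝ) : (blockPoly I α β).vars ⊆ I := by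
  rw [blockPoly_eq]
  intro p hp
  obtain ⟨m, hm, hpm⟩ := (MvPolynomial.mem_vars_iff_mem_support p).mp hp
  obtain ⟨i, hi, rfl⟩ := Finset.mem_image.mp (support_sum_monomial_subset _ _ _ hm)
  have := Finsupp.support_single_subset hpm
  rw [Finset.mem_singleton] at this
  rw [this]
  exact (Finset.mem_product.mp hi).1

theorem coeffNormSq_blockPoly_mul_le (I : Finset ℕ) (α β : ℕ → ℝ) {f : MvPolynomial ℕ ℝ} {q : ℕ}
    (hf : ∀ m ∈ f.support, m.support.card ≤ q) :
    coeffNormSq (blockPoly I α β * f) ≤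
      (2 * (q + 1)) * ((∑ p ∈ I, (α p ^ 2 + β p ^ 2)) * coeffNormSq f) := by
  have e : blockPoly I α β * f = ∑ i ∈ (I ×ˢ ({1, 2} : Finset ℕ)) ×ˢ f.support,
      MvPolynomial.monomial (Finsupp.single i.1.1 i.1.2 + i.2)
        ((if i.1.2 = 1 then α i.1.1 else β i.1.1) * f.coeff i.2) := by
    rw [blockPoly_eq]
    conv_lhs => rw [MvPolynomial.as_sum f]
    rw [Finset.sum_mul_sum]
    conv_rhs => rw [Finset.sum_product]
    simp only [MvPolynomial.monomial_mul]
  rw [e]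
  refine (coeffNormSq_sum_monomial_le _ _ _ (K := 2 * (q + 1)) ?_).trans (le_of_eq ?_)
  · intro m hm
    obtain ⟨i, hi, rfl⟩ := Finset.mem_image.mp hm
    set m := Finsupp.single i.1.1 i.1.2 + i.2 with hmdef
    have hc : m.support.card ≤ q + 1 := by
      refine (Finset.card_le_card Finsupp.support_add).trans ((Finset.card_union_le _ _).trans ?_)
      have h1 : (Finsupp.single i.1.1 i.1.2).support.card ≤ 1 :=
        (Finset.card_le_card Finsupp.support_single_subset).trans (by simp)
      have h2 := hf i.2 (Finset.mem_product.mp hi).2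
      omega
    have hcard : ((((I ×ˢ ({1, 2} : Finset ℕ)) ×ˢ f.support).filter
        fun i => Finsupp.single i.1.1 i.1.2 + i.2 = m).card) ≤ (m.support ×ˢ ({1, 2} : Finset ℕ)).card := by
      refine Finset.card_le_card_of_injOn (fun i => i.1) ?_ ?_
      · intro k hk
        simp only [Finset.coe_filter, Finset.mem_product, Set.mem_ofPred_eq] at hk
        simp only [Finset.coe_product, Set.mem_prod, Finset.mem_coe]
        refine ⟨?_, hk.1.1.2⟩
        rw [← hk.2, Finsupp.mem_support_iff, Finsupp.add_apply, Finsupp.single_eq_same]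
        have := hk.1.1.2
        simp only [Finset.mem_insert, Finset.mem_singleton] at this
        omega
      · rintro ⟨a, b⟩ h1 ⟨a', b'⟩ h2 e
        simp only [Finset.coe_filter, Finset.mem_product, Set.mem_ofPred_eq] at h1 h2 e
        subst e
        rw [add_left_cancel (h1.2.trans h2.2.symm)]
    rw [Finset.card_product] at hcard
    have h3 : (({1, 2} : Finset ℕ)).card = 2 := rfl
    rw [h3] at hcard
    have : ((((I ×ˢ ({1, 2} : Finset ℕ)) ×ˢ f.support).filter
        fun i => Finsupp.single i.1.1 i.1.2 + i.2 = m).card) ≤ 2 * (q + 1) := by omega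
    exact_mod_cast this
  · congr 1
    rw [Finset.sum_product, coeffNormSq, Finset.sum_product, Finset.sum_mul]
    refine Finset.sum_congr rfl fun p _ => ?_
    rw [Finset.sum_pair (by norm_num), add_mul, Finset.mul_sum, Finset.mul_sum]
    simp [mul_pow]

theorem card_support_mul_le {f g : MvPolynomial ℕ ℝ} {a b : ℕ}
    (hf : ∀ m ∈ f.support, m.support.card ≤ a) (hg : ∀ m ∈ g.support, m.support.card ≤ b) :
    ∀ m ∈ (f * g).support, m.support.card ≤ a + b := by
  intro m hm
  obtain ⟨u, hu, v, hv, rfl⟩ := Finset.mem_add.mp (MvPolynomial.support_mul f g hm)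
  have := (Finset.card_le_card (Finsupp.support_add (g₁ := u) (g₂ := v))).trans (Finset.card_union_le _ _)
  have := hf u hu
  have := hg v hv
  omega

theorem card_support_blockPoly (I : Finset ℕ) (α β : ℕ → ℝ) :
    ∀ m ∈ (blockPoly I α β).support, m.support.card ≤ 1 := by
  intro m hm
  rw [blockPoly_eq] at hm
  obtain ⟨i, hi, rfl⟩ := Finset.mem_image.mp (support_sum_monomial_subset _ _ _ hm)
  exact (Finset.card_le_card Finsupp.support_single_subset).trans (by simp)

theorem card_support_blockPoly_pow (I : Finset ℕ) (α β : ℕ → ℝ) (q : ℕ) :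
    ∀ m ∈ (blockPoly I α β ^ q).support, m.support.card ≤ q := by
  induction q with
  | zero =>
    intro m hm
    rw [pow_zero] at hm
    have := MvPolynomial.support_one.subset hm
    rw [Finset.mem_singleton] at this
    simp [this]
  | succ q ih =>
    rw [pow_succ]
    exact card_support_mul_le ih (card_support_blockPoly I α β)

theorem coeffNormSq_blockPoly_pow_le (I : Finset ℕ) (α β : ℕ → ℝ) {W : ℝ}
    (hW : ∑ p ∈ I, (α p ^ 2 + β p ^ 2) ≤ W) (q : ℕ) :
    coeffNormSq (blockPoly I α β ^ q) ≤ (2 * W) ^ q * (q.factorial : ℝ) := by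
  have hW0 : 0 ≤ W := le_trans (Finset.sum_nonneg fun p _ => by positivity) hW
  induction q with
  | zero => simp [coeffNormSq_one]
  | succ q ih =>
    rw [pow_succ']
    refine (coeffNormSq_blockPoly_mul_le I α β (card_support_blockPoly_pow I α β q)).trans ?_
    calc _ ≤ (2 * ((q:ℝ) + 1)) * (W * ((2 * W) ^ q * (q.factorial : ℝ))) := by
          have := coeffNormSq_nonneg (blockPoly I α β ^ q)
          gcongr
      _ = _ := by
          rw [Nat.factorial_succ]
          push_cast
          ring

theorem coeffNormSq_sum_C_mul_le (n : ℕ) (b : ℕ → ℝ) (f : ℕ → MvPolynomial ℕ ℝ) :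
    coeffNormSq (∑ q ∈ Finset.range n, MvPolynomial.C (b q) * f q) ≤
      2 * ∑ q ∈ Finset.range n, 2 ^ q * b q ^ 2 * coeffNormSq (f q) := by
  set F := ∑ q ∈ Finset.range n, MvPolynomial.C (b q) * f q with hF
  have h : ∀ m ∈ F.support, F.coeff m ^ 2 ≤
      2 * ∑ q ∈ Finset.range n, 2 ^ q * b q ^ 2 * (f q).coeff m ^ 2 := by
    intro m _
    have e : F.coeff m = ∑ q ∈ Finset.range n, b q * (f q).coeff m := by
      rw [hF, MvPolynomial.coeff_sum]
      exact Finset.sum_congr rfl fun q _ => MvPolynomial.coeff_C_mul _ _ _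
    rw [e]
    have cs := Finset.sum_sq_le_sum_mul_sum_of_sq_le_mul (Finset.range n)
      (r := fun q => b q * (f q).coeff m) (f := fun q => (1 / 2 : ℝ) ^ q)
      (g := fun q => 2 ^ q * b q ^ 2 * (f q).coeff m ^ 2)
      (fun q _ => by positivity) (fun q _ => by positivity) (fun q _ => by
        refine le_of_eq ?_
        have : (1 / 2 : ℝ) ^ q * 2 ^ q = 1 := by rw [← mul_pow]; norm_num
        calc _ = ((1 / 2 : ℝ) ^ q * 2 ^ q) * (b q ^ 2 * (f q).coeff m ^ 2) := by rw [this]; ring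
          _ = _ := by ring)
    refine cs.trans ?_
    have h2 : ∑ q ∈ Finset.range n, (1 / 2 : ℝ) ^ q ≤ 2 := by
      have := (summable_geometric_two).sum_le_tsum (Finset.range n) (fun i _ => by positivity)
      rwa [tsum_geometric_two] at this
    exact mul_le_mul_of_nonneg_right h2 (Finset.sum_nonneg fun q _ => by positivity)
  refine (Finset.sum_le_sum h).trans ?_
  rw [← Finset.mul_sum, Finset.sum_comm]
  refine mul_le_mul_of_nonneg_left (Finset.sum_le_sum fun q _ => ?_) zero_le_two
  rw [← Finset.mul_sum]
  exact mul_le_mul_of_nonneg_left (sum_coeff_sq_le (f q) _) (by positivity)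

/-- The polynomial `(1 + z/ℓ)^ℓ` where `z` is the block polynomial. -/
noncomputable def blockRes (I : Finset ℕ) (α β : ℕ → ℝ) (l : ℕ) : MvPolynomial ℕ ℝ :=
  (1 + MvPolynomial.C (1 / (l:ℝ)) * blockPoly I α β) ^ l

theorem blockRes_eq (I : Finset ℕ) (α β : ℕ → ℝ) (l : ℕ) : blockRes I α β l =
    ∑ q ∈ Finset.range (l + 1), MvPolynomial.C ((l.choose q : ℝ) / (l:ℝ) ^ q) * blockPoly I α β ^ q := by
  unfold blockRes
  rw [add_comm, add_pow]
  refine Finset.sum_congr rfl fun q _ => ?_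
  rw [one_pow, mul_one, mul_pow, ← MvPolynomial.C_pow, mul_right_comm, ← MvPolynomial.C_eq_coe_nat,
    ← MvPolynomial.C_mul]
  congr 2
  rw [one_div, inv_pow]
  ring

theorem choose_div_pow_le (l q : ℕ) : (l.choose q : ℝ) / (l:ℝ) ^ q ≤ 1 / (q.factorial : ℝ) := by
  rcases Nat.eq_zero_or_pos l with rfl | hl
  · rcases Nat.eq_zero_or_pos q with rfl | hq
    · simp
    · rw [Nat.choose_eq_zero_of_lt hq]
      simp
  · rw [div_le_div_iff₀ (by positivity) (by positivity), one_mul]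
    have := Nat.choose_le_pow_div (α := ℝ) q l
    rwa [le_div_iff₀ (by positivity)] at this

theorem coeffNormSq_blockRes_mul_le (I : Finset ℕ) (α β : ℕ → ℝ) {W : ℝ}
    (hW : ∑ p ∈ I, (α p ^ 2 + β p ^ 2) ≤ W) (l : ℕ) :
    coeffNormSq (blockRes I α β l * blockPoly I α β) ≤ 4 * W * Real.exp (8 * W) := by
  have hW0 : 0 ≤ W := le_trans (Finset.sum_nonneg fun p _ => by positivity) hW
  rw [blockRes_eq, Finset.sum_mul]
  have e : ∀ q ∈ Finset.range (l + 1),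
      MvPolynomial.C ((l.choose q : ℝ) / (l:ℝ) ^ q) * blockPoly I α β ^ q * blockPoly I α β =
      MvPolynomial.C ((l.choose q : ℝ) / (l:ℝ) ^ q) * blockPoly I α β ^ (q + 1) := fun q _ => by
    rw [pow_succ, mul_assoc]
  rw [Finset.sum_congr rfl e]
  refine (coeffNormSq_sum_C_mul_le _ (fun q => (l.choose q : ℝ) / (l:ℝ) ^ q) (fun q => blockPoly I α β ^ (q + 1))).trans ?_
  have h : ∀ q ∈ Finset.range (l + 1), 2 ^ q * ((l.choose q : ℝ) / (l:ℝ) ^ q) ^ 2 *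
      coeffNormSq (blockPoly I α β ^ (q + 1)) ≤ 2 * W * ((8 * W) ^ q / (q.factorial : ℝ)) := by
    intro q _
    have h1 := choose_div_pow_le l q
    have h2 := coeffNormSq_blockPoly_pow_le I α β hW (q + 1)
    have h3 : ((q:ℝ) + 1) ≤ 2 ^ q := by
      have := Nat.lt_two_pow_self (n := q)
      exact_mod_cast this
    have h4 := coeffNormSq_nonneg (blockPoly I α β ^ (q + 1))
    calc _ ≤ 2 ^ q * (1 / (q.factorial : ℝ)) ^ 2 * ((2 * W) ^ (q + 1) * ((q + 1).factorial : ℝ)) := by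
          gcongr
      _ = (4 * W) ^ q * (2 * W) * ((q:ℝ) + 1) / (q.factorial : ℝ) := by
          rw [Nat.factorial_succ]
          push_cast
          have : (q.factorial : ℝ) ≠ 0 := by positivity
          have e4 : (4 * W) ^ q = 2 ^ q * (2 * W) ^ q := by rw [← mul_pow]; congr 1; ring
          rw [e4]
          field_simp
          ring
      _ ≤ (4 * W) ^ q * (2 * W) * 2 ^ q / (q.factorial : ℝ) := by gcongr
      _ = _ := by
          have e8 : (8 * W) ^ q = (4 * W) ^ q * 2 ^ q := by rw [← mul_pow]; congr 1; ring
          rw [e8]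
          ring
  have h2 := Finset.sum_le_sum h
  rw [← Finset.mul_sum] at h2
  have h3 := Real.sum_le_exp_of_nonneg (by positivity : 0 ≤ 8 * W) (l + 1)
  calc _ ≤ 2 * (2 * W * ∑ q ∈ Finset.range (l + 1), (8 * W) ^ q / (q.factorial : ℝ)) := by gcongr
    _ ≤ 2 * (2 * W * Real.exp (8 * W)) := by gcongr
    _ = _ := by ring

/-- The squarefree exponent vector supported on `s`. -/
noncomputable def sqfreeExp (s : Finset ℕ) : ℕ →₀ ℕ := Finsupp.indicator s fun _ _ => 1

theorem sqfreeExp_apply (s : Finset ℕ) (p : ℕ) : sqfreeExp s p = if p ∈ s then 1 else 0 := by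
  unfold sqfreeExp
  rw [Finsupp.indicator_apply]
  simp

theorem sqfreeExp_injective : Function.Injective sqfreeExp := by
  intro s t h
  ext p
  have := DFunLike.congr_fun h p
  rw [sqfreeExp_apply, sqfreeExp_apply] at this
  by_cases h1 : p ∈ s <;> by_cases h2 : p ∈ t <;> simp_all

theorem coeff_sqfreeExp_blockPoly_mul (I : Finset ℕ) (α β : ℕ → ℝ) (f : MvPolynomial ℕ ℝ)
    {s : Finset ℕ} (hs : s ⊆ I) : (blockPoly I α β * f).coeff (sqfreeExp s) =
      ∑ p ∈ s, α p * f.coeff (sqfreeExp (s.erase p)) := by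
  unfold blockPoly
  rw [Finset.sum_mul, MvPolynomial.coeff_sum]
  symm
  refine Finset.sum_subset_zero_on_sdiff hs ?_ ?_
  · intro p hp
    have hps := (Finset.mem_sdiff.mp hp).2
    rw [add_mul, MvPolynomial.coeff_add, MvPolynomial.coeff_monomial_mul', MvPolynomial.coeff_monomial_mul',
      if_neg, if_neg, add_zero]
    · rw [Finsupp.single_le_iff, sqfreeExp_apply, if_neg hps]
      norm_num
    · rw [Finsupp.single_le_iff, sqfreeExp_apply, if_neg hps]
      norm_num
  · intro p hp
    rw [add_mul, MvPolynomial.coeff_add, MvPolynomial.coeff_monomial_mul', MvPolynomial.coeff_monomial_mul',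
      if_pos, if_neg, add_zero]
    · congr 2
      ext r
      rw [Finsupp.tsub_apply, sqfreeExp_apply, sqfreeExp_apply, Finsupp.single_apply]
      by_cases h : p = r
      · subst h; simp [hp]
      · have : r ≠ p := fun e => h e.symm
        simp [h, this]
    · rw [Finsupp.single_le_iff, sqfreeExp_apply, if_pos hp]
      norm_num
    · rw [Finsupp.single_le_iff, sqfreeExp_apply, if_pos hp]

theorem coeff_sqfreeExp_blockPoly_pow (I : Finset ℕ) (α β : ℕ → ℝ) (q : ℕ) {s : Finset ℕ} (hs : s ⊆ I) :
    (blockPoly I α β ^ q).coeff (sqfreeExp s) =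
      if s.card = q then (q.factorial : ℝ) * ∏ p ∈ s, α p else 0 := by
  induction q generalizing s with
  | zero =>
    rw [pow_zero, MvPolynomial.coeff_one]
    by_cases h : s = ∅
    · subst h
      have : sqfreeExp ∅ = 0 := by ext p; rw [sqfreeExp_apply]; simp
      simp [this]
    · rw [if_neg, if_neg]
      · simpa using h
      · intro h0
        apply h
        have : sqfreeExp ∅ = 0 := by ext p; rw [sqfreeExp_apply]; simp
        exact sqfreeExp_injective (by rw [← h0, this])
  | succ q ih =>
    rw [pow_succ', coeff_sqfreeExp_blockPoly_mul I α β _ hs]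
    have h : ∀ p ∈ s, α p * (blockPoly I α β ^ q).coeff (sqfreeExp (s.erase p)) =
        if s.card = q + 1 then (q.factorial : ℝ) * ∏ p ∈ s, α p else 0 := by
      intro p hp
      rw [ih ((Finset.erase_subset p s).trans hs), Finset.card_erase_of_mem hp]
      have hc : 0 < s.card := Finset.card_pos.mpr ⟨p, hp⟩
      by_cases h1 : s.card = q + 1
      · rw [if_pos h1, if_pos (by omega), ← Finset.mul_prod_erase s α hp]
        ring
      · rw [if_neg h1, if_neg (by omega), mul_zero]
    rw [Finset.sum_congr rfl h, Finset.sum_const, nsmul_eq_mul]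
    by_cases h1 : s.card = q + 1
    · rw [if_pos h1, if_pos h1, h1, Nat.factorial_succ]
      push_cast
      ring
    · rw [if_neg h1, if_neg h1, mul_zero]

theorem coeff_sqfreeExp_blockRes (I : Finset ℕ) (α β : ℕ → ℝ) (l : ℕ) {s : Finset ℕ} (hs : s ⊆ I) :
    (blockRes I α β l).coeff (sqfreeExp s) =
      (l.descFactorial s.card : ℝ) / (l:ℝ) ^ s.card * ∏ p ∈ s, α p := by
  rw [blockRes_eq, MvPolynomial.coeff_sum]
  simp only [MvPolynomial.coeff_C_mul, coeff_sqfreeExp_blockPoly_pow I α β _ hs, mul_ite, mul_zero]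
  rw [Finset.sum_ite_eq]
  rw [Nat.descFactorial_eq_factorial_mul_choose]
  by_cases h : s.card ∈ Finset.range (l + 1)
  · rw [if_pos h]
    push_cast
    ring
  · rw [if_neg h]
    rw [Finset.mem_range, not_lt] at h
    rw [Nat.choose_eq_zero_of_lt (by omega)]
    simp

theorem descFactorial_div_pow_ge {l : ℕ} (hl : 0 < l) (m : ℕ) :
    0 ≤ (l.descFactorial m : ℝ) / (l:ℝ) ^ m ∧ (l.descFactorial m : ℝ) / (l:ℝ) ^ m ≤ 1 ∧
      1 - (m:ℝ) ^ 2 / (2 * l) ≤ (l.descFactorial m : ℝ) / (l:ℝ) ^ m := by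
  have hl0 : (0:ℝ) < l := by exact_mod_cast hl
  induction m with
  | zero => simp
  | succ m ih =>
    obtain ⟨h0, h1, h2⟩ := ih
    set r := (l.descFactorial m : ℝ) / (l:ℝ) ^ m with hr
    by_cases hm : m ≤ l
    · have e : (l.descFactorial (m + 1) : ℝ) / (l:ℝ) ^ (m + 1) = r * (1 - m / l) := by
        rw [hr, Nat.descFactorial_succ, pow_succ]
        push_cast [Nat.cast_sub hm]
        field_simp
      have hm' : (m:ℝ) / l ≤ 1 := (div_le_one hl0).mpr (by exact_mod_cast hm)
      have hm0 : 0 ≤ (m:ℝ) / l := by positivity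
      rw [e]
      refine ⟨mul_nonneg h0 (by linarith), mul_le_one₀ h1 (by linarith) (by linarith), ?_⟩
      have : ((m + 1 : ℕ) : ℝ) ^ 2 / (2 * l) = (m:ℝ) ^ 2 / (2 * l) + m / l + 1 / (2 * l) := by
        push_cast
        field_simp
        ring
      rw [this]
      have h3 : 0 ≤ 1 / (2 * (l:ℝ)) := by positivity
      have h4 : r * (m / l) ≤ m / l := mul_le_of_le_one_left hm0 h1
      linarith
    · rw [Nat.descFactorial_eq_zero_iff_lt.mpr (by omega)]
      refine ⟨by simp, by simp, ?_⟩
      rw [Nat.cast_zero, zero_div, sub_nonpos, one_le_div (by positivity)]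
      have a1 : (l:ℝ) + 1 ≤ m := by exact_mod_cast (by omega : l + 1 ≤ m)
      push_cast
      nlinarith

theorem sq_le_two_mul_two_pow (m : ℕ) : (m:ℝ) ^ 2 ≤ 2 * 2 ^ m := by
  have : m ^ 2 ≤ 2 * 2 ^ m := by
    rcases Nat.lt_or_ge m 4 with h | h
    · interval_cases m <;> norm_num
    · induction m, h using Nat.le_induction with
      | base => norm_num
      | succ n hn ih =>
        have : 2 ^ (n + 1) = 2 * 2 ^ n := pow_succ' 2 n
        nlinarith
  exact_mod_cast this

theorem coeffNormSq_blockRes_ge (I : Finset ℕ) (α β : ℕ → ℝ) {W : ℝ}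
    (hW : ∑ p ∈ I, (α p ^ 2 + β p ^ 2) ≤ W) {l : ℕ} (hl : 0 < l) :
    (∏ p ∈ I, (1 + α p ^ 2)) * (1 - 2 * Real.exp (2 * W) / l) ≤ coeffNormSq (blockRes I α β l) ∧
      1 ≤ coeffNormSq (blockRes I α β l) := by
  have hl0 : (0:ℝ) < l := by exact_mod_cast hl
  have hS := sum_coeff_sq_le (blockRes I α β l) (I.powerset.image sqfreeExp)
  rw [Finset.sum_image fun a _ b _ h => sqfreeExp_injective h] at hS
  have hE : ∀ s ∈ I.powerset, ((∏ p ∈ s, α p ^ 2) - (∏ p ∈ s, 2 * α p ^ 2) * (2 / l)) ≤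
      (blockRes I α β l).coeff (sqfreeExp s) ^ 2 := by
    intro s hs
    rw [coeff_sqfreeExp_blockRes I α β l (Finset.mem_powerset.mp hs), mul_pow, ← Finset.prod_pow,
      Finset.prod_mul_distrib, Finset.prod_const]
    obtain ⟨h0, h1, h2⟩ := descFactorial_div_pow_ge hl s.card
    have hP : 0 ≤ ∏ p ∈ s, α p ^ 2 := Finset.prod_nonneg fun p _ => sq_nonneg _
    have h3 := sq_le_two_mul_two_pow s.card
    have h4 : (s.card : ℝ) ^ 2 / l ≤ 2 * 2 ^ s.card / l := by gcongr
    have h5 : (s.card : ℝ) ^ 2 / l = 2 * ((s.card : ℝ) ^ 2 / (2 * l)) := by field_simp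
    set r := (l.descFactorial s.card : ℝ) / (l:ℝ) ^ s.card
    have h6 : 1 - 2 * 2 ^ s.card / l ≤ r ^ 2 := by nlinarith [sq_nonneg (1 - r)]
    calc _ = (1 - 2 * 2 ^ s.card / l) * ∏ p ∈ s, α p ^ 2 := by ring
      _ ≤ _ := mul_le_mul_of_nonneg_right h6 hP
  constructor
  · have h1 := (Finset.sum_le_sum hE).trans hS
    rw [Finset.sum_sub_distrib, ← Finset.sum_mul, ← Finset.prod_one_add, ← Finset.prod_one_add] at h1
    refine le_trans ?_ h1
    have h2 : ∏ p ∈ I, (1 + 2 * α p ^ 2) ≤ Real.exp (2 * W) := by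
      calc _ ≤ ∏ p ∈ I, Real.exp (2 * α p ^ 2) := by
            refine Finset.prod_le_prod (fun p _ => by positivity) fun p _ => ?_
            have := Real.add_one_le_exp (2 * α p ^ 2)
            linarith
        _ = Real.exp (∑ p ∈ I, 2 * α p ^ 2) := (Real.exp_sum _ _).symm
        _ ≤ _ := by
            refine Real.exp_le_exp.mpr ?_
            rw [← Finset.mul_sum]
            refine mul_le_mul_of_nonneg_left (le_trans (Finset.sum_le_sum fun p _ => ?_) hW) zero_le_two
            nlinarith [sq_nonneg (β p)]
    have h3 : 1 ≤ ∏ p ∈ I, (1 + α p ^ 2) := by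
      refine (Finset.prod_const_one (s := I)).symm.trans_le ?_
      exact Finset.prod_le_prod (fun _ _ => zero_le_one) fun p _ => by nlinarith [sq_nonneg (α p)]
    have h4 : (∏ p ∈ I, (1 + 2 * α p ^ 2)) * (2 / l) ≤ Real.exp (2 * W) * (2 / l) := by gcongr
    have h5 : 1 * (Real.exp (2 * W) * (2 / l)) ≤ (∏ p ∈ I, (1 + α p ^ 2)) * (Real.exp (2 * W) * (2 / l)) := by
      gcongr
    have e : 2 * Real.exp (2 * W) / l = Real.exp (2 * W) * (2 / l) := by ring
    rw [e, mul_sub]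
    linarith
  · refine le_trans ?_ (sum_coeff_sq_le (blockRes I α β l) {sqfreeExp ∅})
    rw [Finset.sum_singleton, coeff_sqfreeExp_blockRes I α β l (Finset.empty_subset I)]
    simp

/-- Evaluation of a polynomial in the prime variables at `p ↦ p^{-iγ}`. -/
noncomputable def evalT (γ : ℝ) : MvPolynomial ℕ ℝ →ₐ[ℝ] ℂ :=
  MvPolynomial.aeval fun p : ℕ => cexp ((-(γ * Real.log p) : ℝ) * I)

/-- The natural number with exponent vector `m`. -/
def expNat (m : ℕ →₀ ℕ) : ℕ := m.prod fun p e => p ^ e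

/-- All monomials of `f` have logarithmic length at most `B` and involve only primes. -/
def HasLength (f : MvPolynomial ℕ ℝ) (B : ℝ) : Prop :=
  ∀ m ∈ f.support, (∀ p ∈ m.support, p.Prime) ∧ (m.sum fun p e => (e : ℝ) * Real.log p) ≤ B

theorem HasLength.mul {f g : MvPolynomial ℕ ℝ} {A B : ℝ} (hf : HasLength f A) (hg : HasLength g B) :
    HasLength (f * g) (A + B) := by
  intro m hm
  obtain ⟨u, hu, v, hv, rfl⟩ := Finset.mem_add.mp (MvPolynomial.support_mul f g hm)
  refine ⟨fun p hp => ?_, ?_⟩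
  · rcases Finset.mem_union.mp (Finsupp.support_add hp) with h | h
    · exact (hf u hu).1 p h
    · exact (hg v hv).1 p h
  · rw [Finsupp.sum_add_index' (by simp) (by intro a b c; push_cast; ring)]
    exact add_le_add (hf u hu).2 (hg v hv).2

theorem hasLength_one : HasLength 1 0 := by
  intro m hm
  have : m = 0 := by
    rw [MvPolynomial.mem_support_iff, MvPolynomial.coeff_one] at hm
    by_contra h
    exact hm (if_neg fun h' => h h'.symm)
  subst this
  simp

theorem HasLength.pow {f : MvPolynomial ℕ ℝ} {A : ℝ} (hf : HasLength f A) (n : ℕ) :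
    HasLength (f ^ n) (n * A) := by
  induction n with
  | zero => simpa using hasLength_one
  | succ n ih =>
    rw [pow_succ]
    have := ih.mul hf
    have e : ((n + 1 : ℕ) : ℝ) * A = n * A + A := by push_cast; ring
    rwa [e]

theorem HasLength.prod {ι : Type*} [DecidableEq ι] (s : Finset ι) (f : ι → MvPolynomial ℕ ℝ) (A : ι → ℝ)
    (hf : ∀ i ∈ s, HasLength (f i) (A i)) : HasLength (∏ i ∈ s, f i) (∑ i ∈ s, A i) := by
  induction s using Finset.induction_on with
  | empty => simpa using hasLength_one
  | insert a s ha ih =>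
    rw [Finset.prod_insert ha, Finset.sum_insert ha]
    exact (hf a (Finset.mem_insert_self _ _)).mul (ih fun i hi => hf i (Finset.mem_insert_of_mem hi))

theorem HasLength.mono {f : MvPolynomial ℕ ℝ} {A B : ℝ} (hf : HasLength f A) (h : A ≤ B) : HasLength f B :=
  fun m hm => ⟨(hf m hm).1, (hf m hm).2.trans h⟩

theorem hasLength_blockPoly {I : Finset ℕ} (hI : ∀ p ∈ I, p.Prime) (α β : ℕ → ℝ) {B : ℝ}
    (hB : ∀ p ∈ I, 2 * Real.log p ≤ B) : HasLength (blockPoly I α β) B := by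
  intro m hm
  rw [blockPoly_eq] at hm
  obtain ⟨i, hi, rfl⟩ := Finset.mem_image.mp (support_sum_monomial_subset _ _ _ hm)
  obtain ⟨h1, h2⟩ := Finset.mem_product.mp hi
  refine ⟨fun p hp => ?_, ?_⟩
  · have := Finsupp.support_single_subset hp
    rw [Finset.mem_singleton] at this
    exact this ▸ hI _ h1
  · rw [Finsupp.sum_single_index (by simp)]
    have h3 : (i.2 : ℝ) ≤ 2 := by
      rw [Finset.mem_insert, Finset.mem_singleton] at h2
      rcases h2 with h | h <;> rw [h] <;> norm_num
    refine le_trans (mul_le_mul_of_nonneg_right h3 (Real.log_natCast_nonneg _)) (hB _ h1)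

theorem hasLength_blockRes {I : Finset ℕ} (hI : ∀ p ∈ I, p.Prime) (α β : ℕ → ℝ) {B : ℝ} (hB0 : 0 ≤ B)
    (hB : ∀ p ∈ I, 2 * Real.log p ≤ B) (l : ℕ) : HasLength (blockRes I α β l) (l * B) := by
  refine HasLength.pow ?_ l
  intro m hm
  have h1 := MvPolynomial.support_add hm
  rcases Finset.mem_union.mp h1 with h | h
  · exact (hasLength_one.mono hB0) m h
  · rw [← MvPolynomial.smul_eq_C_mul] at h
    exact hasLength_blockPoly hI α β hB m (MvPolynomial.support_smul h)

theorem expNat_pos {m : ℕ →₀ ℕ} (hm : ∀ p ∈ m.support, p.Prime) : 0 < expNat m :=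
  Finset.prod_pos fun p hp => pow_pos (hm p hp).pos _

theorem log_expNat {m : ℕ →₀ ℕ} (hm : ∀ p ∈ m.support, p.Prime) :
    Real.log (expNat m) = m.sum fun p e => (e : ℝ) * Real.log p := by
  unfold expNat Finsupp.prod Finsupp.sum
  rw [Nat.cast_prod, Real.log_prod (fun p hp => by
    have := (hm p hp).pos
    positivity)]
  refine Finset.sum_congr rfl fun p _ => ?_
  rw [Nat.cast_pow, Real.log_pow]

theorem expNat_inj {m n : ℕ →₀ ℕ} (hm : ∀ p ∈ m.support, p.Prime) (hn : ∀ p ∈ n.support, p.Prime)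
    (h : expNat m = expNat n) : m = n := by
  rw [← Nat.prod_pow_factorization_eq_self hm, ← Nat.prod_pow_factorization_eq_self hn]
  exact congrArg Nat.factorization h

theorem evalT_monomial (γ : ℝ) (m : ℕ →₀ ℕ) (c : ℝ) (hm : ∀ p ∈ m.support, p.Prime) :
    evalT γ (MvPolynomial.monomial m c) = (c:ℂ) * cexp ((-(γ * Real.log (expNat m)) : ℝ) * I) := by
  unfold evalT
  rw [MvPolynomial.aeval_monomial, log_expNat hm]
  congr 1
  unfold Finsupp.prod Finsupp.sum
  rw [Finset.mul_sum, ← Finset.sum_neg_distrib, ofReal_sum, Finset.sum_mul, Complex.exp_sum]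
  refine Finset.prod_congr rfl fun p _ => ?_
  beta_reduce
  rw [← Complex.exp_nat_mul]
  congr 1
  push_cast
  ring

theorem exists_dirVal_eq_evalT {f : MvPolynomial ℕ ℝ} {B Y : ℝ} (hf : HasLength f B) (hB : Real.exp B ≤ Y) :
    ∃ (S : Finset ℕ) (b : ℕ → ℝ), S ⊆ Finset.Icc 1 ⌊Y⌋₊ ∧ (∑ n ∈ S, b n ^ 2 = coeffNormSq f) ∧
      ∀ γ : ℝ, dirVal S b γ = evalT γ f := by
  have hinj : Set.InjOn expNat f.support := fun m hm n hn h => expNat_inj (hf m hm).1 (hf n hn).1 h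
  refine ⟨f.support.image expNat, fun n => f.coeff n.factorization, ?_, ?_, ?_⟩
  · intro n hn
    obtain ⟨m, hm, rfl⟩ := Finset.mem_image.mp hn
    have hp := expNat_pos (hf m hm).1
    rw [Finset.mem_Icc]
    refine ⟨hp, Nat.le_floor ?_⟩
    refine le_trans ?_ hB
    rw [← Real.log_le_iff_le_exp (by exact_mod_cast hp), log_expNat (hf m hm).1]
    exact (hf m hm).2
  · rw [Finset.sum_image hinj]
    refine Finset.sum_congr rfl fun m hm => ?_
    unfold expNat
    beta_reduce
    rw [Nat.prod_pow_factorization_eq_self (hf m hm).1]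
  · intro γ
    unfold dirVal
    rw [Finset.sum_image hinj]
    conv_rhs => rw [MvPolynomial.as_sum f, map_sum]
    refine Finset.sum_congr rfl fun m hm => ?_
    rw [evalT_monomial _ _ _ (hf m hm).1]
    congr 3
    unfold expNat
    beta_reduce
    rw [Nat.prod_pow_factorization_eq_self (hf m hm).1]

theorem evalT_blockPoly_re (γ : ℝ) (I : Finset ℕ) (α β : ℕ → ℝ) :
    (evalT γ (blockPoly I α β)).re =
      ∑ p ∈ I, (α p * Real.cos (γ * Real.log p) + β p * Real.cos (γ * (2 * Real.log p))) := by
  unfold blockPoly evalT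
  rw [map_sum, re_sum]
  refine Finset.sum_congr rfl fun p _ => ?_
  rw [map_add, MvPolynomial.aeval_monomial, MvPolynomial.aeval_monomial, Finsupp.prod_single_index (by simp),
    Finsupp.prod_single_index (by simp), pow_one, ← Complex.exp_nat_mul, add_re]
  congr 1
  · rw [Complex.coe_algebraMap, re_ofReal_mul, Complex.exp_ofReal_mul_I_re, Real.cos_neg]
  · rw [Complex.coe_algebraMap, re_ofReal_mul, ← mul_assoc]
    have : ((2:ℕ):ℂ) * ((-(γ * Real.log p) : ℝ) : ℂ) = ((-(γ * (2 * Real.log p)) : ℝ) : ℂ) := by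
      push_cast
      ring
    rw [this, Complex.exp_ofReal_mul_I_re, Real.cos_neg]

theorem norm_one_add_sq_le (w : ℂ) : ‖1 + w‖ ^ 2 ≤ Real.exp (2 * w.re + ‖w‖ ^ 2) := by
  have h : ‖1 + w‖ ^ 2 = 1 + 2 * w.re + ‖w‖ ^ 2 := by
    rw [← Complex.normSq_eq_norm_sq, ← Complex.normSq_eq_norm_sq, Complex.normSq_apply, Complex.normSq_apply]
    simp only [add_re, one_re, add_im, one_im]
    ring
  rw [h]
  have := Real.add_one_le_exp (2 * w.re + ‖w‖ ^ 2)
  linarith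

theorem norm_evalT_blockRes_sq_le (γ : ℝ) (I : Finset ℕ) (α β : ℕ → ℝ) {l : ℕ} (hl : 0 < l) :
    ‖evalT γ (blockRes I α β l)‖ ^ 2 ≤
      Real.exp (2 * (evalT γ (blockPoly I α β)).re + ‖evalT γ (blockPoly I α β)‖ ^ 2 / l) := by
  have hl0 : (0:ℝ) < l := by exact_mod_cast hl
  unfold blockRes
  rw [map_pow, map_add, map_one, map_mul, norm_pow, ← pow_mul, mul_comm l 2, pow_mul]
  have e : evalT γ (MvPolynomial.C (1 / (l:ℝ))) = ((1 / (l:ℝ) : ℝ) : ℂ) := by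
    unfold evalT
    rw [MvPolynomial.aeval_C, Complex.coe_algebraMap]
  rw [e]
  set z := evalT γ (blockPoly I α β)
  refine (pow_le_pow_left₀ (by positivity) (norm_one_add_sq_le _) l).trans (le_of_eq ?_)
  rw [← Real.exp_nat_mul, re_ofReal_mul, norm_mul, Complex.norm_real, Real.norm_of_nonneg (by positivity)]
  congr 1
  field_simp

theorem sum_log_div_primes_le {N : ℕ} (hN : 0 < N) {S : Finset ℕ} (hS : S ⊆ Finset.Icc 1 N)
    (hp : ∀ p ∈ S, p.Prime) : ∑ p ∈ S, Real.log p / p ≤ Real.log N + (Real.log 4 + 4) := by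
  refine le_trans ?_ (sum_vonMangoldt_div_le hN)
  have e : ∀ p ∈ S, Real.log p / p = ArithmeticFunction.vonMangoldt p / p := fun p h => by
    rw [ArithmeticFunction.vonMangoldt_apply_prime (hp p h)]
  rw [Finset.sum_congr rfl e]
  exact Finset.sum_le_sum_of_subset_of_nonneg hS fun n _ _ =>
    div_nonneg ArithmeticFunction.vonMangoldt_nonneg (Nat.cast_nonneg n)

theorem sum_inv_sq_le_tsum (S : Finset ℕ) :
    ∑ p ∈ S, 1 / (p:ℝ) ^ 2 ≤ ∑' n : ℕ, 1 / (n:ℝ) ^ 2 :=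
  (Real.summable_one_div_nat_pow.mpr one_lt_two).sum_le_tsum S fun _ _ => by positivity

theorem log_log_le_sum_inv_primes {M : ℕ} (hM : 2 ≤ M) :
    Real.log (Real.log M) ≤ ∑ p ∈ (Finset.Icc 1 M).filter Nat.Prime, 1 / (p:ℝ) +
      2 * ∑' n : ℕ, 1 / (n:ℝ) ^ 2 := by
  let f : ℕ →* ℝ := ⟨⟨fun n => (n:ℝ)⁻¹, by simp⟩, fun a b => by push_cast; rw [mul_inv]⟩
  have hf : ∀ n : ℕ, f n = (n:ℝ)⁻¹ := fun n => rfl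
  have h1 : ∀ {p : ℕ}, p.Prime → ‖f p‖ < 1 := fun {p} hp => by
    rw [hf, Real.norm_of_nonneg (by positivity)]
    exact inv_lt_one_of_one_lt₀ (by exact_mod_cast hp.one_lt)
  have hs := EulerProduct.summable_and_hasSum_smoothNumbers_prod_primesBelow_geometric h1 (M + 1)
  have h2 : ∑ n ∈ Finset.Icc 1 M, (n:ℝ)⁻¹ ≤ ∏ p ∈ (M + 1).primesBelow, (1 - f p)⁻¹ := by
    let g : {n // n ∈ Finset.Icc 1 M} → (M + 1).smoothNumbers := fun n => ⟨n, by
      have := Finset.mem_Icc.mp n.2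
      exact Nat.mem_smoothNumbers_of_lt (by omega) (by omega)⟩
    have hg : Function.Injective g := fun a b h => Subtype.ext (show (g a : ℕ) = g b from congrArg _ h)
    have h3 := hs.2.summable.sum_le_tsum (Finset.univ.map ⟨g, hg⟩) (fun n _ => by
      rw [hf]; positivity)
    rw [hs.2.tsum_eq, Finset.sum_map] at h3
    refine le_trans (le_of_eq ?_) h3
    rw [← Finset.sum_coe_sort]
    rfl
  have h4 : Real.log M ≤ ∑ n ∈ Finset.Icc 1 M, (n:ℝ)⁻¹ := by
    have h5 := log_add_one_le_harmonic M
    rw [harmonic_eq_sum_Icc] at h5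
    push_cast at h5
    refine le_trans (Real.log_le_log (by positivity) (by linarith)) h5
  have e : (M + 1).primesBelow = (Finset.Icc 1 M).filter Nat.Prime := by
    ext p
    rw [Nat.primesBelow, Finset.mem_filter, Finset.mem_filter, Finset.mem_range, Finset.mem_Icc]
    constructor
    · rintro ⟨a, b⟩; exact ⟨⟨b.pos, by omega⟩, b⟩
    · rintro ⟨a, b⟩; exact ⟨by omega, b⟩
  rw [e] at h2
  have h5 : ∏ p ∈ (Finset.Icc 1 M).filter Nat.Prime, (1 - f p)⁻¹ ≤
      Real.exp (∑ p ∈ (Finset.Icc 1 M).filter Nat.Prime, (1 / (p:ℝ) + 2 * (1 / (p:ℝ) ^ 2))) := by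
    rw [Real.exp_sum]
    have key : ∀ p : ℕ, p.Prime → 0 ≤ (1 - f p)⁻¹ ∧
        (1 - f p)⁻¹ ≤ Real.exp (1 / (p:ℝ) + 2 * (1 / (p:ℝ) ^ 2)) := by
      intro p hp
      have e1 : 2 * (1 / (p:ℝ) ^ 2) = 2 * (1 / (p:ℝ)) ^ 2 := by rw [div_pow, one_pow]
      rw [hf, e1, ← one_div (p:ℝ)]
      have hx : 1 / (p:ℝ) ≤ 1 / 2 := one_div_le_one_div_of_le two_pos (by exact_mod_cast hp.two_le)
      have hx0 : 0 ≤ 1 / (p:ℝ) := by positivity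
      set x := 1 / (p:ℝ)
      have hx1 : 0 < 1 - x := by linarith
      refine ⟨inv_nonneg.mpr hx1.le, ?_⟩
      rw [inv_le_iff_one_le_mul₀ (show 0 < 1 - x by linarith)]
      have h6 := Real.add_one_le_exp (x + 2 * x ^ 2)
      have h7 : 1 ≤ (x + 2 * x ^ 2 + 1) * (1 - x) := by nlinarith [mul_nonneg (sq_nonneg x) (by linarith : 0 ≤ 1 - 2 * x)]
      exact h7.trans (mul_le_mul_of_nonneg_right h6 (by linarith))
    exact Finset.prod_le_prod (fun p hp => (key p (Finset.mem_filter.mp hp).2).1)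
      fun p hp => (key p (Finset.mem_filter.mp hp).2).2
  have hM0 : 0 < Real.log M := Real.log_pos (by exact_mod_cast (by omega : 1 < M))
  have h6 := (Real.log_le_iff_le_exp hM0).mpr (h4.trans (h2.trans h5))
  rw [Finset.sum_add_distrib, ← Finset.mul_sum] at h6
  have := sum_inv_sq_le_tsum ((Finset.Icc 1 M).filter Nat.Prime)
  linarith

/-- The first-order coefficient of the resonator. -/
noncomputable def coefA (k X : ℝ) (p : ℕ) : ℝ :=
  -(k * smoothWeight X (Real.log p) * Real.exp (-(Real.log p / 2)))

/-- The second-order coefficient of the resonator. -/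
noncomputable def coefB (k X : ℝ) (p : ℕ) : ℝ :=
  -(k / 2 * smoothWeight X (2 * Real.log p) * Real.exp (-Real.log p))

theorem coefA_sq (k X : ℝ) {p : ℕ} (hp : p.Prime) :
    coefA k X p ^ 2 = k ^ 2 * smoothWeight X (Real.log p) ^ 2 * (1 / p) := by
  unfold coefA
  have hp0 : (0:ℝ) < p := by exact_mod_cast hp.pos
  have : Real.exp (-(Real.log p / 2)) ^ 2 = 1 / p := by
    rw [← Real.exp_nat_mul]
    have : ((2:ℕ):ℝ) * -(Real.log p / 2) = -Real.log p := by push_cast; ring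
    rw [this, Real.exp_neg, Real.exp_log hp0, one_div]
  rw [neg_sq, mul_pow, mul_pow, this]

theorem coefB_sq_le (k : ℝ) {X : ℝ} (hX : 0 ≤ X) {p : ℕ} (hp : p.Prime) :
    coefB k X p ^ 2 ≤ k ^ 2 * (1 / p) := by
  unfold coefB
  have hp0 : (1:ℝ) ≤ p := by exact_mod_cast hp.one_lt.le
  have hl : 0 ≤ Real.log p := Real.log_natCast_nonneg p
  rw [Real.exp_neg, Real.exp_log (by linarith), neg_sq, mul_pow, mul_pow, ← one_div]
  have h1 := smoothWeight_le_one hX (by positivity : 0 ≤ 2 * Real.log p)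
  have h2 := smoothWeight_nonneg X (2 * Real.log p)
  have h3 : smoothWeight X (2 * Real.log p) ^ 2 ≤ 1 := pow_le_one₀ h2 h1
  have h4 : (1 / (p:ℝ)) ≤ 1 := by rw [div_le_one (by linarith)]; exact hp0
  have h5 : 0 ≤ 1 / (p:ℝ) := by positivity
  have h6 : (1 / (p:ℝ)) ^ 2 ≤ 1 / p := by nlinarith
  calc _ ≤ (k / 2) ^ 2 * 1 * (1 / (p:ℝ)) := by gcongr
    _ ≤ _ := by
      rw [div_pow, mul_one]
      refine mul_le_mul_of_nonneg_right ?_ h5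
      nlinarith [sq_nonneg k]

theorem coefA_sq_le (k : ℝ) {X : ℝ} (hX : 0 ≤ X) {p : ℕ} (hp : p.Prime) :
    coefA k X p ^ 2 ≤ k ^ 2 * (1 / p) := by
  rw [coefA_sq k X hp]
  have h1 := smoothWeight_le_one hX (Real.log_natCast_nonneg p)
  have h2 := smoothWeight_nonneg X (Real.log p)
  have h3 : smoothWeight X (Real.log p) ^ 2 ≤ 1 := pow_le_one₀ h2 h1
  calc _ ≤ k ^ 2 * 1 * (1 / (p:ℝ)) := by gcongr
    _ = _ := by ring

theorem exists_prod_one_add_coefA_ge (k : ℝ) : ∃ c > 0, ∀ M : ℕ, 3 ≤ M →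
    c * Real.log M ^ (k ^ 2) ≤
      ∏ p ∈ (Finset.Icc 1 M).filter Nat.Prime, (1 + coefA k (Real.log M) p ^ 2) := by
  set D := ∑' n : ℕ, 1 / (n:ℝ) ^ 2 with hD
  set K := 4 * (1 + (Real.log 4 + 4)) with hK
  refine ⟨Real.exp (-(k ^ 2 * (2 * D) + k ^ 2 * K + k ^ 4 * D)), Real.exp_pos _, fun M hM => ?_⟩
  set P := (Finset.Icc 1 M).filter Nat.Prime with hP
  have hX1 : 1 ≤ Real.log M := by
    rw [Real.le_log_iff_exp_le (by positivity)]
    have h3 : (3:ℝ) ≤ M := by exact_mod_cast hM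
    linarith [Real.exp_one_lt_d9]
  set X := Real.log M with hX
  have hX0 : 0 < X := by linarith
  have hpr : ∀ p ∈ P, p.Prime := fun p hp => (Finset.mem_filter.mp hp).2
  have hterm : ∀ p ∈ P, Real.exp (k ^ 2 * (1 / p) - k ^ 2 * (4 / X * (Real.log p / p)) - k ^ 4 * (1 / (p:ℝ) ^ 2)) ≤
      1 + coefA k X p ^ 2 := by
    intro p hp
    have hpp := hpr p hp
    have hle := coefA_sq_le k hX0.le hpp
    have h0 : 0 ≤ coefA k X p ^ 2 := sq_nonneg _
    have hx : Real.exp (coefA k X p ^ 2 - (coefA k X p ^ 2) ^ 2) ≤ 1 + coefA k X p ^ 2 := by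
      set x := coefA k X p ^ 2
      rw [← Real.le_log_iff_exp_le (by linarith)]
      have := Real.one_sub_inv_le_log_of_pos (by linarith : 0 < 1 + x)
      refine le_trans ?_ this
      have h1 : 1 - (1 + x)⁻¹ = x / (1 + x) := by
        have : (1 + x) ≠ 0 := by linarith
        field_simp
        ring
      rw [h1, le_div_iff₀ (by linarith)]
      nlinarith [pow_nonneg h0 3]
    refine le_trans (Real.exp_le_exp.mpr ?_) hx
    have h4 : (coefA k X p ^ 2) ^ 2 ≤ k ^ 4 * (1 / (p:ℝ) ^ 2) := by
      calc _ ≤ (k ^ 2 * (1 / (p:ℝ))) ^ 2 := pow_le_pow_left₀ h0 hle 2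
        _ = _ := by ring
    have h5 : k ^ 2 * (1 / p) - k ^ 2 * (4 / X * (Real.log p / p)) ≤ coefA k X p ^ 2 := by
      rw [coefA_sq k X hpp]
      have hw : 1 - 4 / X * Real.log p ≤ smoothWeight X (Real.log p) ^ 2 := by
        have hl : 0 ≤ Real.log p := Real.log_natCast_nonneg p
        set u := Real.log p / X with hu
        have hu0 : 0 ≤ u := by positivity
        have e : 4 / X * Real.log p = 4 * u := by rw [hu]; ring
        rw [e]
        by_cases hu1 : u ≤ 1 / 4
        · have h6 : (1 - u) ^ 2 ≤ smoothWeight X (Real.log p) := by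
            unfold smoothWeight
            rw [← hu, max_eq_left (by linarith), sq]
            refine mul_le_mul_of_nonneg_left ?_ (by linarith)
            have := Real.add_one_le_exp (-u)
            linarith
          have h7 : ((1 - u) ^ 2) ^ 2 ≤ smoothWeight X (Real.log p) ^ 2 := pow_le_pow_left₀ (sq_nonneg _) h6 2
          refine le_trans ?_ h7
          have h8 : 1 - 2 * u ≤ (1 - u) ^ 2 := by nlinarith [sq_nonneg u]
          have h9 : (1 - 2 * u) ^ 2 ≤ ((1 - u) ^ 2) ^ 2 := pow_le_pow_left₀ (by linarith) h8 2
          nlinarith [sq_nonneg u]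
        · push Not at hu1
          linarith [sq_nonneg (smoothWeight X (Real.log p))]
      calc _ = k ^ 2 * (1 - 4 / X * Real.log p) * (1 / p) := by ring
        _ ≤ _ := by gcongr
    linarith
  have h1 := Finset.prod_le_prod (fun p _ => (Real.exp_pos _).le) hterm
  refine le_trans ?_ h1
  rw [← Real.exp_sum, Finset.sum_sub_distrib, Finset.sum_sub_distrib, ← Finset.mul_sum, ← Finset.mul_sum,
    ← Finset.mul_sum, ← Finset.mul_sum, Real.rpow_def_of_pos hX0, ← Real.exp_add]
  refine Real.exp_le_exp.mpr ?_
  have hm := log_log_le_sum_inv_primes (by omega : 2 ≤ M)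
  have hs := sum_inv_sq_le_tsum P
  have hl := sum_log_div_primes_le (by omega : 0 < M) (Finset.filter_subset Nat.Prime _) hpr
  rw [← hX] at hm hl
  rw [← hP, ← hD] at hm
  rw [← hD] at hs
  have h2 : 4 / X * ∑ p ∈ P, Real.log p / p ≤ K := by
    have hl4 : 0 ≤ Real.log 4 := Real.log_nonneg (by norm_num)
    rw [div_mul_eq_mul_div, div_le_iff₀ hX0, hK, mul_assoc]
    refine mul_le_mul_of_nonneg_left (hl.trans ?_) (by norm_num)
    nlinarith
  have a1 := mul_le_mul_of_nonneg_left h2 (sq_nonneg k)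
  have a2 := mul_le_mul_of_nonneg_left hs (by positivity : 0 ≤ k ^ 4)
  have a3 := mul_le_mul_of_nonneg_left hm (sq_nonneg k)
  linarith

/-- The primes up to `2^(2^J)`. -/
def primesTower (J : ℕ) : Finset ℕ := (Finset.Icc 1 (2 ^ 2 ^ J)).filter Nat.Prime

/-- The primes `p ≤ 2^(2^J)` with `2^(2^j) ≤ p < 2^(2^(j+1))`. -/
def primeBlock (J j : ℕ) : Finset ℕ := (primesTower J).filter fun p => Nat.log 2 (Nat.log 2 p) = j

theorem prime_of_mem_primesTower {J p : ℕ} (h : p ∈ primesTower J) : p.Prime := (Finset.mem_filter.mp h).2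

theorem primeBlock_subset (J j : ℕ) : primeBlock J j ⊆ primesTower J := Finset.filter_subset _ _

theorem disjoint_primeBlock (J : ℕ) {i j : ℕ} (h : i ≠ j) : Disjoint (primeBlock J i) (primeBlock J j) := by
  rw [Finset.disjoint_left]
  intro p hi hj
  exact h ((Finset.mem_filter.mp hi).2.symm.trans (Finset.mem_filter.mp hj).2)

theorem log_log_mem_range {J p : ℕ} (h : p ∈ primesTower J) :
    Nat.log 2 (Nat.log 2 p) ∈ Finset.range (J + 1) := by
  have h1 := (Finset.mem_Icc.mp (Finset.mem_filter.mp h).1).2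
  have h2 := Nat.log_mono_right (b := 2) h1
  rw [Nat.log_pow (by norm_num)] at h2
  have h3 := Nat.log_mono_right (b := 2) h2
  rw [Nat.log_pow (by norm_num)] at h3
  rw [Finset.mem_range]
  omega

theorem sum_primesTower (J : ℕ) (f : ℕ → ℝ) :
    ∑ p ∈ primesTower J, f p = ∑ j ∈ Finset.range (J + 1), ∑ p ∈ primeBlock J j, f p :=
  (Finset.sum_fiberwise_of_maps_to (fun _ h => log_log_mem_range h) f).symm

theorem prod_primesTower (J : ℕ) (f : ℕ → ℝ) :
    ∏ p ∈ primesTower J, f p = ∏ j ∈ Finset.range (J + 1), ∏ p ∈ primeBlock J j, f p :=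
  (Finset.prod_fiberwise_of_maps_to (fun _ h => log_log_mem_range h) f).symm

theorem primeBlock_bounds {J j p : ℕ} (h : p ∈ primeBlock J j) : 2 ^ 2 ^ j ≤ p ∧ p < 2 ^ 2 ^ (j + 1) := by
  have hp := prime_of_mem_primesTower (primeBlock_subset J j h)
  have h1 := (Finset.mem_filter.mp h).2
  have h2 : Nat.log 2 p ≠ 0 := (Nat.log_pos (by norm_num) hp.two_le).ne'
  have h3 := Nat.pow_log_le_self 2 h2
  have h4 := Nat.lt_pow_succ_log_self (b := 2) (by norm_num) (Nat.log 2 p)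
  rw [h1] at h3 h4
  refine ⟨Nat.pow_le_of_le_log hp.pos.ne' h3, Nat.lt_pow_of_log_lt (by norm_num) h4⟩

theorem log_primeBlock_bounds {J j p : ℕ} (h : p ∈ primeBlock J j) :
    2 ^ j * Real.log 2 ≤ Real.log p ∧ Real.log p ≤ 2 ^ (j + 1) * Real.log 2 := by
  obtain ⟨h1, h2⟩ := primeBlock_bounds h
  have hp := (prime_of_mem_primesTower (primeBlock_subset J j h)).pos
  have e : ∀ i : ℕ, (2:ℝ) ^ i * Real.log 2 = Real.log ((2:ℝ) ^ 2 ^ i) := fun i => by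
    rw [Real.log_pow]
    push_cast
    ring
  rw [e, e]
  constructor
  · exact Real.log_le_log (by positivity) (by exact_mod_cast h1)
  · exact Real.log_le_log (by exact_mod_cast hp) (by exact_mod_cast h2.le)

theorem sum_inv_primeBlock_le (J j : ℕ) : ∑ p ∈ primeBlock J j, 1 / (p:ℝ) ≤ 10 := by
  have h1 := sum_log_div_primes_le (N := 2 ^ 2 ^ (j + 1)) (by positivity) (S := primeBlock J j)
    (fun p h => Finset.mem_Icc.mpr ⟨(prime_of_mem_primesTower (primeBlock_subset J j h)).pos, (primeBlock_bounds h).2.le⟩)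
    (fun p h => prime_of_mem_primesTower (primeBlock_subset J j h))
  have hl2 : 0.6931471803 < Real.log 2 := Real.log_two_gt_d9
  have h2 : 2 ^ j * Real.log 2 * ∑ p ∈ primeBlock J j, 1 / (p:ℝ) ≤ ∑ p ∈ primeBlock J j, Real.log p / p := by
    rw [Finset.mul_sum]
    refine Finset.sum_le_sum fun p hp => ?_
    rw [mul_one_div]
    exact div_le_div_of_nonneg_right (log_primeBlock_bounds hp).1 (Nat.cast_nonneg p)
  have e : Real.log ((2 ^ 2 ^ (j + 1) : ℕ) : ℝ) = 2 * (2 ^ j * Real.log 2) := by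
    push_cast
    rw [Real.log_pow]
    push_cast
    ring
  have e4 : Real.log 4 = 2 * Real.log 2 := by
    rw [show (4:ℝ) = 2 ^ 2 by norm_num, Real.log_pow]
    norm_num
  have hj : (1:ℝ) ≤ 2 ^ j := one_le_pow₀ (by norm_num)
  rw [e, e4] at h1
  have h3 : Real.log 2 ≤ 2 ^ j * Real.log 2 := le_mul_of_one_le_left (by linarith) hj
  have h4 := h2.trans h1
  by_contra hc
  push Not at hc
  have : 2 ^ j * Real.log 2 * 10 < 2 ^ j * Real.log 2 * ∑ p ∈ primeBlock J j, 1 / (p:ℝ) :=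
    mul_lt_mul_of_pos_left hc (by positivity)
  linarith

/-- `log (2^(2^J))`. -/
noncomputable def towerLog (J : ℕ) : ℝ := Real.log ((2 ^ 2 ^ J : ℕ) : ℝ)

theorem towerLog_eq (J : ℕ) : towerLog J = 2 ^ J * Real.log 2 := by
  unfold towerLog
  push_cast
  rw [Real.log_pow]
  push_cast
  ring

theorem towerLog_pos (J : ℕ) : 0 < towerLog J := by
  rw [towerLog_eq]
  have := Real.log_pos one_lt_two
  positivity

theorem sum_coef_sq_primeBlock_le (k : ℝ) (J j : ℕ) :
    ∑ p ∈ primeBlock J j, (coefA k (towerLog J) p ^ 2 + coefB k (towerLog J) p ^ 2) ≤ 20 * k ^ 2 := by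
  calc _ ≤ ∑ p ∈ primeBlock J j, 2 * k ^ 2 * (1 / (p:ℝ)) := Finset.sum_le_sum fun p hp => by
        have hpp := prime_of_mem_primesTower (primeBlock_subset J j hp)
        have := coefA_sq_le k (towerLog_pos J).le hpp
        have := coefB_sq_le k (towerLog_pos J).le hpp
        linarith
    _ = 2 * k ^ 2 * ∑ p ∈ primeBlock J j, 1 / (p:ℝ) := by rw [Finset.mul_sum]
    _ ≤ 2 * k ^ 2 * 10 := mul_le_mul_of_nonneg_left (sum_inv_primeBlock_le J j) (by positivity)
    _ = _ := by ring

/-- The exponent used on block `j`. -/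
def blockExp (A J j : ℕ) : ℕ := A * (J + 1 - j) ^ 2

theorem blockExp_pos {A J j : ℕ} (hA : 0 < A) (hj : j ∈ Finset.range (J + 1)) : 0 < blockExp A J j := by
  rw [Finset.mem_range] at hj
  unfold blockExp
  have : 0 < J + 1 - j := by omega
  positivity

theorem sum_inv_blockExp_le (A J : ℕ) :
    ∑ j ∈ Finset.range (J + 1), 1 / (blockExp A J j : ℝ) ≤ (∑' n : ℕ, 1 / (n:ℝ) ^ 2) / A := by
  rw [← Finset.sum_range_reflect]
  have h : ∀ j ∈ Finset.range (J + 1), 1 / (blockExp A J (J + 1 - 1 - j) : ℝ) =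
      1 / (((j + 1 : ℕ) : ℝ)) ^ 2 / A := by
    intro j hj
    rw [Finset.mem_range] at hj
    unfold blockExp
    rw [show J + 1 - (J + 1 - 1 - j) = j + 1 by omega]
    push_cast
    rw [div_div, mul_comm]
  rw [Finset.sum_congr rfl h, ← Finset.sum_div]
  refine div_le_div_of_nonneg_right ?_ (Nat.cast_nonneg A)
  have := sum_inv_sq_le_tsum ((Finset.range (J + 1)).map ⟨fun j => j + 1, fun a b h => by simpa using h⟩)
  rw [Finset.sum_map] at this
  exact this

theorem summable_add_one_sq_mul_half_pow : Summable fun n : ℕ => ((n:ℝ) + 1) ^ 2 * (1 / 2) ^ n := by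
  have h := fun q : ℕ => summable_pow_mul_geometric_of_norm_lt_one q (r := (1 / 2 : ℝ)) (by norm_num)
  refine (((h 2).add ((h 1).mul_left 2)).add (h 0)).congr fun n => ?_
  ring

theorem sum_blockExp_mul_le (A J : ℕ) :
    ∑ j ∈ Finset.range (J + 1), (blockExp A J j : ℝ) * 2 ^ j ≤
      A * (∑' n : ℕ, ((n:ℝ) + 1) ^ 2 * (1 / 2) ^ n) * 2 ^ J := by
  rw [← Finset.sum_range_reflect]
  have h : ∀ j ∈ Finset.range (J + 1), (blockExp A J (J + 1 - 1 - j) : ℝ) * 2 ^ (J + 1 - 1 - j) =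
      A * (((j:ℝ) + 1) ^ 2 * (1 / 2) ^ j) * 2 ^ J := by
    intro j hj
    rw [Finset.mem_range] at hj
    unfold blockExp
    rw [show J + 1 - (J + 1 - 1 - j) = j + 1 by omega]
    have e : (2:ℝ) ^ J = 2 ^ (J + 1 - 1 - j) * 2 ^ j := by
      rw [← pow_add]
      congr 1
      omega
    rw [e, one_div, inv_pow]
    push_cast
    field_simp
  rw [Finset.sum_congr rfl h, ← Finset.sum_mul, ← Finset.mul_sum]
  have := summable_add_one_sq_mul_half_pow.sum_le_tsum (Finset.range (J + 1)) fun _ _ => by positivity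
  gcongr

/-- The block polynomial for the tower of height `J`. -/
noncomputable def towerPoly (k : ℝ) (J j : ℕ) : MvPolynomial ℕ ℝ :=
  blockPoly (primeBlock J j) (coefA k (towerLog J)) (coefB k (towerLog J))

/-- The resonator factor on block `j`. -/
noncomputable def towerRes (k : ℝ) (A J j : ℕ) : MvPolynomial ℕ ℝ :=
  blockRes (primeBlock J j) (coefA k (towerLog J)) (coefB k (towerLog J)) (blockExp A J j)

/-- The resonator. -/
noncomputable def resonator (k : ℝ) (A J : ℕ) : MvPolynomial ℕ ℝ :=
  ∏ j ∈ Finset.range (J + 1), towerRes k A J j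

theorem vars_blockRes (I : Finset ℕ) (α β : ℕ → ℝ) (l : ℕ) : (blockRes I α β l).vars ⊆ I := by
  unfold blockRes
  refine (MvPolynomial.vars_pow _ _).trans ((MvPolynomial.vars_add_subset _ _).trans ?_)
  refine Finset.union_subset (by simp) ((MvPolynomial.vars_mul _ _).trans ?_)
  rw [MvPolynomial.vars_C]
  exact Finset.union_subset (Finset.empty_subset _) (vars_blockPoly I α β)

theorem coeffNormSq_resonator (k : ℝ) (A J : ℕ) :
    coeffNormSq (resonator k A J) = ∏ j ∈ Finset.range (J + 1), coeffNormSq (towerRes k A J j) :=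
  coeffNormSq_prod _ _ (primeBlock J) (fun _ _ => vars_blockRes _ _ _ _) fun _ _ _ _ h => disjoint_primeBlock J h

theorem coeffNormSq_towerRes_ge {k : ℝ} {A J j : ℕ} (hA : 0 < A) (hj : j ∈ Finset.range (J + 1)) :
    (∏ p ∈ primeBlock J j, (1 + coefA k (towerLog J) p ^ 2)) *
      (1 - 2 * Real.exp (2 * (20 * k ^ 2)) / blockExp A J j) ≤ coeffNormSq (towerRes k A J j) ∧
      1 ≤ coeffNormSq (towerRes k A J j) :=
  coeffNormSq_blockRes_ge _ _ _ (sum_coef_sq_primeBlock_le k J j) (blockExp_pos hA hj)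

theorem coeffNormSq_resonator_mul_le {k : ℝ} {A J i : ℕ} (hA : 0 < A) (hi : i ∈ Finset.range (J + 1)) :
    coeffNormSq (resonator k A J * towerPoly k J i) ≤
      4 * (20 * k ^ 2) * Real.exp (8 * (20 * k ^ 2)) * coeffNormSq (resonator k A J) := by
  have e : resonator k A J * towerPoly k J i = ∏ j ∈ Finset.range (J + 1),
      if j = i then towerRes k A J i * towerPoly k J i else towerRes k A J j := by
    unfold resonator
    rw [← Finset.mul_prod_erase _ _ hi, ← Finset.mul_prod_erase _ (fun j => if j = i then _ else _) hi, if_pos rfl,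
      Finset.prod_congr rfl fun j hj => if_neg (Finset.ne_of_mem_erase hj)]
    ring
  rw [e, coeffNormSq_prod _ _ (primeBlock J), coeffNormSq_resonator, ← Finset.mul_prod_erase _ _ hi,
    ← Finset.mul_prod_erase _ (fun j => coeffNormSq (towerRes k A J j)) hi, if_pos rfl,
    Finset.prod_congr rfl fun j hj => by rw [if_neg (Finset.ne_of_mem_erase hj)]]
  · have h1 : coeffNormSq (towerRes k A J i * towerPoly k J i) ≤
        4 * (20 * k ^ 2) * Real.exp (8 * (20 * k ^ 2)) :=
      coeffNormSq_blockRes_mul_le _ _ _ (sum_coef_sq_primeBlock_le k J i) _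
    have h2 := (coeffNormSq_towerRes_ge (k := k) hA hi).2
    rw [← mul_assoc]
    refine mul_le_mul_of_nonneg_right (h1.trans ?_) (Finset.prod_nonneg fun _ _ => coeffNormSq_nonneg _)
    exact le_mul_of_one_le_right (by positivity) h2
  · intro j _
    split_ifs with h
    · subst h
      exact (MvPolynomial.vars_mul _ _).trans (Finset.union_subset (vars_blockRes _ _ _ _) (vars_blockPoly _ _ _))
    · exact vars_blockRes _ _ _ _
  · intro _ _ _ _ h
    exact disjoint_primeBlock J h

theorem one_sub_sum_le_prod_one_sub (n : ℕ) (x : ℕ → ℝ) (h0 : ∀ j ∈ Finset.range n, 0 ≤ x j)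
    (h1 : ∀ j ∈ Finset.range n, x j ≤ 1) :
    1 - ∑ j ∈ Finset.range n, x j ≤ ∏ j ∈ Finset.range n, (1 - x j) := by
  induction n with
  | zero => simp
  | succ n ih =>
    have hs : Finset.range n ⊆ Finset.range (n + 1) := Finset.range_mono (Nat.le_succ n)
    have ih' := ih (fun j hj => h0 j (hs hj)) fun j hj => h1 j (hs hj)
    rw [Finset.sum_range_succ, Finset.prod_range_succ]
    have hp : ∏ j ∈ Finset.range n, (1 - x j) ≤ 1 := Finset.prod_le_one
      (fun j hj => by linarith [h1 j (hs hj)]) fun j hj => by linarith [h0 j (hs hj)]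
    have a := h0 n (Finset.self_mem_range_succ n)
    nlinarith [mul_nonneg a (sub_nonneg.mpr hp)]

theorem coeffNormSq_resonator_ge {k : ℝ} {A : ℕ} (hA : 0 < A)
    (hA2 : 4 * Real.exp (2 * (20 * k ^ 2)) * (∑' n : ℕ, 1 / (n:ℝ) ^ 2) ≤ A) (J : ℕ) :
    (1 / 2) * ∏ p ∈ primesTower J, (1 + coefA k (towerLog J) p ^ 2) ≤ coeffNormSq (resonator k A J) := by
  have hA0 : (0:ℝ) < A := by exact_mod_cast hA
  set E := Real.exp (2 * (20 * k ^ 2)) with hE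
  have hsum : ∑ j ∈ Finset.range (J + 1), 2 * E / (blockExp A J j : ℝ) ≤ 1 / 2 := by
    have h := sum_inv_blockExp_le A J
    have e : ∑ j ∈ Finset.range (J + 1), 2 * E / (blockExp A J j : ℝ) =
        2 * E * ∑ j ∈ Finset.range (J + 1), 1 / (blockExp A J j : ℝ) := by
      rw [Finset.mul_sum]
      exact Finset.sum_congr rfl fun j _ => by rw [mul_one_div]
    rw [e]
    calc _ ≤ 2 * E * ((∑' n : ℕ, 1 / (n:ℝ) ^ 2) / A) := by gcongr
      _ = (4 * E * (∑' n : ℕ, 1 / (n:ℝ) ^ 2)) / A / 2 := by ring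
      _ ≤ 1 / 2 := by
        refine div_le_div_of_nonneg_right ?_ zero_le_two
        rwa [div_le_one hA0]
  have hx0 : ∀ j ∈ Finset.range (J + 1), 0 ≤ 2 * E / (blockExp A J j : ℝ) := fun j _ => by positivity
  have hx1 : ∀ j ∈ Finset.range (J + 1), 2 * E / (blockExp A J j : ℝ) ≤ 1 := fun j hj =>
    (Finset.single_le_sum hx0 hj).trans (hsum.trans (by norm_num))
  have h1 := one_sub_sum_le_prod_one_sub (J + 1) _ hx0 hx1
  have hP : 0 ≤ ∏ p ∈ primesTower J, (1 + coefA k (towerLog J) p ^ 2) := Finset.prod_nonneg fun p _ => by positivity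
  calc _ ≤ (∏ j ∈ Finset.range (J + 1), (1 - 2 * E / (blockExp A J j : ℝ))) *
        ∏ p ∈ primesTower J, (1 + coefA k (towerLog J) p ^ 2) :=
        mul_le_mul_of_nonneg_right (by linarith) hP
    _ = ∏ j ∈ Finset.range (J + 1), ((∏ p ∈ primeBlock J j, (1 + coefA k (towerLog J) p ^ 2)) *
        (1 - 2 * E / (blockExp A J j : ℝ))) := by
        rw [prod_primesTower, Finset.prod_mul_distrib, mul_comm]
    _ ≤ ∏ j ∈ Finset.range (J + 1), coeffNormSq (towerRes k A J j) :=
        Finset.prod_le_prod (fun j hj => mul_nonneg (Finset.prod_nonneg fun p _ => by positivity)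
          (by linarith [hx1 j hj])) fun j hj => (coeffNormSq_towerRes_ge hA hj).1
    _ = _ := (coeffNormSq_resonator k A J).symm

theorem hasLength_towerPoly (k : ℝ) {J j : ℕ} : HasLength (towerPoly k J j) (4 * Real.log 2 * 2 ^ j) :=
  hasLength_blockPoly (fun p hp => prime_of_mem_primesTower (primeBlock_subset J j hp)) _ _ fun p hp => by
    have := (log_primeBlock_bounds hp).2
    rw [pow_succ] at this
    linarith

theorem hasLength_resonator (k : ℝ) (A J : ℕ) : HasLength (resonator k A J)
    (4 * Real.log 2 * (A * ∑' n : ℕ, ((n:ℝ) + 1) ^ 2 * (1 / 2) ^ n) * 2 ^ J) := by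
  have hl : 0 < Real.log 2 := Real.log_pos one_lt_two
  have h : HasLength (resonator k A J)
      (∑ j ∈ Finset.range (J + 1), (blockExp A J j : ℝ) * (4 * Real.log 2 * 2 ^ j)) :=
    HasLength.prod _ _ _ fun j _ => hasLength_blockRes
      (fun p hp => prime_of_mem_primesTower (primeBlock_subset J j hp)) _ _ (by positivity) (fun p hp => by
        have := (log_primeBlock_bounds hp).2
        rw [pow_succ] at this
        linarith) _
  refine h.mono ?_
  have e : ∑ j ∈ Finset.range (J + 1), (blockExp A J j : ℝ) * (4 * Real.log 2 * 2 ^ j) =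
      4 * Real.log 2 * ∑ j ∈ Finset.range (J + 1), (blockExp A J j : ℝ) * 2 ^ j := by
    rw [Finset.mul_sum]
    exact Finset.sum_congr rfl fun j _ => by ring
  rw [e, mul_assoc (4 * Real.log 2)]
  exact mul_le_mul_of_nonneg_left (sum_blockExp_mul_le A J) (by positivity)

/-- The constant controlling the logarithmic length of the resonator. -/
noncomputable def lengthConst (A : ℕ) : ℝ :=
  4 * Real.log 2 * (A * (∑' n : ℕ, ((n:ℝ) + 1) ^ 2 * (1 / 2) ^ n) + 1)

theorem one_le_lengthConst (A : ℕ) : 1 ≤ lengthConst A := by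
  have h : 0 ≤ ∑' n : ℕ, ((n:ℝ) + 1) ^ 2 * (1 / 2) ^ n := tsum_nonneg fun _ => by positivity
  have h2 : 0 ≤ (A:ℝ) * ∑' n : ℕ, ((n:ℝ) + 1) ^ 2 * (1 / 2) ^ n := by positivity
  have := Real.log_two_gt_d9
  unfold lengthConst
  nlinarith

theorem hasLength_resonator_le (k : ℝ) (A J : ℕ) : HasLength (resonator k A J) (lengthConst A * 2 ^ J) := by
  have hl : 0 < Real.log 2 := Real.log_pos one_lt_two
  refine (hasLength_resonator k A J).mono ?_
  unfold lengthConst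
  gcongr
  linarith

theorem hasLength_resonator_mul_le (k : ℝ) (A : ℕ) {J i : ℕ} (hi : i ∈ Finset.range (J + 1)) :
    HasLength (resonator k A J * towerPoly k J i) (lengthConst A * 2 ^ J) := by
  have hl : 0 < Real.log 2 := Real.log_pos one_lt_two
  refine ((hasLength_resonator k A J).mul (hasLength_towerPoly k)).mono ?_
  have : (2:ℝ) ^ i ≤ 2 ^ J := pow_le_pow_right₀ one_le_two (by rw [Finset.mem_range] at hi; omega)
  have h2 := mul_le_mul_of_nonneg_left this (by positivity : 0 ≤ 4 * Real.log 2)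
  unfold lengthConst
  linarith

theorem norm_evalT_resonator_sq_sub_le (k : ℝ) {A : ℕ} (hA : 0 < A) (J : ℕ) (γ : ℝ) :
    ‖evalT γ (resonator k A J)‖ ^ 2 - ∑ j ∈ Finset.range (J + 1),
      1 / (blockExp A J j : ℝ) * ‖evalT γ (resonator k A J * towerPoly k J j)‖ ^ 2 ≤
      Real.exp (2 * ∑ j ∈ Finset.range (J + 1), (evalT γ (towerPoly k J j)).re) := by
  set μ := ‖evalT γ (resonator k A J)‖ ^ 2 with hμ
  set R := ∑ j ∈ Finset.range (J + 1), (evalT γ (towerPoly k J j)).re with hR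
  set S := ∑ j ∈ Finset.range (J + 1), ‖evalT γ (towerPoly k J j)‖ ^ 2 / (blockExp A J j : ℝ) with hS
  have h1 : μ ≤ Real.exp (2 * R + S) := by
    rw [hμ, hR, hS, Finset.mul_sum, ← Finset.sum_add_distrib, Real.exp_sum]
    unfold resonator
    rw [map_prod, norm_prod, ← Finset.prod_pow]
    exact Finset.prod_le_prod (fun _ _ => by positivity) fun j hj =>
      norm_evalT_blockRes_sq_le γ _ _ _ (blockExp_pos hA hj)
  have h2 : ∑ j ∈ Finset.range (J + 1),
      1 / (blockExp A J j : ℝ) * ‖evalT γ (resonator k A J * towerPoly k J j)‖ ^ 2 = μ * S := by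
    rw [hS, Finset.mul_sum]
    refine Finset.sum_congr rfl fun j _ => ?_
    rw [map_mul, norm_mul, mul_pow]
    ring
  have h3 : μ * Real.exp (-S) ≤ Real.exp (2 * R) := by
    calc _ ≤ Real.exp (2 * R + S) * Real.exp (-S) := mul_le_mul_of_nonneg_right h1 (Real.exp_pos _).le
      _ = _ := by rw [← Real.exp_add]; congr 1; ring
  have h4 : μ * (1 - S) ≤ μ * Real.exp (-S) := mul_le_mul_of_nonneg_left
    (by have := Real.add_one_le_exp (-S); linarith) (by positivity)
  rw [h2]
  linarith

theorem sum_re_evalT_towerPoly (k : ℝ) (J : ℕ) (γ : ℝ) :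
    ∑ j ∈ Finset.range (J + 1), (evalT γ (towerPoly k J j)).re =
      -(k * ∑ p ∈ primesTower J, primeTerm (towerLog J) γ p) := by
  rw [sum_primesTower, Finset.mul_sum, ← Finset.sum_neg_distrib]
  refine Finset.sum_congr rfl fun j _ => ?_
  unfold towerPoly
  rw [evalT_blockPoly_re, Finset.mul_sum, ← Finset.sum_neg_distrib]
  refine Finset.sum_congr rfl fun p _ => ?_
  unfold coefA coefB primeTerm
  ring

theorem rpow_neg_norm_deriv_ge (H : SimpleRH) : ∃ C > 0, ∀ T ≥ (2:ℝ), ∀ γ ∈ zetaOrd, T < γ → γ ≤ 2 * T →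
    ∀ J : ℕ, 1 ≤ J → ((2 ^ 2 ^ J : ℕ) : ℝ) ≤ T → ∀ k : ℝ, 0 ≤ k →
    towerLog J ^ (-(2 * k)) * Real.exp (-(2 * k * (Real.log T / towerLog J + C))) *
      Real.exp (2 * ∑ j ∈ Finset.range (J + 1), (evalT γ (towerPoly k J j)).re) ≤
      ‖deriv riemannZeta (1 / 2 + γ * I)‖ ^ (-(2 * k)) := by
  obtain ⟨C, hC, h⟩ := norm_deriv_zeta_le_primeTerm H
  refine ⟨C, hC, fun T hT γ hγ h1 h2 J hJ hM k hk => ?_⟩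
  have h3 : 3 ≤ 2 ^ 2 ^ J := by
    have : 2 ^ 1 ≤ 2 ^ J := Nat.pow_le_pow_right (by norm_num) hJ
    calc 3 ≤ 2 ^ 2 := by norm_num
      _ ≤ _ := Nat.pow_le_pow_right (by norm_num) this
  have h4 := h T hT γ hγ h1 h2 _ h3 hM
  have hX := towerLog_pos J
  change _ ≤ towerLog J * Real.exp (∑ p ∈ primesTower J, primeTerm (towerLog J) γ p + Real.log T / towerLog J + C) at h4
  have hpos : 0 < ‖deriv riemannZeta (1 / 2 + γ * I)‖ := by
    rw [norm_pos_iff]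
    exact H.2 _ hγ (by simp) (by simp; norm_num)
  have h5 := Real.rpow_le_rpow_of_nonpos hpos h4 (by linarith : -(2 * k) ≤ 0)
  refine le_trans (le_of_eq ?_) h5
  rw [Real.mul_rpow hX.le (Real.exp_pos _).le, ← Real.exp_mul, mul_assoc, ← Real.exp_add, sum_re_evalT_towerPoly]
  congr 2
  ring

theorem fejer_evalT_bounds (H : SimpleRH) : ∃ Y₀ : ℝ, 2 ≤ Y₀ ∧ ∀ Y ≥ Y₀, ∀ t : ℝ,
    5 / 4 * Y ^ 8 ≤ t → t ≤ 7 / 4 * Y ^ 8 → riemannZeta (1 / 2 + t * I) ≠ 0 →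
    ∀ f : MvPolynomial ℕ ℝ, ∀ B : ℝ, HasLength f B → Real.exp B ≤ Y →
    1 / (2 * Y ^ 2) * Real.log Y * coeffNormSq f ≤
      ∑ γ ∈ zetaWindow (Y ^ 8), fejer (1 / Y ^ 2) (t - γ) * ‖evalT γ f‖ ^ 2 ∧
    ∑ γ ∈ zetaWindow (Y ^ 8), fejer (1 / Y ^ 2) (t - γ) * ‖evalT γ f‖ ^ 2 ≤
      11 / Y ^ 2 * Real.log Y * coeffNormSq f := by
  obtain ⟨Y₀, hY₀, h⟩ := fejer_window_bounds H
  refine ⟨Y₀, hY₀, fun Y hY t h1 h2 h3 f B hf hB => ?_⟩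
  obtain ⟨S, b, hS, hb, he⟩ := exists_dirVal_eq_evalT hf hB
  have h4 := h Y hY t h1 h2 h3 ⌊Y⌋₊ (Nat.floor_pos.mpr (by linarith)) (Nat.floor_le (by linarith)) S hS b
  rw [hb] at h4
  simp only [he] at h4
  exact h4

theorem fejer_moment_ge_of_tower (H : SimpleRH) {k : ℝ} (hk : 0 ≤ k) : ∃ A : ℕ, ∃ c > 0, ∃ Y₀ ≥ (2:ℝ), ∀ Y ≥ Y₀,
    ∀ J : ℕ, 1 ≤ J → lengthConst A * 2 ^ J ≤ Real.log Y → Real.log Y ≤ 2 * lengthConst A * 2 ^ J → ∀ t : ℝ,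
    5 / 4 * Y ^ 8 ≤ t → t ≤ 7 / 4 * Y ^ 8 → riemannZeta (1 / 2 + t * I) ≠ 0 →
    c / Y ^ 2 * Real.log Y * (towerLog J ^ (k ^ 2) * towerLog J ^ (-(2 * k))) ≤
      ∑ γ ∈ zetaWindow (Y ^ 8), fejer (1 / Y ^ 2) (t - γ) *
        ‖deriv riemannZeta (1 / 2 + (γ:ℝ) * I)‖ ^ (-(2 * k)) := by
  set D := ∑' n : ℕ, 1 / (n:ℝ) ^ 2 with hD
  set Kw := 4 * (20 * k ^ 2) * Real.exp (8 * (20 * k ^ 2)) with hKw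
  have hD0 : 0 ≤ D := tsum_nonneg fun _ => by positivity
  have hKw0 : 0 ≤ Kw := by positivity
  obtain ⟨A, hAge⟩ := exists_nat_ge (max 1 (max (4 * Real.exp (2 * (20 * k ^ 2)) * D) (44 * Kw * D)))
  have hA1 : (1:ℝ) ≤ A := (le_max_left _ _).trans hAge
  have hA2 : 4 * Real.exp (2 * (20 * k ^ 2)) * D ≤ A := (le_max_left _ _).trans ((le_max_right _ _).trans hAge)
  have hA3 : 44 * Kw * D ≤ A := (le_max_right _ _).trans ((le_max_right _ _).trans hAge)
  have hA : 0 < A := by exact_mod_cast (by linarith : (0:ℝ) < A)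
  obtain ⟨c1, hc1, hprod⟩ := exists_prod_one_add_coefA_ge k
  obtain ⟨C, hC, hder⟩ := rpow_neg_norm_deriv_ge H
  obtain ⟨Y₀, hY₀, hfej⟩ := fejer_evalT_bounds H
  have hl2 : 0 < Real.log 2 := Real.log_pos one_lt_two
  have hCA := one_le_lengthConst A
  set CA := lengthConst A with hCAdef
  set E := Real.exp (-(2 * k * (16 * CA / Real.log 2 + C))) with hE
  have hE0 : 0 < E := Real.exp_pos _
  refine ⟨A, E * (1 / 8) * c1, by positivity, Y₀, hY₀, fun Y hY J hJ hJ1 hJ2 t ht1 ht2 hz => ?_⟩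
  have hY2 : 2 ≤ Y := hY₀.trans hY
  have hY0 : 0 < Y := by linarith
  have hlY : 0 < Real.log Y := Real.log_pos (by linarith)
  have hX := towerLog_pos J
  have hpow : (1:ℝ) ≤ 2 ^ J := one_le_pow₀ one_le_two
  have hY8 : Y ≤ Y ^ 8 := le_self_pow₀ (by linarith) (by norm_num)
  have hM : ((2 ^ 2 ^ J : ℕ) : ℝ) ≤ Y ^ 8 := by
    refine le_trans ?_ hY8
    have h1 : towerLog J ≤ Real.log Y := by
      rw [towerLog_eq]
      refine le_trans ?_ hJ1
      have : Real.log 2 ≤ 1 := by linarith [Real.log_two_lt_d9]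
      nlinarith
    exact (Real.log_le_log_iff (by positivity) hY0).mp h1
  have hexp : Real.exp (CA * 2 ^ J) ≤ Y := (Real.le_log_iff_exp_le hY0).mp hJ1
  have hratio : Real.log (Y ^ 8) / towerLog J ≤ 16 * CA / Real.log 2 := by
    rw [Real.log_pow, towerLog_eq, div_le_div_iff₀ (by positivity) hl2]
    push_cast
    have := mul_le_mul_of_nonneg_right hJ2 hl2.le
    linarith
  set P := towerLog J ^ (-(2 * k)) * E with hP
  have hP0 : 0 < P := mul_pos (Real.rpow_pos_of_pos hX _) hE0
  have hterm : ∀ γ ∈ zetaWindow (Y ^ 8), fejer (1 / Y ^ 2) (t - γ) *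
      (P * (‖evalT γ (resonator k A J)‖ ^ 2 - ∑ j ∈ Finset.range (J + 1),
        1 / (blockExp A J j : ℝ) * ‖evalT γ (resonator k A J * towerPoly k J j)‖ ^ 2)) ≤
      fejer (1 / Y ^ 2) (t - γ) * ‖deriv riemannZeta (1 / 2 + (γ:ℝ) * I)‖ ^ (-(2 * k)) := by
    intro γ hγ
    refine mul_le_mul_of_nonneg_left ?_ (fejer_nonneg _ _)
    obtain ⟨hγ1, hγ2⟩ := mem_zetaWindow.mp hγ
    refine le_trans ?_ (hder (Y ^ 8) (by linarith) γ γ.2 hγ1 hγ2 J hJ hM k hk)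
    have h1 := norm_evalT_resonator_sq_sub_le k hA J γ
    refine (mul_le_mul_of_nonneg_left h1 hP0.le).trans ?_
    refine mul_le_mul_of_nonneg_right ?_ (Real.exp_pos _).le
    refine mul_le_mul_of_nonneg_left ?_ (Real.rpow_pos_of_pos hX _).le
    refine Real.exp_le_exp.mpr (neg_le_neg ?_)
    gcongr
  refine le_trans ?_ (Finset.sum_le_sum hterm)
  have hsplit : ∑ γ ∈ zetaWindow (Y ^ 8), fejer (1 / Y ^ 2) (t - γ) *
      (P * (‖evalT γ (resonator k A J)‖ ^ 2 - ∑ j ∈ Finset.range (J + 1),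
        1 / (blockExp A J j : ℝ) * ‖evalT γ (resonator k A J * towerPoly k J j)‖ ^ 2)) =
      P * (∑ γ ∈ zetaWindow (Y ^ 8), fejer (1 / Y ^ 2) (t - γ) * ‖evalT γ (resonator k A J)‖ ^ 2 -
        ∑ j ∈ Finset.range (J + 1), 1 / (blockExp A J j : ℝ) *
          ∑ γ ∈ zetaWindow (Y ^ 8), fejer (1 / Y ^ 2) (t - γ) *
            ‖evalT γ (resonator k A J * towerPoly k J j)‖ ^ 2) := by
    simp only [Finset.mul_sum (s := zetaWindow (Y ^ 8))]
    rw [Finset.sum_comm, ← Finset.sum_sub_distrib, Finset.mul_sum]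
    refine Finset.sum_congr rfl fun γ _ => ?_
    have e : ∑ j ∈ Finset.range (J + 1), 1 / (blockExp A J j : ℝ) * (fejer (1 / Y ^ 2) (t - γ) *
          ‖evalT γ (resonator k A J * towerPoly k J j)‖ ^ 2) = fejer (1 / Y ^ 2) (t - γ) *
        ∑ j ∈ Finset.range (J + 1), 1 / (blockExp A J j : ℝ) *
          ‖evalT γ (resonator k A J * towerPoly k J j)‖ ^ 2 := by
      rw [Finset.mul_sum]
      exact Finset.sum_congr rfl fun j _ => by ring
    rw [e]
    ring
  rw [hsplit]
  set Q := coeffNormSq (resonator k A J) with hQ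
  have hlow := (hfej Y hY t ht1 ht2 hz _ _ (hasLength_resonator_le k A J) hexp).1
  have hup : ∑ j ∈ Finset.range (J + 1), 1 / (blockExp A J j : ℝ) *
      ∑ γ ∈ zetaWindow (Y ^ 8), fejer (1 / Y ^ 2) (t - γ) *
        ‖evalT γ (resonator k A J * towerPoly k J j)‖ ^ 2 ≤ 1 / (4 * Y ^ 2) * Real.log Y * Q := by
    have hQ0 : 0 ≤ Q := coeffNormSq_nonneg _
    calc _ ≤ ∑ j ∈ Finset.range (J + 1), 1 / (blockExp A J j : ℝ) * (11 / Y ^ 2 * Real.log Y * (Kw * Q)) := by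
          refine Finset.sum_le_sum fun j hj => mul_le_mul_of_nonneg_left ?_ (by positivity)
          refine ((hfej Y hY t ht1 ht2 hz _ _ (hasLength_resonator_mul_le k A hj) hexp).2).trans ?_
          exact mul_le_mul_of_nonneg_left (coeffNormSq_resonator_mul_le hA hj) (by positivity)
      _ = (∑ j ∈ Finset.range (J + 1), 1 / (blockExp A J j : ℝ)) * (11 / Y ^ 2 * Real.log Y * (Kw * Q)) :=
          (Finset.sum_mul _ _ _).symm
      _ ≤ D / A * (11 / Y ^ 2 * Real.log Y * (Kw * Q)) :=
          mul_le_mul_of_nonneg_right (sum_inv_blockExp_le A J) (by positivity)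
      _ = (44 * Kw * D) / A * (1 / (4 * Y ^ 2) * Real.log Y * Q) := by
          field_simp
          ring
      _ ≤ 1 * (1 / (4 * Y ^ 2) * Real.log Y * Q) :=
          mul_le_mul_of_nonneg_right (by rw [div_le_one (by linarith)]; exact hA3) (by positivity)
      _ = _ := one_mul _
  have hQge : 1 / 2 * (c1 * towerLog J ^ (k ^ 2)) ≤ Q := by
    refine le_trans ?_ (coeffNormSq_resonator_ge hA hA2 J)
    have h3 : 3 ≤ 2 ^ 2 ^ J := by
      have : 2 ^ 1 ≤ 2 ^ J := Nat.pow_le_pow_right (by norm_num) hJ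
      calc 3 ≤ 2 ^ 2 := by norm_num
        _ ≤ _ := Nat.pow_le_pow_right (by norm_num) this
    have := hprod _ h3
    exact mul_le_mul_of_nonneg_left this (by norm_num)
  calc _ = P * (1 / (4 * Y ^ 2) * Real.log Y * (1 / 2 * (c1 * towerLog J ^ (k ^ 2)))) := by
        rw [hP]
        field_simp
        ring
    _ ≤ P * (1 / (4 * Y ^ 2) * Real.log Y * Q) := by gcongr
    _ = P * (1 / (2 * Y ^ 2) * Real.log Y * Q - 1 / (4 * Y ^ 2) * Real.log Y * Q) := by ring
    _ ≤ _ := mul_le_mul_of_nonneg_left (by linarith) hP0.le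

theorem fejer_moment_ge (H : SimpleRH) {k : ℝ} (hk : 0 ≤ k) : ∃ c > 0, ∃ Y₀ ≥ (2:ℝ), ∀ Y ≥ Y₀, ∀ t : ℝ,
    5 / 4 * Y ^ 8 ≤ t → t ≤ 7 / 4 * Y ^ 8 → riemannZeta (1 / 2 + t * I) ≠ 0 →
    c / Y ^ 2 * Real.log Y ^ ((k - 1) ^ 2) ≤
      ∑ γ ∈ zetaWindow (Y ^ 8), fejer (1 / Y ^ 2) (t - γ) *
        ‖deriv riemannZeta (1 / 2 + (γ:ℝ) * I)‖ ^ (-(2 * k)) := by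
  obtain ⟨A, c, hc, Y₀, hY₀, h⟩ := fejer_moment_ge_of_tower H hk
  have hCA := one_le_lengthConst A
  set CA := lengthConst A with hCAdef
  have hl2 : 0 < Real.log 2 := Real.log_pos one_lt_two
  set r := Real.log 2 / (2 * CA) with hr
  have hr0 : 0 < r := by positivity
  refine ⟨c * r ^ ((k - 1) ^ 2), by positivity, max Y₀ (Real.exp (2 * CA)), le_max_of_le_left hY₀,
    fun Y hY t ht1 ht2 hz => ?_⟩
  have hY1 := (le_max_left _ _).trans hY
  have hY0 : 0 < Y := by linarith
  have hlog : 2 * CA ≤ Real.log Y := (Real.le_log_iff_exp_le hY0).mpr ((le_max_right _ _).trans hY)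
  have hCA0 : 0 < CA := by linarith
  have hlY : 0 < Real.log Y := by linarith
  have hge2 : 2 ≤ Real.log Y / CA := by rwa [le_div_iff₀ hCA0]
  obtain ⟨J, hJ1, hJ2⟩ := exists_nat_pow_near (by linarith : 1 ≤ Real.log Y / CA) one_lt_two
  rw [le_div_iff₀ hCA0] at hJ1
  rw [div_lt_iff₀ hCA0] at hJ2
  have hJ : 1 ≤ J := by
    by_contra hcon
    have : J = 0 := by omega
    subst this
    norm_num at hJ2
    linarith
  have hJ3 : Real.log Y ≤ 2 * CA * 2 ^ J := by rw [pow_succ] at hJ2; linarith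
  have h1 := h Y hY1 J hJ (by linarith) hJ3 t ht1 ht2 hz
  refine le_trans ?_ h1
  have hX := towerLog_pos J
  have hXle : towerLog J ≤ Real.log Y := by
    rw [towerLog_eq]
    refine le_trans ?_ hJ1
    have : Real.log 2 ≤ CA := by linarith [Real.log_two_lt_d9]
    gcongr
  have hXge : r * Real.log Y ≤ towerLog J := by
    rw [towerLog_eq, hr, div_mul_eq_mul_div, div_le_iff₀ (by positivity)]
    have := mul_le_mul_of_nonneg_left hJ3 hl2.le
    linarith
  have e : towerLog J * (towerLog J ^ (k ^ 2) * towerLog J ^ (-(2 * k))) = towerLog J ^ ((k - 1) ^ 2) := by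
    rw [← Real.rpow_add hX]
    nth_rewrite 1 [← Real.rpow_one (towerLog J)]
    rw [← Real.rpow_add hX]
    congr 1
    ring
  calc _ = c / Y ^ 2 * (r * Real.log Y) ^ ((k - 1) ^ 2) := by
        rw [Real.mul_rpow hr0.le hlY.le]
        ring
    _ ≤ c / Y ^ 2 * towerLog J ^ ((k - 1) ^ 2) := by
        refine mul_le_mul_of_nonneg_left ?_ (by positivity)
        exact Real.rpow_le_rpow (by positivity) hXge (sq_nonneg _)
    _ = c / Y ^ 2 * towerLog J * (towerLog J ^ (k ^ 2) * towerLog J ^ (-(2 * k))) := by rw [← e]; ring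
    _ ≤ _ := by gcongr

theorem fejer_le_lorentz {h : ℝ} (hh : 0 < h) (v : ℝ) : fejer h v ≤ 5 * h ^ 2 * (1 + (h * v) ^ 2)⁻¹ := by
  have h1 := fejer_le h v
  have h2 := fejer_le_sq h v
  have hpos : 0 < 1 + (h * v) ^ 2 := by positivity
  rw [← div_eq_mul_inv, le_div_iff₀ hpos]
  by_cases hv : (h * v) ^ 2 ≤ 4
  · calc _ ≤ h ^ 2 * 5 := mul_le_mul h2 (by linarith) hpos.le (sq_nonneg h)
      _ = _ := by ring
  · push Not at hv
    have hv0 : v ≠ 0 := by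
      rintro rfl
      norm_num at hv
    calc _ ≤ 4 * (1 / v ^ 2) * (1 + (h * v) ^ 2) := mul_le_mul_of_nonneg_right h1 hpos.le
      _ ≤ 4 * (1 / v ^ 2) * (5 / 4 * (h * v) ^ 2) := by gcongr; linarith
      _ = _ := by field_simp

theorem integral_lorentz_le {h : ℝ} (hh : 0 < h) (γ a b : ℝ) :
    ∫ t in a..b, 5 * h ^ 2 * (1 + (h * (t - γ)) ^ 2)⁻¹ ≤ 5 * h * Real.pi := by
  rw [intervalIntegral.integral_const_mul]
  have e : ∫ t in a..b, (1 + (h * (t - γ)) ^ 2)⁻¹ =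
      h⁻¹ * ∫ t in (h * a - h * γ)..(h * b - h * γ), (1 + t ^ 2)⁻¹ := by
    rw [← smul_eq_mul, ← intervalIntegral.integral_comp_mul_sub (fun t => (1 + t ^ 2)⁻¹) hh.ne' (h * γ)]
    refine intervalIntegral.integral_congr fun t _ => ?_
    rw [mul_sub]
  rw [e, integral_inv_one_add_sq]
  have h1 := Real.arctan_lt_pi_div_two (h * b - h * γ)
  have h2 := Real.neg_pi_div_two_lt_arctan (h * a - h * γ)
  calc _ ≤ 5 * h ^ 2 * (h⁻¹ * Real.pi) := by gcongr; linarith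
    _ = _ := by field_simp

theorem sum_zetaWindow_ge (H : SimpleRH) {k : ℝ} (hk : 0 ≤ k) : ∃ c > 0, ∃ Y₀ ≥ (2:ℝ), ∀ Y ≥ Y₀,
    c * Y ^ 8 * Real.log Y ^ ((k - 1) ^ 2) ≤
      ∑ γ ∈ zetaWindow (Y ^ 8), ‖deriv riemannZeta (1 / 2 + (γ:ℝ) * I)‖ ^ (-(2 * k)) := by
  obtain ⟨c, hc, Y₀, hY₀, h⟩ := fejer_moment_ge H hk
  refine ⟨c / (10 * Real.pi), by have := Real.pi_pos; positivity, Y₀, hY₀, fun Y hY => ?_⟩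
  have hY0 : 0 < Y := by linarith
  set w : zetaOrd → ℝ := fun γ => ‖deriv riemannZeta (1 / 2 + (γ:ℝ) * I)‖ ^ (-(2 * k)) with hw
  have hw0 : ∀ γ, 0 ≤ w γ := fun γ => Real.rpow_nonneg (norm_nonneg _) _
  have hh : 0 < 1 / Y ^ 2 := by positivity
  set K := c / Y ^ 2 * Real.log Y ^ ((k - 1) ^ 2) with hK
  have hcont : ∀ γ : zetaOrd, Continuous fun t : ℝ =>
      5 * (1 / Y ^ 2) ^ 2 * (1 + (1 / Y ^ 2 * (t - γ)) ^ 2)⁻¹ * w γ := fun γ => by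
    refine Continuous.mul (continuous_const.mul (Continuous.inv₀ (by fun_prop) fun t => ?_)) continuous_const
    positivity
  have hint : ∀ γ : zetaOrd, IntervalIntegrable (fun t : ℝ =>
      5 * (1 / Y ^ 2) ^ 2 * (1 + (1 / Y ^ 2 * (t - γ)) ^ 2)⁻¹ * w γ) MeasureTheory.volume
      (5 / 4 * Y ^ 8) (7 / 4 * Y ^ 8) := fun γ => (hcont γ).intervalIntegrable _ _
  have hle : (5 / 4 * Y ^ 8) ≤ 7 / 4 * Y ^ 8 := by
    have : 0 < Y ^ 8 := by positivity
    linarith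
  have hcount : (zetaOrd : Set ℝ).Countable := Set.countable_coe_iff.mp inferInstance
  have hae : ∀ᵐ t : ℝ, t ∉ zetaOrd := by
    have := hcount.measure_zero MeasureTheory.volume
    exact MeasureTheory.measure_eq_zero_iff_ae_notMem.mp this
  have hmono : ∫ _ in (5 / 4 * Y ^ 8)..(7 / 4 * Y ^ 8), K ≤
      ∫ t in (5 / 4 * Y ^ 8)..(7 / 4 * Y ^ 8), ∑ γ ∈ zetaWindow (Y ^ 8),
        5 * (1 / Y ^ 2) ^ 2 * (1 + (1 / Y ^ 2 * (t - γ)) ^ 2)⁻¹ * w γ := by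
    refine intervalIntegral.integral_mono_ae_restrict hle intervalIntegrable_const
      ((continuous_finsetSum _ fun γ _ => hcont γ).intervalIntegrable _ _) ?_
    rw [EventuallyLE, MeasureTheory.ae_restrict_iff' measurableSet_Icc]
    filter_upwards [hae] with t ht htI
    refine (h Y hY t htI.1 htI.2 ht).trans (Finset.sum_le_sum fun γ _ => ?_)
    exact mul_le_mul_of_nonneg_right (fejer_le_lorentz hh _) (hw0 γ)
  rw [intervalIntegral.integral_const, intervalIntegral.integral_finsetSum fun γ _ => hint γ, smul_eq_mul] at hmono
  have h2 : ∑ γ ∈ zetaWindow (Y ^ 8), ∫ t in (5 / 4 * Y ^ 8)..(7 / 4 * Y ^ 8),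
      5 * (1 / Y ^ 2) ^ 2 * (1 + (1 / Y ^ 2 * (t - γ)) ^ 2)⁻¹ * w γ ≤
      5 * (1 / Y ^ 2) * Real.pi * ∑ γ ∈ zetaWindow (Y ^ 8), w γ := by
    rw [Finset.mul_sum]
    refine Finset.sum_le_sum fun γ _ => ?_
    rw [intervalIntegral.integral_mul_const]
    exact mul_le_mul_of_nonneg_right (integral_lorentz_le hh _ _ _) (hw0 γ)
  have h3 := hmono.trans h2
  have hpi := Real.pi_pos
  have h4 : (7 / 4 * Y ^ 8 - 5 / 4 * Y ^ 8) * K =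
      5 * (1 / Y ^ 2) * Real.pi * (c / (10 * Real.pi) * Y ^ 8 * Real.log Y ^ ((k - 1) ^ 2)) := by
    rw [hK]
    field_simp
    ring
  rw [h4] at h3
  exact le_of_mul_le_mul_left h3 (by positivity)

theorem sum_zetaWindow_le_negativeMoment (H : SimpleRH) (k : ℝ) {U : ℝ} (hU : 0 < U) :
    ∑ γ ∈ zetaWindow U, ‖deriv riemannZeta (1 / 2 + (γ:ℝ) * I)‖ ^ (-(2 * k)) ≤ negativeMoment k (2 * U) := by
  unfold negativeMoment
  set Z := {ρ : ℂ // riemannZeta ρ = 0 ∧ 0 < ρ.re ∧ ρ.re < 1 ∧ 0 < ρ.im ∧ ρ.im ≤ 2 * U} with hZ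
  have hre : ∀ ρ : Z, (ρ : ℂ) = 1 / 2 + ((ρ : ℂ).im : ℂ) * I := by
    intro ρ
    obtain ⟨h1, h2, h3, _, _⟩ := ρ.2
    have h4 : (ρ : ℂ).re = 1 / 2 := by
      refine H.1 _ h1 ?_ ?_
      · rintro ⟨n, hn⟩
        rw [hn] at h2
        simp at h2
        have : (0:ℝ) ≤ n := Nat.cast_nonneg n
        linarith
      · intro h
        rw [h] at h3
        simp at h3
    apply Complex.ext
    · simpa using h4
    · simp
  have hfin : Finite Z := by
    have hf := (finite_zetaOrd_inter (2 * U)).to_subtype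
    refine Finite.of_injective (β := ↥(zetaOrd ∩ Set.Icc (-(2 * U)) (2 * U)))
      (fun ρ => ⟨(ρ : ℂ).im, ?_, ?_, ?_⟩) ?_
    · have h1 := ρ.2.1
      rw [hre ρ] at h1
      exact h1
    · have := ρ.2.2.2.2.1
      linarith
    · exact ρ.2.2.2.2.2
    · intro a b hab
      have h1 : (a : ℂ).im = (b : ℂ).im := congrArg Subtype.val hab
      apply Subtype.ext
      rw [hre a, hre b, h1]
  let φ : {γ // γ ∈ zetaWindow U} → Z := fun γ => ⟨1 / 2 + ((γ : zetaOrd) : ℝ) * I, (γ : zetaOrd).2,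
    by simp, by simp; norm_num, by
      have := (mem_zetaWindow.mp γ.2).1
      simp
      linarith, by
      have := (mem_zetaWindow.mp γ.2).2
      simp
      linarith⟩
  have hφ : Function.Injective φ := by
    intro a b hab
    have h1 := congrArg (fun z : Z => (z : ℂ).im) hab
    apply Subtype.ext
    apply Subtype.ext
    simpa [φ] using h1
  have hs : Summable fun ρ : Z => ‖deriv riemannZeta (ρ : ℂ)‖ ^ (-(2 * k)) := Summable.of_finite
  have h1 := hs.sum_le_tsum ((zetaWindow U).attach.map ⟨φ, hφ⟩) fun ρ _ =>
    Real.rpow_nonneg (norm_nonneg _) _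
  rw [Finset.sum_map] at h1
  refine le_trans (le_of_eq ?_) h1
  rw [← Finset.sum_attach]
  rfl

/-- Assuming RH and that all nontrivial zeros of `ζ` are simple, for any fixed
rational `k = a/b ≥ 0` one has `J_{-k}(T) ≫ T (log T)^{(k-1)²}`. -/
theorem negativeMoment_lower_bound
    (hRH : RiemannHypothesis)
    (hsimple : ∀ ρ : ℂ, riemannZeta ρ = 0 → 0 < ρ.re → ρ.re < 1 →
      deriv riemannZeta ρ ≠ 0)
    (a b : ℕ) (hb : 0 < b) :
    ∃ c > (0 : ℝ), ∃ T₀ > (0 : ℝ), ∀ T ≥ T₀,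
      c * T * Real.log T ^ (((a : ℝ) / b - 1) ^ 2) ≤ negativeMoment ((a : ℝ) / b) T := by
  have H : SimpleRH := ⟨hRH, hsimple⟩
  set k : ℝ := (a : ℝ) / b with hk
  obtain ⟨c, hc, Y₀, hY₀, h⟩ := sum_zetaWindow_ge H (k := k) (by positivity)
  refine ⟨c / 2 * (1 / 16) ^ ((k - 1) ^ 2), by positivity, max 4 (2 * Y₀ ^ 8), by positivity, fun T hT => ?_⟩
  have hT4 : 4 ≤ T := (le_max_left _ _).trans hT
  have hTY : 2 * Y₀ ^ 8 ≤ T := (le_max_right _ _).trans hT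
  set Y : ℝ := (T / 2) ^ (1 / 8 : ℝ) with hY
  have hT2 : 0 ≤ T / 2 := by linarith
  have hY8 : Y ^ 8 = T / 2 := by
    rw [hY, ← Real.rpow_natCast, ← Real.rpow_mul hT2]
    norm_num
  have hYge : Y₀ ≤ Y := by
    refine le_of_pow_le_pow_left₀ (n := 8) (by norm_num) (Real.rpow_nonneg hT2 _) ?_
    rw [hY8]
    linarith
  have h1 := h Y hYge
  rw [hY8] at h1
  have h2 := sum_zetaWindow_le_negativeMoment H k (by linarith : 0 < T / 2)
  rw [mul_div_cancel₀ T two_ne_zero] at h2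
  refine le_trans ?_ (h1.trans h2)
  have hlog : 1 / 16 * Real.log T ≤ Real.log Y := by
    rw [hY, Real.log_rpow (by linarith), Real.log_div (by linarith) two_ne_zero]
    have h3 : Real.log 4 ≤ Real.log T := Real.log_le_log (by norm_num) hT4
    have e4 : Real.log 4 = 2 * Real.log 2 := by
      rw [show (4:ℝ) = 2 ^ 2 by norm_num, Real.log_pow]
      norm_num
    linarith
  have hlT : 0 ≤ Real.log T := Real.log_nonneg (by linarith)
  calc _ = c * (T / 2) * (1 / 16 * Real.log T) ^ ((k - 1) ^ 2) := by
        rw [Real.mul_rpow (by norm_num) hlT]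
        ring
    _ ≤ _ := by
        refine mul_le_mul_of_nonneg_left ?_ (by positivity)
        exact Real.rpow_le_rpow (by positivity) hlog (sq_nonneg _)
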